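/- Let U_B ⊂ U(4) be a partially invertible universal set with invertible algebraic subset U_M and a = |U_M|/|U_B|. For every integer t ≥ 1, every 0 < ε_d < 1, and some constant 0 < C < 1: if n ≥ ⌊2.5·log₂(4t)⌋, ε' < 1 − P(t), k ≥ (10t + n²t − nt + n + log₂(1/ε')) / log₂(1/(1+(C−1)a)), and L ≥ (4nt + log₂(1/ε_d)) / log₂(1/(ε' + P(t))), then the random unitary ensemble block^L(B^k) on n qubits is an ε_d-approximate unitary t-design on U(2^n). -/

import Mathlib

open MeasureTheory Matrix
open scoped Classical ComplexOrder

noncomputable section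

/-- We equip the unitary group with its Borel σ-algebra. -/
instance unitaryGroupMeasurableSpace {ξ : Type*} [Fintype ξ] [DecidableEq ξ] :
    MeasurableSpace (Matrix.unitaryGroup ξ ℂ) := borel _

instance unitaryGroupBorelSpace {ξ : Type*} [Fintype ξ] [DecidableEq ξ] :
    BorelSpace (Matrix.unitaryGroup ξ ℂ) := ⟨rfl⟩

/-- The spectral-gap bound
`P(t) = (1 + (1/2)·(425·⌊log₂(4t)⌋²·t⁵·t^{3.1/ln 2})⁻¹)^{-1/3}`. -/
def Pgap (t : ℕ) : ℝ :=
  (1 + (1 / 2) * (425 * ((⌊Real.logb 2 (4 * t)⌋ : ℤ) : ℝ) ^ 2 * (t : ℝ) ^ 5 *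
      (t : ℝ) ^ ((3.1 : ℝ) / Real.log 2))⁻¹) ^ (-(1 / 3 : ℝ))

/-- The `t`-fold tensor (Kronecker) power `U^{⊗t}` of a matrix `U`. -/
def tpowMat {ξ : Type*} [Fintype ξ] (t : ℕ) (U : Matrix ξ ξ ℂ) :
    Matrix (Fin t → ξ) (Fin t → ξ) ℂ :=
  fun x y => ∏ s, U (x s) (y s)

/-- The Haar-averaged `t`-twirl `∫ U^{⊗t} ρ U^{†⊗t} dμ_H(U)`, defined entrywise. -/
def haarChannel {ξ : Type*} [Fintype ξ] [DecidableEq ξ] (t : ℕ)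
    (μH : Measure (Matrix.unitaryGroup ξ ℂ))
    (ρ : Matrix (Fin t → ξ) (Fin t → ξ) ℂ) :
    Matrix (Fin t → ξ) (Fin t → ξ) ℂ :=
  fun x y => ∫ U, (tpowMat t ((U : Matrix ξ ξ ℂ)) * ρ * (tpowMat t ((U : Matrix ξ ξ ℂ)))ᴴ) x y ∂μH

/-- The ensemble `{p i, V i}` is an `ε`-approximate unitary `t`-design (strong definition):
for every positive semidefinite `ρ`,
`(1−ε)·∫ U^{⊗t} ρ U^{†⊗t} dμ_H  ≤  Σ_i p_i V_i^{⊗t} ρ V_i^{†⊗t}  ≤  (1+ε)·∫ U^{⊗t} ρ U^{†⊗t} dμ_H`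
in the positive semidefinite order. -/
def IsApproxDesign {ξ : Type*} [Fintype ξ] [DecidableEq ξ] {ι : Type*} [Fintype ι]
    (t : ℕ) (ε : ℝ) (μH : Measure (Matrix.unitaryGroup ξ ℂ))
    (p : ι → ℝ) (V : ι → Matrix ξ ξ ℂ) : Prop :=
  ∀ ρ : Matrix (Fin t → ξ) (Fin t → ξ) ℂ, ρ.PosSemidef →
    (∑ i, (p i : ℂ) • (tpowMat t (V i) * ρ * (tpowMat t (V i))ᴴ)
        - ((1 - ε : ℝ) : ℂ) • haarChannel t μH ρ).PosSemidef ∧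
    (((1 + ε : ℝ) : ℂ) • haarChannel t μH ρ
        - ∑ i, (p i : ℂ) • (tpowMat t (V i) * ρ * (tpowMat t (V i))ᴴ)).PosSemidef

/-- Index of a pair of qubit basis states as a basis state of `ℂ⁴`. -/
def pairIdx (x y : Fin 2) : Fin 4 := ⟨2 * x.val + y.val, by omega⟩

/-- The `n`-qubit matrix which applies the two-qubit gate `U` to the (distinct) qubits
`q, q'` and acts as the identity on all other qubits. -/
def applyGate (n : ℕ) (q q' : Fin n) (U : Matrix (Fin 4) (Fin 4) ℂ) :
    Matrix (Fin n → Fin 2) (Fin n → Fin 2) ℂ :=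
  fun x y =>
    if (∀ r, r ≠ q → r ≠ q' → x r = y r) then
      U (pairIdx (x q) (x q')) (pairIdx (y q) (y q')) else 0

/-- One block: a first layer of nearest-neighbour two-qubit gates `f i` on qubit pairs
`(0,1), (2,3), …`, followed by a second layer of gates `g i` on qubit pairs
`(1,2), (3,4), …` (`n` even; odd `n` analogous, the last qubit pair being dropped). -/
def blockUnitary (n : ℕ)
    (f : Fin (n / 2) → Matrix (Fin 4) (Fin 4) ℂ)
    (g : Fin ((n - 1) / 2) → Matrix (Fin 4) (Fin 4) ℂ) :
    Matrix (Fin n → Fin 2) (Fin n → Fin 2) ℂ :=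
  (List.ofFn fun i : Fin ((n - 1) / 2) =>
      applyGate n ⟨2 * i.val + 1, by omega⟩ ⟨2 * i.val + 2, by omega⟩ (g i)).prod *
  (List.ofFn fun i : Fin (n / 2) =>
      applyGate n ⟨2 * i.val, by omega⟩ ⟨2 * i.val + 1, by omega⟩ (f i)).prod

/-- The product `U_{f 0} ⋯ U_{f (k-1)}` of a word of unitaries, as a `4 × 4` matrix. -/
def wordMat {k : ℕ} (f : Fin k → Matrix.unitaryGroup (Fin 4) ℂ) :
    Matrix (Fin 4) (Fin 4) ℂ :=
  (List.ofFn fun i => ((f i : Matrix (Fin 4) (Fin 4) ℂ))).prod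

set_option linter.unusedSectionVars false

section AbstractChain
variable {E : Type*} [NormedAddCommGroup E] [InnerProductSpace ℂ E] [FiniteDimensional ℂ E]

local notation "⟪" x "," y "⟫" => inner ℂ x y

/-- If `T` and its adjoint `T'` preserve `K`, then `T` commutes with the projection on `K`. -/
theorem commute_starProjection_of_mem (K : Submodule ℂ E) (T T' : E →L[ℂ] E)
    (hadj : ∀ x y, ⟪T x, y⟫ = ⟪x, T' y⟫)
    (h1 : ∀ x ∈ K, T x ∈ K) (h2 : ∀ x ∈ K, T' x ∈ K) : Commute T K.starProjection := by
  ext v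
  simp only [ContinuousLinearMap.mul_def, ContinuousLinearMap.comp_apply]
  symm
  have hmem : T (K.starProjection v) ∈ K := h1 _ (K.starProjection_apply_mem v)
  have horth : T v - T (K.starProjection v) ∈ Kᗮ := by
    rw [← map_sub, Submodule.mem_orthogonal']
    intro u hu
    rw [hadj]
    exact Submodule.starProjection_inner_eq_zero _ _ (h2 u hu)
  exact Submodule.eq_starProjection_of_mem_orthogonal hmem horth

theorem mem_of_commute_starProjection (K : Submodule ℂ E) (T : E →L[ℂ] E)
    (h : Commute T K.starProjection) {x : E} (hx : x ∈ K) : T x ∈ K := by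
  have h1 := congrArg (fun A : E →L[ℂ] E => A x) h.eq
  simp only [ContinuousLinearMap.mul_def, ContinuousLinearMap.comp_apply] at h1
  rw [Submodule.starProjection_eq_self_iff.2 hx] at h1
  exact Submodule.starProjection_eq_self_iff.1 h1.symm

/-- Common fixed space of the projections with index in `S`. -/
def chainFix (F : ℕ → Submodule ℂ E) (S : Set ℕ) : Submodule ℂ E := ⨅ i ∈ S, F i

/-- Projection on the common fixed space. -/
def chainProj (F : ℕ → Submodule ℂ E) (S : Set ℕ) : E →L[ℂ] E := (chainFix F S).starProjection

theorem mem_chainFix {F : ℕ → Submodule ℂ E} {S : Set ℕ} {x : E} :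
    x ∈ chainFix F S ↔ ∀ i ∈ S, x ∈ F i := by
  simp [chainFix, Submodule.mem_iInf]

theorem chainFix_anti {F : ℕ → Submodule ℂ E} {S S' : Set ℕ} (h : S ⊆ S') :
    chainFix F S' ≤ chainFix F S := by
  intro x hx
  rw [mem_chainFix] at *
  exact fun i hi => hx i (h hi)

theorem proj_symm (K : Submodule ℂ E) (x y : E) :
    ⟪K.starProjection x, y⟫ = ⟪x, K.starProjection y⟫ :=
  Submodule.inner_starProjection_left_eq_right K x y

theorem proj_idem (K : Submodule ℂ E) (x : E) :
    K.starProjection (K.starProjection x) = K.starProjection x :=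
  Submodule.starProjection_eq_self_iff.2 (K.starProjection_apply_mem x)

theorem proj_norm_le (K : Submodule ℂ E) (x : E) : ‖K.starProjection x‖ ≤ ‖x‖ :=
  Submodule.norm_starProjection_apply_le K x

theorem proj_pyth (K : Submodule ℂ E) (x : E) :
    ‖x - K.starProjection x‖ ^ 2 = ‖x‖ ^ 2 - ‖K.starProjection x‖ ^ 2 := by
  have h := Submodule.norm_sq_eq_add_norm_sq_starProjection x K
  rw [Submodule.starProjection_orthogonal_val] at h
  linarith

theorem chainProj_mem (F : ℕ → Submodule ℂ E) (S : Set ℕ) (x : E) :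
    chainProj F S x ∈ chainFix F S := Submodule.starProjection_apply_mem _ x

theorem chainProj_eq_self {F : ℕ → Submodule ℂ E} {S : Set ℕ} {x : E} :
    chainProj F S x = x ↔ x ∈ chainFix F S := Submodule.starProjection_eq_self_iff

theorem commute_chainProj (F : ℕ → Submodule ℂ E) (S : Set ℕ) (T T' : E →L[ℂ] E)
    (hadj : ∀ x y, ⟪T x, y⟫ = ⟪x, T' y⟫)
    (h1 : ∀ i ∈ S, Commute T (F i).starProjection)
    (h2 : ∀ i ∈ S, Commute T' (F i).starProjection) : Commute T (chainProj F S) := by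
  apply commute_starProjection_of_mem _ T T' hadj
  · intro x hx
    rw [mem_chainFix] at *
    exact fun i hi => mem_of_commute_starProjection _ _ (h1 i hi) (hx i hi)
  · intro x hx
    rw [mem_chainFix] at *
    exact fun i hi => mem_of_commute_starProjection _ _ (h2 i hi) (hx i hi)

theorem commute_chainProj_self (F : ℕ → Submodule ℂ E) (S : Set ℕ) (K : Submodule ℂ E)
    (h1 : ∀ i ∈ S, Commute K.starProjection (F i).starProjection) :
    Commute K.starProjection (chainProj F S) :=
  commute_chainProj F S _ K.starProjection (proj_symm K) h1 h1

theorem commute_chainProj_chainProj (F : ℕ → Submodule ℂ E) (S S' : Set ℕ)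
    (h : ∀ i ∈ S, ∀ j ∈ S', Commute (F i).starProjection (F j).starProjection) :
    Commute (chainProj F S) (chainProj F S') := by
  symm
  apply commute_chainProj_self F S (chainFix F S')
  intro i hi
  symm
  exact commute_chainProj_self F S' (F i) (h i hi)

theorem chainProj_union (F : ℕ → Submodule ℂ E) (S S' : Set ℕ)
    (h : Commute (chainProj F S) (chainProj F S')) :
    chainProj F (S ∪ S') = chainProj F S * chainProj F S' := by
  ext v
  simp only [ContinuousLinearMap.mul_def, ContinuousLinearMap.comp_apply]
  symm
  have hmem' : chainProj F S (chainProj F S' v) ∈ chainFix F S' :=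
    mem_of_commute_starProjection _ _ h (chainProj_mem F S' v)
  have hmem : chainProj F S (chainProj F S' v) ∈ chainFix F (S ∪ S') := by
    have := chainProj_mem F S (chainProj F S' v)
    rw [mem_chainFix] at *
    rintro i (hi | hi)
    · exact this i hi
    · exact hmem' i hi
  have horth : v - chainProj F S (chainProj F S' v) ∈ (chainFix F (S ∪ S'))ᗮ := by
    rw [Submodule.mem_orthogonal']
    intro u hu
    have hu1 : chainProj F S u = u := chainProj_eq_self.2 (chainFix_anti Set.subset_union_left hu)
    have hu2 : chainProj F S' u = u := chainProj_eq_self.2 (chainFix_anti Set.subset_union_right hu)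
    rw [inner_sub_left, chainProj, proj_symm]
    change _ - ⟪chainProj F S' v, chainProj F S u⟫ = 0
    rw [hu1, chainProj, proj_symm]
    change _ - ⟪v, chainProj F S' u⟫ = 0
    rw [hu2, sub_self]
  exact (Submodule.eq_starProjection_of_mem_orthogonal hmem horth).symm

theorem chainProj_of_subset (F : ℕ → Submodule ℂ E) {S S' : Set ℕ} (h : S ⊆ S') (v : E) :
    chainProj F S' (chainProj F S v) = chainProj F S' v := by
  have hmem : chainProj F S' v ∈ chainFix F S' := chainProj_mem F S' v
  refine (Submodule.eq_starProjection_of_mem_orthogonal hmem ?_).symm.symm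
  rw [Submodule.mem_orthogonal']
  intro u hu
  have hu1 : chainProj F S u = u := chainProj_eq_self.2 (chainFix_anti h hu)
  have hu2 : chainProj F S' u = u := chainProj_eq_self.2 hu
  rw [inner_sub_left, chainProj, proj_symm]
  change ⟪v, chainProj F S u⟫ - ⟪chainProj F S' v, u⟫ = 0
  rw [hu1, chainProj, proj_symm]
  change _ - ⟪v, chainProj F S' u⟫ = 0
  rw [hu2, sub_self]

theorem chainProj_of_subset' (F : ℕ → Submodule ℂ E) {S S' : Set ℕ} (h : S ⊆ S') (v : E) :
    chainProj F S (chainProj F S' v) = chainProj F S' v :=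
  chainProj_eq_self.2 (chainFix_anti h (chainProj_mem F S' v))

theorem chainProj_singleton (F : ℕ → Submodule ℂ E) (i : ℕ) :
    chainProj F {i} = (F i).starProjection := by
  have : chainFix F {i} = F i := by
    ext x; simp [mem_chainFix]
  rw [chainProj]; congr!

theorem chainProj_empty (F : ℕ → Submodule ℂ E) : chainProj F ∅ = 1 := by
  ext x
  exact chainProj_eq_self.2 (by simp [mem_chainFix])

end AbstractChain

section AbstractSpectral
variable {E : Type*} [NormedAddCommGroup E] [InnerProductSpace ℂ E] [FiniteDimensional ℂ E]

local notation "⟪" x "," y "⟫" => inner ℂ x y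

theorem exists_eigenbasis (T : E →L[ℂ] E) (hT : ∀ x y, ⟪T x, y⟫ = ⟪x, T y⟫) :
    ∃ (m : ℕ) (b : OrthonormalBasis (Fin m) ℂ E) (μ : Fin m → ℝ),
      ∀ i, T (b i) = (μ i : ℂ) • b i := by
  have hS : (T : E →ₗ[ℂ] E).IsSymmetric := hT
  exact ⟨_, hS.eigenvectorBasis rfl, hS.eigenvalues rfl, fun i => hS.apply_eigenvectorBasis rfl i⟩

theorem eigenbasis_inner {T : E →L[ℂ] E} (hT : ∀ x y, ⟪T x, y⟫ = ⟪x, T y⟫)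
    {m : ℕ} {b : OrthonormalBasis (Fin m) ℂ E} {μ : Fin m → ℝ}
    (h : ∀ i, T (b i) = (μ i : ℂ) • b i) (v : E) (i : Fin m) :
    ⟪b i, T v⟫ = (μ i : ℂ) * ⟪b i, v⟫ := by
  rw [← hT, h, inner_smul_left]; simp

/-- gap lemma: eigenvalues are zero or at least `g`. -/
theorem gap_of_eigenvalues (T : E →L[ℂ] E) (hT : ∀ x y, ⟪T x, y⟫ = ⟪x, T y⟫) (g : ℝ)
    (hg : ∀ (μ : ℝ) (v : E), v ≠ 0 → T v = (μ : ℂ) • v → μ = 0 ∨ g ≤ μ)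
    (K : Submodule ℂ E) (hK : ∀ v, T v = 0 → v ∈ K) (hg0 : 0 ≤ g) (v : E) :
    g * ‖v - K.starProjection v‖ ^ 2 ≤ (⟪v, T v⟫).re := by
  obtain ⟨m, b, μ, h⟩ := exists_eigenbasis T hT
  set w : E := ∑ i, (if μ i = 0 then ⟪b i, v⟫ else 0) • b i with hw
  have hwK : w ∈ K := by
    apply hK
    rw [hw, map_sum]
    apply Finset.sum_eq_zero
    intro i _
    rw [map_smul, h]
    split_ifs with h0
    · simp [h0]
    · simp
  have hwb : ∀ i, ⟪b i, w⟫ = if μ i = 0 then ⟪b i, v⟫ else 0 := by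
    intro i
    rw [hw, b.orthonormal.inner_right_fintype]
  have h1 : ‖v - K.starProjection v‖ ≤ ‖v - w‖ := by
    have : v - K.starProjection v = (v - w) - K.starProjection (v - w) := by
      rw [map_sub, Submodule.starProjection_eq_self_iff.2 hwK]; abel
    rw [this]
    have h2 := proj_pyth K (v - w)
    nlinarith [norm_nonneg (v - w), norm_nonneg ((v - w) - K.starProjection (v - w)),
      sq_nonneg ‖K.starProjection (v - w)‖]
  have h2 : g * ‖v - w‖ ^ 2 ≤ (⟪v, T v⟫).re := by
    rw [← b.sum_sq_norm_inner_right (v - w), ← b.sum_inner_mul_inner v (T v), Complex.re_sum,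
      Finset.mul_sum]
    apply Finset.sum_le_sum
    intro i _
    rw [eigenbasis_inner hT h, inner_sub_right, hwb]
    have e1 : (⟪v, b i⟫ * ((μ i : ℂ) * ⟪b i, v⟫)).re = μ i * ‖⟪b i, v⟫‖ ^ 2 := by
      rw [mul_left_comm, ← inner_conj_symm v (b i), mul_comm ((starRingEnd ℂ) _), Complex.mul_conj,
        ← Complex.ofReal_mul, Complex.ofReal_re, Complex.normSq_eq_norm_sq]
    rw [e1]
    split_ifs with h0
    · simp [h0]
    · rw [sub_zero]
      have hb : b i ≠ 0 := b.orthonormal.ne_zero i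
      rcases hg (μ i) (b i) hb (h i) with h3 | h3
      · exact absurd h3 h0
      · exact mul_le_mul_of_nonneg_right h3 (by positivity)
  have h3 : ‖v - K.starProjection v‖ ^ 2 ≤ ‖v - w‖ ^ 2 := by gcongr
  nlinarith

theorem pow_apply_eigen {T : E →L[ℂ] E} {μ : ℂ} {x : E} (h : T x = μ • x) (k : ℕ) :
    (T ^ k) x = μ ^ k • x := by
  induction k with
  | zero => simp
  | succ k ih =>
    rw [pow_succ', ContinuousLinearMap.mul_def, ContinuousLinearMap.comp_apply, ih, map_smul, h,
      smul_smul, pow_succ]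

/-- Functional calculus bound for polynomials. -/
theorem poly_bound (T : E →L[ℂ] E) (hT : ∀ x y, ⟪T x, y⟫ = ⟪x, T y⟫) (lam η : ℝ)
    (h0 : ∀ v, 0 ≤ (⟪v, T v⟫).re) (h1 : ∀ v, (⟪v, T v⟫).re ≤ lam * ‖v‖ ^ 2)
    (p : Polynomial ℝ) (hp : ∀ x, 0 ≤ x → x ≤ lam → |p.eval x| ≤ η) (v : E) (hη : 0 ≤ η) :
    ‖∑ k ∈ Finset.range (p.natDegree + 1), (p.coeff k : ℂ) • (T ^ k) v‖ ≤ η * ‖v‖ := by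
  obtain ⟨m, b, μ, h⟩ := exists_eigenbasis T hT
  set w := ∑ k ∈ Finset.range (p.natDegree + 1), (p.coeff k : ℂ) • (T ^ k) v with hw
  have hb : ∀ i (k : ℕ), ⟪b i, (T ^ k) v⟫ = (μ i : ℂ) ^ k * ⟪b i, v⟫ := by
    intro i k
    induction k with
    | zero => simp
    | succ k ih =>
      rw [pow_succ', ContinuousLinearMap.mul_def, ContinuousLinearMap.comp_apply,
        eigenbasis_inner hT h, ih]; ring
  have hwb : ∀ i, ⟪b i, w⟫ = ((p.eval (μ i) : ℝ) : ℂ) * ⟪b i, v⟫ := by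
    intro i
    rw [hw, inner_sum, Polynomial.eval_eq_sum_range]
    rw [Complex.ofReal_sum, Finset.sum_mul]
    apply Finset.sum_congr rfl
    intro k _
    rw [inner_smul_right, hb, Complex.ofReal_mul, Complex.ofReal_pow]; ring
  have hμ : ∀ i, 0 ≤ μ i ∧ μ i ≤ lam := by
    intro i
    have e : (⟪b i, T (b i)⟫).re = μ i := by
      rw [h, inner_smul_right, inner_self_eq_norm_sq_to_K, b.orthonormal.1 i]; simp
    have a1 := h0 (b i)
    have a2 := h1 (b i)
    rw [e] at a1 a2
    rw [b.orthonormal.1 i] at a2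
    exact ⟨a1, by simpa using a2⟩
  have : ‖w‖ ^ 2 ≤ (η * ‖v‖) ^ 2 := by
    rw [mul_pow, ← b.sum_sq_norm_inner_right w, ← b.sum_sq_norm_inner_right v, Finset.mul_sum]
    apply Finset.sum_le_sum
    intro i _
    rw [hwb, norm_mul, mul_pow]
    apply mul_le_mul_of_nonneg_right _ (by positivity)
    rw [Complex.norm_real, Real.norm_eq_abs]
    have := hp _ (hμ i).1 (hμ i).2
    gcongr
  exact le_of_sq_le_sq this (by positivity)

end AbstractSpectral

section AbstractDL
variable {E : Type*} [NormedAddCommGroup E] [InnerProductSpace ℂ E] [FiniteDimensional ℂ E]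

local notation "⟪" x "," y "⟫" => inner ℂ x y

/-- Far away projections commute. -/
def FarComm (F : ℕ → Submodule ℂ E) : Prop :=
  ∀ i j, i + 2 ≤ j → Commute (F i).starProjection (F j).starProjection

theorem FarComm.chain {F : ℕ → Submodule ℂ E} (hF : FarComm F) {S S' : Set ℕ}
    (h : ∀ i ∈ S, ∀ j ∈ S', i + 2 ≤ j ∨ j + 2 ≤ i) :
    Commute (chainProj F S) (chainProj F S') := by
  apply commute_chainProj_chainProj
  intro i hi j hj
  rcases h i hi j hj with h | h
  · exact hF i j h
  · exact (hF j i h).symm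

theorem commute_apply {T T' : E →L[ℂ] E} (h : Commute T T') (x : E) : T (T' x) = T' (T x) :=
  congrArg (fun A : E →L[ℂ] E => A x) h.eq

theorem proj_sub_norm_le (K : Submodule ℂ E) (x : E) : ‖x - K.starProjection x‖ ≤ ‖x‖ := by
  have h2 := proj_pyth K x
  nlinarith [norm_nonneg x, norm_nonneg (x - K.starProjection x), sq_nonneg ‖K.starProjection x‖]

theorem sum_range_two_mul (f : ℕ → ℝ) (N : ℕ) :
    ∑ i ∈ Finset.range (2 * N), f i = ∑ j ∈ Finset.range N, (f (2 * j) + f (2 * j + 1)) := by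
  induction N with
  | zero => simp
  | succ N ih =>
    rw [show 2 * (N + 1) = 2 * N + 1 + 1 by ring, Finset.sum_range_succ, Finset.sum_range_succ, ih,
      Finset.sum_range_succ]; ring

theorem telescope_two (a : ℕ → ℝ) (N : ℕ) (h : ∀ j, a (j + 1) ≤ a j) :
    ∑ j ∈ Finset.range N, (a (j - 1) - a (j + 1)) ≤ 2 * (a 0 - a N) := by
  have key : ∀ N, ∑ j ∈ Finset.range (N + 1), (a (j - 1) - a (j + 1))
      = 2 * a 0 - a N - a (N + 1) := by
    intro N
    induction N with
    | zero => simp; ring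
    | succ N ih => rw [Finset.sum_range_succ, ih]; simp; ring
  cases N with
  | zero => simp
  | succ N => rw [key]; linarith [h N]

/-- Key step of the detectability lemma. -/
theorem dl_sum (F : ℕ → Submodule ℂ E) (hF : FarComm F) (S : Set ℕ) (N : ℕ)
    (u : E) (hu : ∀ i ∈ S, Even i → u ∈ F i) (w : E)
    (hw : w = chainProj F {i | i ∈ S ∧ Odd i} u) :
    ∑ i ∈ Finset.range (2 * N), (if i ∈ S then ‖w - (F i).starProjection w‖ ^ 2 else 0)
      ≤ 2 * (‖u‖ ^ 2 - ‖w‖ ^ 2) := by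
  set O : Set ℕ := {i | i ∈ S ∧ Odd i} with hO
  let R : ℕ → E →L[ℂ] E := fun j => chainProj F {i | i ∈ O ∧ i < 2 * j}
  have hsub : ∀ j j', j ≤ j' → {i | i ∈ O ∧ i < 2 * j} ⊆ {i | i ∈ O ∧ i < 2 * j'} := by
    intro j j' h i hi
    exact ⟨hi.1, by have := hi.2; omega⟩
  have hRR : ∀ j j', j ≤ j' → R j' u = R j' (R j u) := by
    intro j j' h
    exact (chainProj_of_subset F (hsub j j' h) u).symm
  have hanti : ∀ j, ‖R (j + 1) u‖ ^ 2 ≤ ‖R j u‖ ^ 2 := by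
    intro j
    rw [hRR j (j + 1) (by omega)]
    gcongr
    exact proj_norm_le _ _
  have hR0 : R 0 u = u := by
    apply chainProj_eq_self.2
    rw [mem_chainFix]
    intro i hi
    exact absurd hi.2 (by omega)
  have hRN : ‖w‖ ^ 2 ≤ ‖R N u‖ ^ 2 := by
    have : w = chainProj F O (R N u) := by
      rw [hw]
      exact (chainProj_of_subset F (fun i hi => hi.1) u).symm
    rw [this]
    gcongr
    exact proj_norm_le _ _
  have htel := telescope_two (fun j => ‖R j u‖ ^ 2) N hanti
  simp only [hR0] at htel
  have hmain : ∑ i ∈ Finset.range (2 * N), (if i ∈ S then ‖w - (F i).starProjection w‖ ^ 2 else 0)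
      ≤ ∑ j ∈ Finset.range N, (‖R (j - 1) u‖ ^ 2 - ‖R (j + 1) u‖ ^ 2) := by
    rw [sum_range_two_mul]
    apply Finset.sum_le_sum
    intro j _
    have hodd : (if 2 * j + 1 ∈ S then ‖w - (F (2 * j + 1)).starProjection w‖ ^ 2 else 0) = 0 := by
      split_ifs with h
      · have : w ∈ F (2 * j + 1) := by
          have := chainProj_mem F O u
          rw [← hw, mem_chainFix] at this
          exact this _ ⟨h, ⟨j, rfl⟩⟩
        rw [Submodule.starProjection_eq_self_iff.2 this]; simp
      · rfl
    rw [hodd, add_zero]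
    have hRle : ‖R (j + 1) u‖ ^ 2 ≤ ‖R (j - 1) u‖ ^ 2 := by
      rw [hRR (j - 1) (j + 1) (by omega)]
      gcongr
      exact proj_norm_le _ _
    split_ifs with h
    · have hui : u ∈ F (2 * j) := hu _ h ⟨j, by ring⟩
      set G := (F (2 * j)).starProjection with hG
      let B := chainProj F {i | i ∈ O ∧ 2 * (j + 1) ≤ i}
      have hBc : Commute B G := by
        rw [hG, ← chainProj_singleton]
        apply hF.chain
        rintro i ⟨hi, hi'⟩ k rfl
        right; omega
      have hRc : Commute (R (j - 1)) G := by
        rw [hG, ← chainProj_singleton]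
        apply hF.chain
        rintro i ⟨hi, hi'⟩ k rfl
        left; omega
      have hwB : w = B (R (j + 1) u) := by
        have hOU : O = {i | i ∈ O ∧ 2 * (j + 1) ≤ i} ∪ {i | i ∈ O ∧ i < 2 * (j + 1)} := by
          ext i; simp only [Set.mem_union, Set.mem_ofPred_eq]
          constructor
          · intro hi
            rcases le_or_gt (2 * (j + 1)) i with h | h
            · exact Or.inl ⟨hi, h⟩
            · exact Or.inr ⟨hi, h⟩
          · rintro (h | h) <;> exact h.1
        rw [hw]
        conv_lhs => rw [hOU]
        rw [chainProj_union]
        · rfl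
        · apply hF.chain
          rintro i ⟨⟨_, hi1⟩, hi2⟩ k ⟨⟨_, hk1⟩, hk2⟩
          obtain ⟨x, rfl⟩ := hi1
          obtain ⟨y, rfl⟩ := hk1
          right; omega
      have e1 : w - G w = B (R (j + 1) u - G (R (j + 1) u)) := by
        rw [map_sub, ← hwB, commute_apply hBc, ← hwB]
      have e2 : R (j - 1) u - G (R (j - 1) u) = 0 := by
        rw [← commute_apply hRc, hG, Submodule.starProjection_eq_self_iff.2 hui, sub_self]
      set x := R (j - 1) u with hx
      have e3 : R (j + 1) u - G (R (j + 1) u) = (R (j + 1) x - x) - G (R (j + 1) x - x) := by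
        rw [map_sub, hRR (j - 1) (j + 1) (by omega), ← hx]
        have : R (j + 1) x - x - (G (R (j + 1) x) - G x) = R (j + 1) x - G (R (j + 1) x) - (x - G x) := by
          abel
        rw [this, e2, sub_zero]
      have n1 : ‖w - G w‖ ≤ ‖x - R (j + 1) x‖ := by
        rw [e1]
        refine (proj_norm_le _ _).trans ?_
        rw [e3]
        refine (proj_sub_norm_le _ _).trans ?_
        rw [norm_sub_rev]
      have n2 : ‖x - R (j + 1) x‖ ^ 2 = ‖x‖ ^ 2 - ‖R (j + 1) x‖ ^ 2 := proj_pyth _ _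
      rw [hRR (j - 1) (j + 1) (by omega), ← hx, ← n2]
      gcongr
    · linarith
  linarith

/-- Detectability lemma. -/
theorem detectability (F : ℕ → Submodule ℂ E) (hF : FarComm F) (S : Set ℕ) (N : ℕ)
    (γ : ℝ)
    (hgap : ∀ v, γ * ‖v - chainProj F S v‖ ^ 2 ≤
      ∑ i ∈ Finset.range (2 * N), (if i ∈ S then ‖v - (F i).starProjection v‖ ^ 2 else 0))
    (v : E) (hv : chainProj F S v = 0) :
    ‖chainProj F {i | i ∈ S ∧ Odd i} (chainProj F {i | i ∈ S ∧ Even i} v)‖ ^ 2 * (1 + γ / 2)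
      ≤ ‖v‖ ^ 2 := by
  set u := chainProj F {i | i ∈ S ∧ Even i} v with hu
  set w := chainProj F {i | i ∈ S ∧ Odd i} u with hw
  have h1 := dl_sum F hF S N u (by
    intro i hi he
    have := chainProj_mem F {i | i ∈ S ∧ Even i} v
    rw [mem_chainFix] at this
    exact this i ⟨hi, he⟩) w hw
  have h2 := hgap w
  have h3 : chainProj F S w = 0 := by
    rw [hw, chainProj_of_subset F (fun i hi => hi.1), hu, chainProj_of_subset F (fun i hi => hi.1), hv]
  rw [h3, sub_zero] at h2
  have h4 : ‖u‖ ^ 2 ≤ ‖v‖ ^ 2 := by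
    gcongr
    exact proj_norm_le _ _
  nlinarith

/-- Light cone lemma. -/
theorem light_cone (F : ℕ → Submodule ℂ E) (hF : FarComm F) (a b c : ℕ)
    (l : List (Set ℕ)) (hl : ∀ S ∈ l, (∀ i ∈ S, a ≤ i ∧ i < c) ∧
      ∀ i ∈ S, ∀ j ∈ S, i ≠ j → i + 2 ≤ j ∨ j + 2 ≤ i) :
    ∃ T : E →L[ℂ] E, chainProj F (Set.Ico a b) * (l.reverse.map (chainProj F)).prod =
        chainProj F (Set.Ico a b) * T ∧
      (∀ A : Set ℕ, (∀ i ∈ A, i + l.length < b) → Commute T (chainProj F A)) ∧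
      ∀ x, (∀ i, a ≤ i → i < c → b < i + l.length → x ∈ F i) → T x = x := by
  induction l with
  | nil => exact ⟨1, by simp, fun A _ => Commute.one_left _, fun x _ => rfl⟩
  | cons S l ih =>
    obtain ⟨T, h1, h2, h3⟩ := ih (fun S' hS' => hl S' (List.mem_cons_of_mem _ hS'))
    obtain ⟨hS1, hS2⟩ := hl S List.mem_cons_self
    set A : Set ℕ := {i | i ∈ S ∧ i + l.length < b} with hA
    set B : Set ℕ := {i | i ∈ S ∧ b ≤ i + l.length} with hB
    have hSAB : S = A ∪ B := by
      ext i; simp only [hA, hB, Set.mem_union, Set.mem_ofPred_eq]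
      constructor
      · intro hi
        rcases lt_or_ge (i + l.length) b with h | h
        · exact Or.inl ⟨hi, h⟩
        · exact Or.inr ⟨hi, h⟩
      · rintro (h | h) <;> exact h.1
    have hPS : chainProj F S = chainProj F A * chainProj F B := by
      conv_lhs => rw [hSAB]
      apply chainProj_union
      apply hF.chain
      intro i hi j hj
      apply hS2 i hi.1 j hj.1
      rintro rfl
      exact absurd hi.2 (by have := hj.2; omega)
    have hAl : chainProj F (Set.Ico a b) * chainProj F A = chainProj F (Set.Ico a b) := by
      ext x
      have hsub : A ⊆ Set.Ico a b := fun i hi => ⟨(hS1 i hi.1).1, by have := hi.2; omega⟩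
      exact chainProj_of_subset F hsub x
    refine ⟨T * chainProj F B, ?_, ?_, ?_⟩
    · rw [List.reverse_cons, List.map_append, List.prod_append, ← mul_assoc, h1]
      simp only [List.map_cons, List.map_nil, List.prod_cons, List.prod_nil, mul_one]
      rw [hPS, ← mul_assoc, mul_assoc _ T, (h2 A (fun i hi => hi.2)).eq, ← mul_assoc, hAl, mul_assoc]
    · intro A' hA'
      simp only [List.length_cons] at hA'
      apply Commute.mul_left
      · exact h2 A' (fun i hi => by have := hA' i hi; omega)
      · apply hF.chain
        intro i hi j hj
        have := hA' j hj
        have := hi.2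
        right; omega
    · intro x hx
      simp only [List.length_cons] at hx
      have hBx : chainProj F B x = x := by
        rw [chainProj_eq_self, mem_chainFix]
        intro i hi
        exact hx i (hS1 i hi.1).1 (hS1 i hi.1).2 (by have := hi.2; omega)
      rw [ContinuousLinearMap.mul_def, ContinuousLinearMap.comp_apply, hBx]
      exact h3 x (fun i h4 h5 h6 => hx i h4 h5 (by omega))

end AbstractDL

section AbstractOverlap
variable {E : Type*} [NormedAddCommGroup E] [InnerProductSpace ℂ E] [FiniteDimensional ℂ E]

local notation "⟪" x "," y "⟫" => inner ℂ x y

theorem cheb_lower (y : ℝ) (hy : 0 ≤ y) (q : ℕ) :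
    1 + (q : ℝ) ^ 2 * y ≤ (Polynomial.Chebyshev.T ℝ q).eval (1 + y) := by
  suffices h : 1 + (q : ℝ) ^ 2 * y ≤ (Polynomial.Chebyshev.T ℝ q).eval (1 + y) ∧
      (2 * q + 1) * y ≤ (Polynomial.Chebyshev.T ℝ (q + 1 : ℤ)).eval (1 + y) -
        (Polynomial.Chebyshev.T ℝ q).eval (1 + y) from h.1
  induction q with
  | zero => simp
  | succ q ih =>
    obtain ⟨h1, h2⟩ := ih
    have e := Polynomial.Chebyshev.T_add_two ℝ (q : ℤ)
    have e' : (Polynomial.Chebyshev.T ℝ ((q : ℤ) + 2)).eval (1 + y) =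
        2 * (1 + y) * (Polynomial.Chebyshev.T ℝ ((q : ℤ) + 1)).eval (1 + y) -
          (Polynomial.Chebyshev.T ℝ (q : ℤ)).eval (1 + y) := by
      rw [e]; simp
    push_cast
    rw [show (q : ℤ) + 1 + 1 = q + 2 by ring, e']
    set A := (Polynomial.Chebyshev.T ℝ ((q : ℤ) + 1)).eval (1 + y)
    set B := (Polynomial.Chebyshev.T ℝ (q : ℤ)).eval (1 + y)
    have hA : 1 ≤ A := by nlinarith [sq_nonneg (q : ℝ), mul_nonneg (sq_nonneg (q : ℝ)) hy, mul_nonneg (Nat.cast_nonneg (α := ℝ) q) hy]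
    constructor
    · nlinarith
    · nlinarith

/-- Layer list. -/
def layerList (A B : Set ℕ) : ℕ → List (Set ℕ)
  | 0 => []
  | k + 1 => A :: B :: A :: layerList A B k

theorem layerList_length (A B : Set ℕ) (k : ℕ) : (layerList A B k).length = 3 * k := by
  induction k with
  | zero => rfl
  | succ k ih => simp [layerList, ih]; ring

theorem layerList_mem (A B : Set ℕ) (k : ℕ) : ∀ S ∈ layerList A B k, S = A ∨ S = B := by
  induction k with
  | zero => simp [layerList]
  | succ k ih =>
    intro S hS
    simp only [layerList, List.mem_cons] at hS
    rcases hS with h | h | h | h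
    · exact Or.inl h
    · exact Or.inr h
    · exact Or.inl h
    · exact ih S h

theorem layerList_prod (F : ℕ → Submodule ℂ E) (A B : Set ℕ) (k : ℕ) :
    ((layerList A B k).reverse.map (chainProj F)).prod =
      (chainProj F A * (chainProj F B * chainProj F A)) ^ k := by
  induction k with
  | zero => simp [layerList]
  | succ k ih =>
    rw [pow_succ, ← ih]
    simp [layerList, List.map_append, List.prod_append]

theorem overlap_pow (F : ℕ → Submodule ℂ E) (hF : FarComm F) (a b' b c k : ℕ)
    (hk : b' + 3 * k ≤ b) (x : E) :
    chainProj F (Set.Ico a b)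
      (((chainProj F {i | i ∈ Set.Ico a c ∧ Even i} *
        (chainProj F {i | i ∈ Set.Ico a c ∧ Odd i} *
          chainProj F {i | i ∈ Set.Ico a c ∧ Even i})) ^ k) (chainProj F (Set.Ico b' c) x)) =
      chainProj F (Set.Ico a b) (chainProj F (Set.Ico b' c) x) := by
  obtain ⟨T, h1, -, h3⟩ := light_cone F hF a b c
    (layerList {i | i ∈ Set.Ico a c ∧ Even i} {i | i ∈ Set.Ico a c ∧ Odd i} k) (by
      intro S hS
      rcases layerList_mem _ _ _ S hS with rfl | rfl
      · refine ⟨fun i hi => hi.1, ?_⟩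
        rintro i ⟨_, ⟨u, rfl⟩⟩ j ⟨_, ⟨v, rfl⟩⟩ hij
        omega
      · refine ⟨fun i hi => hi.1, ?_⟩
        rintro i ⟨_, ⟨u, rfl⟩⟩ j ⟨_, ⟨v, rfl⟩⟩ hij
        omega)
  rw [layerList_prod, layerList_length] at *
  have h4 := congrArg (fun A : E →L[ℂ] E => A (chainProj F (Set.Ico b' c) x)) h1
  simp only [ContinuousLinearMap.mul_def, ContinuousLinearMap.comp_apply] at h4
  refine Eq.trans h4 ?_
  rw [h3]
  intro i hi1 hi2 hi3
  have := chainProj_mem F (Set.Ico b' c) x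
  rw [mem_chainFix] at this
  exact this i ⟨by omega, hi2⟩

theorem overlap (F : ℕ → Submodule ℂ E) (hF : FarComm F) (a b' b c q : ℕ)
    (ha : a ≤ b') (hb : b ≤ c) (hq : b' + 3 * q ≤ b) (γ : ℝ) (hγ : 0 ≤ γ)
    (hgap : ∀ v, γ * ‖v - chainProj F (Set.Ico a c) v‖ ^ 2 ≤
      ∑ i ∈ Finset.Ico a c, ‖v - (F i).starProjection v‖ ^ 2) (v : E) :
    ‖chainProj F (Set.Ico a b) (chainProj F (Set.Ico b' c) v) - chainProj F (Set.Ico a c) v‖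
      ≤ (1 / (1 + (q : ℝ) ^ 2 * γ)) * ‖v‖ := by
  set I := Set.Ico a c with hI
  set Pe := chainProj F {i | i ∈ I ∧ Even i} with hPe
  set Po := chainProj F {i | i ∈ I ∧ Odd i} with hPo
  set G := chainProj F I with hG
  set M := Pe * (Po * Pe) with hM
  have hgap' : ∀ v, γ * ‖v - G v‖ ^ 2 ≤
      ∑ i ∈ Finset.range (2 * c), (if i ∈ I then ‖v - (F i).starProjection v‖ ^ 2 else 0) := by
    intro v
    refine (hgap v).trans (le_of_eq ?_)
    rw [← Finset.sum_filter]
    apply Finset.sum_congr _ (fun _ _ => rfl)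
    ext i
    simp only [hI, Finset.mem_Ico, Finset.mem_filter, Finset.mem_range, Set.mem_Ico]
    omega
  have hdl := detectability F hF I c γ (by intro v; convert hgap' v)
  have hGe : ∀ x, G (Pe x) = G x := fun x => chainProj_of_subset F (fun i hi => hi.1) x
  have hGo : ∀ x, G (Po x) = G x := fun x => chainProj_of_subset F (fun i hi => hi.1) x
  have heG : ∀ x, Pe (G x) = G x := fun x => chainProj_of_subset' F (fun i hi => hi.1) x
  have hoG : ∀ x, Po (G x) = G x := fun x => chainProj_of_subset' F (fun i hi => hi.1) x
  have hMapp : ∀ x, M x = Pe (Po (Pe x)) := fun x => rfl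
  have hMG : ∀ x, M (G x) = G x := fun x => by rw [hMapp, heG, hoG, heG]
  have hGM : ∀ x, G (M x) = G x := fun x => by rw [hMapp, hGe, hGo, hGe]
  have hGG : ∀ x, G (G x) = G x := fun x => proj_idem _ x
  set M' := M - G with hM'
  have hM'app : ∀ x, M' x = M x - G x := fun x => rfl
  set lam : ℝ := 1 / (1 + γ / 2) with hlam
  have hpos : 0 < 1 + γ / 2 := by positivity
  have hs : ∀ x y, ⟪M' x, y⟫ = ⟪x, M' y⟫ := by
    intro x y
    rw [hM'app, hM'app, inner_sub_left, inner_sub_right, hMapp, hMapp]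
    rw [hPe, hPo, hG]
    simp only [chainProj, proj_symm]
  have hquad : ∀ v, (⟪v, M' v⟫).re = ‖Po (Pe (v - G v))‖ ^ 2 := by
    intro v
    have e1 : M' v = M (v - G v) := by rw [hM'app, map_sub, hMG]
    have e2 : ⟪v, M (v - G v)⟫ = ⟪v - G v, M (v - G v)⟫ := by
      have hGs : ∀ x y, ⟪G x, y⟫ = ⟪x, G y⟫ := proj_symm _
      have h0 : G (v - G v) = 0 := by rw [map_sub, hGG, sub_self]
      rw [inner_sub_left v (G v), hGs, hGM, h0, inner_zero_right, sub_zero]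
    rw [e1, e2, hMapp]
    set z := v - G v
    have e3 : ⟪z, Pe (Po (Pe z))⟫ = ⟪Po (Pe z), Po (Pe z)⟫ := by
      rw [hPe, chainProj, ← proj_symm]
      change ⟪Pe z, Po (Pe z)⟫ = ⟪Po (Pe z), Po (Pe z)⟫
      rw [hPo, chainProj, proj_symm, proj_idem]
    rw [e3, inner_self_eq_norm_sq_to_K]
    norm_cast
  have hq0 : ∀ v, 0 ≤ (⟪v, M' v⟫).re := fun v => by rw [hquad]; positivity
  have hq1 : ∀ v, (⟪v, M' v⟫).re ≤ lam * ‖v‖ ^ 2 := by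
    intro v
    rw [hquad, hlam]
    have h1 := hdl (v - G v) (by rw [map_sub, ← hG, hGG, sub_self])
    have h2 : ‖v - G v‖ ^ 2 ≤ ‖v‖ ^ 2 := by
      gcongr
      exact proj_sub_norm_le _ _
    rw [one_div, inv_mul_eq_div, le_div_iff₀ hpos]
    exact h1.trans h2
  -- Chebyshev polynomial
  set D : ℝ := (Polynomial.Chebyshev.T ℝ q).eval (1 + γ) with hD
  have hDl := cheb_lower γ hγ q
  rw [← hD] at hDl
  have hD1 : 0 < 1 + (q : ℝ) ^ 2 * γ := by positivity
  have hD0 : 0 < D := by linarith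
  set p : Polynomial ℝ := Polynomial.C D⁻¹ *
    (Polynomial.Chebyshev.T ℝ q).comp (Polynomial.C (2 * (1 + γ / 2)) * Polynomial.X - 1) with hp
  have hpev : ∀ x, p.eval x = D⁻¹ * (Polynomial.Chebyshev.T ℝ q).eval (2 * (1 + γ / 2) * x - 1) := by
    intro x; simp [hp]
  have hp1 : p.eval 1 = 1 := by
    rw [hpev, show 2 * (1 + γ / 2) * 1 - 1 = 1 + γ by ring, ← hD, inv_mul_cancel₀ hD0.ne']
  have hpdeg : p.natDegree ≤ q := by
    refine (Polynomial.natDegree_C_mul_le _ _).trans ?_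
    refine (Polynomial.natDegree_comp_le).trans ?_
    have h1 : (Polynomial.Chebyshev.T ℝ (q : ℤ)).natDegree = q := by
      rw [Polynomial.Chebyshev.natDegree_T]; simp
    have h2 : (Polynomial.C (2 * (1 + γ / 2)) * Polynomial.X - 1 : Polynomial ℝ).natDegree ≤ 1 := by
      compute_degree
    rw [h1]
    nlinarith
  have hpb : ∀ x, 0 ≤ x → x ≤ lam → |p.eval x| ≤ 1 / (1 + (q : ℝ) ^ 2 * γ) := by
    intro x hx0 hx1
    rw [hlam, le_div_iff₀ hpos] at hx1
    rw [hpev, abs_mul, abs_of_pos (inv_pos.2 hD0)]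
    have h1 := Polynomial.Chebyshev.abs_eval_T_real_le_one (q : ℤ)
      (x := 2 * (1 + γ / 2) * x - 1) (by rw [abs_le]; constructor <;> nlinarith)
    calc D⁻¹ * _ ≤ D⁻¹ * 1 := by gcongr
      _ ≤ _ := by
        rw [mul_one, one_div]
        gcongr
  set x := chainProj F (Set.Ico b' c) v - G v with hx
  have hGr : ∀ y, G (chainProj F (Set.Ico b' c) y) = G y := fun y =>
    chainProj_of_subset F (S := Set.Ico b' c) (S' := Set.Ico a c) (fun i hi => ⟨ha.trans hi.1, hi.2⟩) y
  have hGl : ∀ y, chainProj F (Set.Ico a b) (G y) = G y := fun y =>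
    chainProj_of_subset' F (S := Set.Ico a b) (S' := Set.Ico a c) (fun i hi => ⟨hi.1, hi.2.trans_le hb⟩) y
  have hGx : G x = 0 := by rw [hx, map_sub, hGr, hGG, sub_self]
  have hpow : ∀ k : ℕ, (M' ^ k) x = (M ^ k) x ∧ G ((M ^ k) x) = 0 := by
    intro k
    induction k with
    | zero => exact ⟨rfl, hGx⟩
    | succ k ih =>
      rw [pow_succ', pow_succ']
      simp only [ContinuousLinearMap.mul_def, ContinuousLinearMap.comp_apply]
      rw [ih.1, hGM]
      refine ⟨?_, ih.2⟩
      rw [hM'app, ih.2, sub_zero]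
  have hMGpow : ∀ k : ℕ, (M ^ k) (G v) = G v := by
    intro k
    induction k with
    | zero => rfl
    | succ k ih =>
      rw [pow_succ']
      simp only [ContinuousLinearMap.mul_def, ContinuousLinearMap.comp_apply]
      rw [ih, hMG]
  have hb1 := poly_bound M' hs lam _ hq0 hq1 p hpb x (by positivity)
  have hfin : chainProj F (Set.Ico a b) (∑ k ∈ Finset.range (p.natDegree + 1),
      (p.coeff k : ℂ) • (M' ^ k) x) =
      chainProj F (Set.Ico a b) (chainProj F (Set.Ico b' c) v) - G v := by
    rw [map_sum]
    have : ∀ k ∈ Finset.range (p.natDegree + 1),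
        chainProj F (Set.Ico a b) ((p.coeff k : ℂ) • (M' ^ k) x) =
        (p.coeff k : ℂ) • (chainProj F (Set.Ico a b) (chainProj F (Set.Ico b' c) v) - G v) := by
      intro k hk
      rw [map_smul, (hpow k).1, hx, map_sub, map_sub, hMGpow, hGl]
      rw [overlap_pow F hF a b' b c k (by rw [Finset.mem_range] at hk; omega) v]
    rw [Finset.sum_congr rfl this, ← Finset.sum_smul]
    have h1 : ∑ k ∈ Finset.range (p.natDegree + 1), (p.coeff k : ℂ) = 1 := by
      rw [Polynomial.eval_eq_sum_range] at hp1
      simp only [one_pow, mul_one] at hp1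
      rw [← Complex.ofReal_sum, hp1, Complex.ofReal_one]
    rw [h1, one_smul]
  rw [← hfin]
  refine (proj_norm_le _ _).trans (hb1.trans ?_)
  gcongr
  have : x = chainProj F (Set.Ico b' c) v - chainProj F I (chainProj F (Set.Ico b' c) v) := by
    rw [hx, ← hGr v]
  rw [this]
  exact (proj_sub_norm_le _ _).trans (proj_norm_le _ _)

end AbstractOverlap

section AbstractFNW
variable {E : Type*} [NormedAddCommGroup E] [InnerProductSpace ℂ E] [FiniteDimensional ℂ E]

local notation "⟪" x "," y "⟫" => inner ℂ x y

theorem proj_quad (K : Submodule ℂ E) (v : E) :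
    (⟪v, v - K.starProjection v⟫).re = ‖v - K.starProjection v‖ ^ 2 := by
  rw [proj_pyth, inner_sub_right, Complex.sub_re]
  have h1 : (⟪v, v⟫).re = ‖v‖ ^ 2 := by
    rw [inner_self_eq_norm_sq_to_K]; norm_cast
  have h2 : ⟪v, K.starProjection v⟫ = ⟪K.starProjection v, K.starProjection v⟫ := by
    rw [proj_symm, proj_idem]
  have h3 : (⟪K.starProjection v, K.starProjection v⟫).re = ‖K.starProjection v‖ ^ 2 := by
    rw [inner_self_eq_norm_sq_to_K]; norm_cast
  rw [h1, h2, h3]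

theorem norm_add_sq_c (x y : E) : ‖x + y‖ ^ 2 = ‖x‖ ^ 2 + 2 * (⟪x, y⟫).re + ‖y‖ ^ 2 :=
  norm_add_sq (𝕜 := ℂ) x y

theorem fnw_pair (K1 K2 K : Submodule ℂ E) (h1 : K ≤ K1) (h2 : K ≤ K2) (η : ℝ)
    (hη0 : 0 ≤ η) (hη1 : η ≤ 1)
    (h : ∀ v, ‖K1.starProjection (K2.starProjection v) - K.starProjection v‖ ≤ η * ‖v‖) (v : E) :
    -(η * (‖v - K1.starProjection v‖ ^ 2 + ‖v - K2.starProjection v‖ ^ 2)) ≤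
      2 * (⟪v - K1.starProjection v, v - K2.starProjection v⟫).re := by
  set P := K1.starProjection
  set Q := K2.starProjection
  set G := K.starProjection
  have hPG : ∀ x, P (G x) = G x := fun x =>
    Submodule.starProjection_eq_self_iff.2 (h1 (K.starProjection_apply_mem x))
  have hQG : ∀ x, Q (G x) = G x := fun x =>
    Submodule.starProjection_eq_self_iff.2 (h2 (K.starProjection_apply_mem x))
  have hGQ : ∀ x, G (Q x) = G x := by
    intro x
    apply ext_inner_right ℂ
    intro y
    rw [proj_symm, proj_symm, hQG, proj_symm]
  -- bound for vectors orthogonal to K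
  have key : ∀ x, G x = 0 → ‖P x‖ ^ 2 + ‖Q x‖ ^ 2 ≤ (1 + η) * ‖x‖ ^ 2 := by
    intro x hx
    have e1 : ⟪P x, Q x⟫ = ⟪P x, P (Q (Q x)) - G (Q x)⟫ := by
      have i1 : Q (Q x) = Q x := proj_idem K2 x
      have i2 : ⟪P x, P (Q x)⟫ = ⟪P (P x), Q x⟫ := (proj_symm K1 _ _).symm
      have i3 : P (P x) = P x := proj_idem K1 x
      rw [hGQ, hx, sub_zero, i1, i2, i3]
    have e2 : (⟪P x, Q x⟫).re ≤ η * (‖P x‖ * ‖Q x‖) := by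
      rw [e1]
      refine (Complex.re_le_norm _).trans ((norm_inner_le_norm _ _).trans ?_)
      have := h (Q x)
      nlinarith [norm_nonneg (P x)]
    have e3 : (⟪x, P x + Q x⟫).re = ‖P x‖ ^ 2 + ‖Q x‖ ^ 2 := by
      have a1 := proj_quad K1 x
      have a2 := proj_quad K2 x
      rw [proj_pyth, inner_sub_right, Complex.sub_re] at a1 a2
      have h1 : (⟪x, x⟫).re = ‖x‖ ^ 2 := by
        rw [inner_self_eq_norm_sq_to_K]; norm_cast
      rw [inner_add_right, Complex.add_re]
      linarith
    have e4 : (⟪x, P x + Q x⟫).re ≤ ‖x‖ * ‖P x + Q x‖ :=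
      (Complex.re_le_norm _).trans (norm_inner_le_norm _ _)
    have e5 : ‖P x + Q x‖ ^ 2 ≤ (1 + η) * (‖P x‖ ^ 2 + ‖Q x‖ ^ 2) := by
      rw [norm_add_sq_c]
      nlinarith [sq_nonneg (‖P x‖ - ‖Q x‖)]
    set s := ‖P x‖ ^ 2 + ‖Q x‖ ^ 2
    have hs0 : 0 ≤ s := by positivity
    have e6 : s ^ 2 ≤ ‖x‖ ^ 2 * ((1 + η) * s) := by
      calc s ^ 2 ≤ (‖x‖ * ‖P x + Q x‖) ^ 2 := by
            rw [← e3] at hs0 ⊢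
            gcongr
        _ = ‖x‖ ^ 2 * ‖P x + Q x‖ ^ 2 := by ring
        _ ≤ _ := by gcongr
    rcases eq_or_lt_of_le hs0 with h0 | h0
    · rw [← h0]; positivity
    · have : s * s ≤ ((1 + η) * ‖x‖ ^ 2) * s := by nlinarith
      exact le_of_mul_le_mul_right this h0
  set z := v - G v with hz
  have hGz : G z = 0 := by rw [hz, map_sub, proj_idem, sub_self]
  have hp : v - P v = z - P z := by rw [hz, map_sub, hPG]; abel
  have hq : v - Q v = z - Q z := by rw [hz, map_sub, hQG]; abel
  rw [hp, hq]
  set x := z - P z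
  set y := z - Q z
  have k1 := key z hGz
  have k2 : ‖x‖ ^ 2 = ‖z‖ ^ 2 - ‖P z‖ ^ 2 := proj_pyth K1 z
  have k3 : ‖y‖ ^ 2 = ‖z‖ ^ 2 - ‖Q z‖ ^ 2 := proj_pyth K2 z
  have k4 : (1 - η) * ‖z‖ ^ 2 ≤ ‖x‖ ^ 2 + ‖y‖ ^ 2 := by nlinarith
  have k5 : ‖x‖ ^ 2 + ‖y‖ ^ 2 = (⟪z, x + y⟫).re := by
    rw [inner_add_right, Complex.add_re, ← proj_quad K1 z, ← proj_quad K2 z]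
  have k6 : (⟪z, x + y⟫).re ≤ ‖z‖ * ‖x + y‖ :=
    (Complex.re_le_norm _).trans (norm_inner_le_norm _ _)
  have k7 : ‖x + y‖ ^ 2 = ‖x‖ ^ 2 + 2 * (⟪x, y⟫).re + ‖y‖ ^ 2 := norm_add_sq_c x y
  set X := ‖x‖ ^ 2 + ‖y‖ ^ 2 with hX
  have hX0 : 0 ≤ X := by positivity
  have k8 : X ^ 2 ≤ ‖z‖ ^ 2 * ‖x + y‖ ^ 2 := by
    rw [← mul_pow]
    have : X ≤ ‖z‖ * ‖x + y‖ := by linarith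
    gcongr
  have k9 : (1 - η) * X ≤ ‖x + y‖ ^ 2 := by
    rcases eq_or_lt_of_le hX0 with h0 | h0
    · rw [← h0]; simp
    · have : (1 - η) * X * X ≤ ‖x + y‖ ^ 2 * X := by
        have a1 : (1 - η) * X ^ 2 ≤ (1 - η) * (‖z‖ ^ 2 * ‖x + y‖ ^ 2) :=
          mul_le_mul_of_nonneg_left k8 (by linarith)
        nlinarith [mul_le_mul_of_nonneg_right k4 (sq_nonneg ‖x + y‖)]
      exact le_of_mul_le_mul_right this h0
  nlinarith

theorem commuting_pair (K1 K2 : Submodule ℂ E)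
    (hc : Commute K1.starProjection K2.starProjection) (v : E) :
    0 ≤ (⟪v - K1.starProjection v, v - K2.starProjection v⟫).re := by
  set P := K1.starProjection
  set Q := K2.starProjection
  -- = ‖(1-P)(1-Q) v‖²
  have e : ⟪v - P v, v - Q v⟫ = ⟪(v - Q v) - P (v - Q v), (v - Q v) - P (v - Q v)⟫ := by
    have h1 : ∀ x y, ⟪x - P x, y⟫ = ⟪x, y - P y⟫ := by
      intro x y
      rw [inner_sub_left, inner_sub_right, proj_symm]
    have h2 : ∀ x y, ⟪x - Q x, y⟫ = ⟪x, y - Q y⟫ := by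
      intro x y
      rw [inner_sub_left, inner_sub_right, proj_symm]
    have hPP : ∀ x, P (P x) = P x := proj_idem K1
    have hQQ : ∀ x, Q (Q x) = Q x := proj_idem K2
    have hPQ : ∀ x, P (Q x) = Q (P x) := commute_apply hc
    rw [h1, h1, h2]
    congr 1
    simp only [map_sub, hPP, hQQ, hPQ]
    abel
  rw [e]
  exact inner_self_nonneg (𝕜 := ℂ)

/-- Gap of a sum of complementary projections with small neighbour overlaps. -/
theorem fnw_chain (K : ℕ → Submodule ℂ E) (η : ℝ) (hη0 : 0 ≤ η) (hη1 : 2 * η ≤ 1)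
    (hfar : FarComm K)
    (hnear : ∀ k v, -(η * (‖v - (K k).starProjection v‖ ^ 2 + ‖v - (K (k + 1)).starProjection v‖ ^ 2)) ≤
      2 * (⟪v - (K k).starProjection v, v - (K (k + 1)).starProjection v⟫).re) (N : ℕ) (v : E) :
    (1 - 2 * η) * ‖v - chainProj K (Set.Iio N) v‖ ^ 2 ≤
      ∑ k ∈ Finset.range N, ‖v - (K k).starProjection v‖ ^ 2 := by
  let T : E →L[ℂ] E := ∑ k ∈ Finset.range N, (1 - (K k).starProjection)
  have hTapp : ∀ v, T v = ∑ k ∈ Finset.range N, (v - (K k).starProjection v) := by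
    intro v
    simp [T]
  have hTs : ∀ x y, ⟪T x, y⟫ = ⟪x, T y⟫ := by
    intro x y
    rw [hTapp, hTapp, sum_inner, inner_sum]
    apply Finset.sum_congr rfl
    intro k _
    rw [inner_sub_left, inner_sub_right, proj_symm]
  have hTq : ∀ v, (⟪v, T v⟫).re = ∑ k ∈ Finset.range N, ‖v - (K k).starProjection v‖ ^ 2 := by
    intro v
    rw [hTapp, inner_sum, Complex.re_sum]
    apply Finset.sum_congr rfl
    intro k _
    rw [proj_quad]
  have hsq : ∀ (N : ℕ) (v : E), (1 - 2 * η) * (∑ k ∈ Finset.range N, ‖v - (K k).starProjection v‖ ^ 2)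
      + (if N = 0 then 0 else η * ‖v - (K (N - 1)).starProjection v‖ ^ 2)
      ≤ ‖∑ k ∈ Finset.range N, (v - (K k).starProjection v)‖ ^ 2 := by
    intro N v
    induction N with
    | zero => simp
    | succ N ih =>
      rw [Finset.sum_range_succ, Finset.sum_range_succ, norm_add_sq_c]
      simp only [Nat.add_eq_zero_iff, one_ne_zero, and_false, if_false, Nat.add_sub_cancel]
      cases N with
      | zero =>
        simp
        nlinarith [sq_nonneg ‖v - (K 0).starProjection v‖]
      | succ N =>
        simp only [Nat.add_eq_zero_iff, one_ne_zero, and_false, if_false, Nat.add_sub_cancel] at ih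
        have h1 := hnear N v
        have h2 : (⟪v - (K N).starProjection v, v - (K (N + 1)).starProjection v⟫).re ≤
            (⟪∑ k ∈ Finset.range (N + 1), (v - (K k).starProjection v),
              v - (K (N + 1)).starProjection v⟫).re := by
          rw [Finset.sum_range_succ, inner_add_left, Complex.add_re, sum_inner, Complex.re_sum]
          have : 0 ≤ ∑ k ∈ Finset.range N, (⟪v - (K k).starProjection v,
              v - (K (N + 1)).starProjection v⟫).re := by
            apply Finset.sum_nonneg
            intro k hk
            rw [Finset.mem_range] at hk
            exact commuting_pair _ _ (hfar k (N + 1) (by omega)) v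
          linarith
        nlinarith
  rw [← hTq]
  refine gap_of_eigenvalues T hTs (1 - 2 * η) ?_ _ ?_ (by linarith) v
  · intro μ w hw hTw
    have h1 := hsq N w
    rw [← hTapp, hTw, ← hTq, hTw, inner_smul_right, inner_self_eq_norm_sq_to_K] at h1
    have h2 : ((μ : ℂ) * ((‖w‖ : ℝ) : ℂ) ^ 2).re = μ * ‖w‖ ^ 2 := by norm_cast
    have h0 : 0 ≤ (if N = 0 then 0 else η * ‖w - (K (N - 1)).starProjection w‖ ^ 2) := by
      split_ifs <;> positivity
    have h3 : 0 ≤ (⟪w, T w⟫).re := by rw [hTq]; positivity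
    rw [hTw, inner_smul_right, inner_self_eq_norm_sq_to_K] at h3
    erw [h2] at h1 h3
    rw [norm_smul, mul_pow, Complex.norm_real, Real.norm_eq_abs, sq_abs] at h1
    have hw2 : 0 < ‖w‖ ^ 2 := by positivity
    have hμ0 : 0 ≤ μ := nonneg_of_mul_nonneg_left h3 hw2
    by_cases hμ : μ = 0
    · exact Or.inl hμ
    · right
      have hμp : 0 < μ := lt_of_le_of_ne hμ0 (Ne.symm hμ)
      have : (1 - 2 * η) * (μ * ‖w‖ ^ 2) ≤ μ * (μ * ‖w‖ ^ 2) := by nlinarith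
      exact le_of_mul_le_mul_right this (by positivity)
  · intro w hw
    have h1 := hTq w
    rw [hw, inner_zero_right, Complex.zero_re] at h1
    rw [mem_chainFix]
    intro k hk
    have h2 := (Finset.sum_eq_zero_iff_of_nonneg (fun k _ => by positivity)).1 h1.symm k
      (Finset.mem_range.2 hk)
    have h3 : w - (K k).starProjection w = 0 := by simpa using h2
    exact Submodule.starProjection_eq_self_iff.1 (sub_eq_zero.1 h3).symm

theorem sum_blocks (f : ℕ → ℝ) (s N : ℕ) :
    ∑ k ∈ Finset.range N, ∑ i ∈ Finset.Ico (k * s) ((k + 1) * s), f i =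
      ∑ i ∈ Finset.range (N * s), f i := by
  induction N with
  | zero => simp
  | succ N ih =>
    rw [Finset.sum_range_succ, ih, Finset.sum_range_add_sum_Ico]
    nlinarith

/-- Uniform gap of the chain from the local gap. -/
theorem uniform_gap (F : ℕ → Submodule ℂ E) (hF : FarComm F) (A : ℝ) (hA : 0 < A)
    (hloc : ∀ a b v, a < b → ‖v - chainProj F (Set.Ico a b) v‖ ^ 2 ≤
      A * (b - a : ℕ) * ∑ i ∈ Finset.Ico a b, ‖v - (F i).starProjection v‖ ^ 2)
    (m : ℕ) (hm : ∀ i, m ≤ i → F i = ⊤)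
    (q : ℕ) (hq : 3 * (A * (9 * q + 2)) ≤ (q : ℝ) ^ 2) (v : E) :
    ‖v - chainProj F Set.univ v‖ ^ 2 ≤
      4 * (A * (6 * q + 1)) * ∑ i ∈ Finset.range m, ‖v - (F i).starProjection v‖ ^ 2 := by
  set s := 3 * q + 1 with hs
  set J : ℕ → Set ℕ := fun k => Set.Ico (k * s) (k * s + (6 * q + 1)) with hJ
  set K : ℕ → Submodule ℂ E := fun k => chainFix F (J k) with hK
  set N := m + 1 with hN
  have hfar : FarComm K := by
    intro k l hkl
    apply hF.chain
    intro i hi j hj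
    left
    have h1 := hi.2
    have h2 := hj.1
    have h3 : (k + 2) * s ≤ l * s := Nat.mul_le_mul_right _ hkl
    have h4 : (k + 2) * s = k * s + 2 * s := by ring
    omega
  have hnear : ∀ k v, -((1 / 4) * (‖v - (K k).starProjection v‖ ^ 2 + ‖v - (K (k + 1)).starProjection v‖ ^ 2)) ≤
      2 * (⟪v - (K k).starProjection v, v - (K (k + 1)).starProjection v⟫).re := by
    intro k
    have e1 : (k + 1) * s = k * s + s := by ring
    apply fnw_pair (K k) (K (k + 1)) (chainFix F (Set.Ico (k * s) ((k + 1) * s + (6 * q + 1))))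
    · apply chainFix_anti
      intro i hi
      exact ⟨hi.1, by have := hi.2; omega⟩
    · apply chainFix_anti
      intro i hi
      exact ⟨by have := hi.1; omega, hi.2⟩
    · norm_num
    · norm_num
    · intro v
      have h9 : (0 : ℝ) < A * (9 * q + 2) := by positivity
      have := overlap F hF (k * s) ((k + 1) * s) (k * s + (6 * q + 1)) ((k + 1) * s + (6 * q + 1)) q
        (by omega) (by omega) (by omega) (1 / (A * (9 * q + 2))) (by positivity) (by
          intro v
          have h1 := hloc (k * s) ((k + 1) * s + (6 * q + 1)) v (by omega)
          have h2 : (k + 1) * s + (6 * q + 1) - k * s = 9 * q + 2 := by omega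
          rw [h2] at h1
          rw [one_div, inv_mul_le_iff₀ h9]
          exact_mod_cast h1) v
      refine this.trans ?_
      gcongr
      have h3 : 3 ≤ (q : ℝ) ^ 2 * (1 / (A * (9 * q + 2))) := by
        rw [mul_one_div, le_div_iff₀ h9]; exact hq
      linarith
  have hch := fnw_chain K (1 / 4) (by norm_num) (by norm_num) hfar hnear N v
  have hcov : ∀ w, w ∈ chainFix K (Set.Iio N) → w ∈ chainFix F Set.univ := by
    intro w hw
    rw [mem_chainFix] at *
    intro i _
    by_cases hi : m ≤ i
    · rw [hm i hi]; trivial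
    · have hd : i / s < N := by
        have := Nat.div_le_self i s
        omega
      have := hw (i / s) hd
      rw [hK] at this
      simp only [mem_chainFix] at this
      apply this i
      have h1 := Nat.div_add_mod i s
      have h2 := Nat.mod_lt i (show 0 < s by omega)
      have h3 : i / s * s = s * (i / s) := by ring
      exact ⟨by omega, by omega⟩
  have hle : ‖v - chainProj F Set.univ v‖ ≤ ‖v - chainProj K (Set.Iio N) v‖ := by
    set w := chainProj K (Set.Iio N) v with hw
    have h1 : chainProj F Set.univ w = w := chainProj_eq_self.2 (hcov _ (chainProj_mem K _ v))
    have : v - chainProj F Set.univ v = (v - w) - chainProj F Set.univ (v - w) := by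
      rw [map_sub, h1]; abel
    rw [this]
    exact proj_sub_norm_le _ _
  have hf0 : ∀ i, m ≤ i → ‖v - (F i).starProjection v‖ ^ 2 = 0 := by
    intro i hi
    have : v ∈ F i := by rw [hm i hi]; trivial
    rw [Submodule.starProjection_eq_self_iff.2 this]; simp
  set f : ℕ → ℝ := fun i => ‖v - (F i).starProjection v‖ ^ 2 with hf
  have hfnn : ∀ i, 0 ≤ f i := fun i => by positivity
  have hbig : ∀ M, ∑ i ∈ Finset.range M, f i ≤ ∑ i ∈ Finset.range m, f i := by
    intro M
    have : ∑ i ∈ Finset.range m, f i = ∑ i ∈ Finset.range (max m M), f i := by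
      apply Finset.sum_subset
      · intro i; simp only [Finset.mem_range]; omega
      · intro i _ hi
        rw [Finset.mem_range] at hi
        exact hf0 i (by omega)
    rw [this]
    apply Finset.sum_le_sum_of_subset_of_nonneg
    · intro i; simp only [Finset.mem_range]; omega
    · intro i _ _; exact hfnn i
  have hsum : ∑ k ∈ Finset.range N, ∑ i ∈ Finset.Ico (k * s) (k * s + (6 * q + 1)), f i ≤
      2 * ∑ i ∈ Finset.range m, f i := by
    have h1 : ∀ k, ∑ i ∈ Finset.Ico (k * s) (k * s + (6 * q + 1)), f i ≤
        ∑ i ∈ Finset.Ico (k * s) ((k + 1) * s), f i +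
        ∑ i ∈ Finset.Ico ((k + 1) * s) ((k + 2) * s), f i := by
      intro k
      rw [Finset.sum_Ico_consecutive _ (by nlinarith) (by nlinarith)]
      apply Finset.sum_le_sum_of_subset_of_nonneg
      · apply Finset.Ico_subset_Ico_right
        have : (k + 2) * s = k * s + 2 * s := by ring
        omega
      · intro i _ _; exact hfnn i
    refine (Finset.sum_le_sum (fun k _ => h1 k)).trans ?_
    rw [Finset.sum_add_distrib, sum_blocks]
    have h2 : ∑ k ∈ Finset.range N, ∑ i ∈ Finset.Ico ((k + 1) * s) ((k + 2) * s), f i ≤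
        ∑ i ∈ Finset.range ((N + 1) * s), f i := by
      rw [← sum_blocks f s (N + 1), Finset.sum_range_succ' _ N]
      have : 0 ≤ ∑ i ∈ Finset.Ico (0 * s) ((0 + 1) * s), f i := Finset.sum_nonneg (fun i _ => hfnn i)
      have e : ∀ k, k + 1 + 1 = k + 2 := fun k => rfl
      simp only [e]
      linarith
    linarith [hbig (N * s), hbig ((N + 1) * s)]
  have hJgap : ∀ k, ‖v - (K k).starProjection v‖ ^ 2 ≤
      A * (6 * q + 1) * ∑ i ∈ Finset.Ico (k * s) (k * s + (6 * q + 1)), f i := by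
    intro k
    have h1 := hloc (k * s) (k * s + (6 * q + 1)) v (by omega)
    rw [Nat.add_sub_cancel_left] at h1
    push_cast at h1
    exact h1
  have h5 : ∑ k ∈ Finset.range N, ‖v - (K k).starProjection v‖ ^ 2 ≤
      A * (6 * q + 1) * (2 * ∑ i ∈ Finset.range m, f i) := by
    refine (Finset.sum_le_sum (fun k _ => hJgap k)).trans ?_
    rw [← Finset.mul_sum]
    gcongr
  have h6 : ‖v - chainProj F Set.univ v‖ ^ 2 ≤ ‖v - chainProj K (Set.Iio N) v‖ ^ 2 := by gcongr
  nlinarith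

/-- One-block contraction from a gap. -/
theorem block_contraction (F : ℕ → Submodule ℂ E) (hF : FarComm F)
    (m : ℕ) (γ : ℝ)
    (hgap : ∀ v, γ * ‖v - chainProj F Set.univ v‖ ^ 2 ≤
      ∑ i ∈ Finset.range m, ‖v - (F i).starProjection v‖ ^ 2) (v : E) :
    ‖chainProj F {i | Odd i} (chainProj F {i | Even i} v) - chainProj F Set.univ v‖ ^ 2 *
      (1 + γ / 2) ≤ ‖v‖ ^ 2 := by
  have h1 := detectability F hF Set.univ m γ (by
    intro v
    refine (hgap v).trans ?_
    simp only [Set.mem_univ, if_true]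
    apply Finset.sum_le_sum_of_subset_of_nonneg
    · intro i; simp only [Finset.mem_range]; omega
    · intro i _ _; positivity) (v - chainProj F Set.univ v) (by
      rw [map_sub]
      exact sub_eq_zero.2 (proj_idem _ v).symm)
  simp only [Set.mem_univ, true_and, map_sub] at h1
  rw [chainProj_of_subset' F (Set.subset_univ _), chainProj_of_subset' F (Set.subset_univ _)] at h1
  refine h1.trans ?_
  gcongr
  exact proj_sub_norm_le _ _

end AbstractFNW

section Tens
variable {ι X : Type*} [Fintype ι] [Fintype X] [DecidableEq ι] [DecidableEq X]

local notation "⟪" x "," y "⟫" => inner ℂ x y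

/-- Operator attached to a matrix. -/
def mop {J : Type*} [Fintype J] (M : Matrix J J ℂ) : EuclideanSpace ℂ J →L[ℂ] EuclideanSpace ℂ J :=
  Matrix.toEuclideanCLM (𝕜 := ℂ) M

section mop
variable {J : Type*} [Fintype J]

theorem mop_apply (M : Matrix J J ℂ) (v : EuclideanSpace ℂ J) (j : J) :
    mop M v j = ∑ k, M j k * v k := by
  rw [mop]
  change (WithLp.ofLp (Matrix.toEuclideanCLM (𝕜 := ℂ) M v)) j = _
  rw [Matrix.ofLp_toEuclideanCLM]
  rfl

theorem mop_mul (M N : Matrix J J ℂ) (v : EuclideanSpace ℂ J) :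
    mop (M * N) v = mop M (mop N v) := by
  simp [mop]

theorem mop_mul' (M N : Matrix J J ℂ) : mop (M * N) = mop M * mop N := by
  simp [mop]

theorem mop_one' [DecidableEq J] : mop (1 : Matrix J J ℂ) = 1 := by
  ext v j
  rw [mop_apply]
  simp [Matrix.one_apply]

theorem mop_one [DecidableEq J] (v : EuclideanSpace ℂ J) : mop (1 : Matrix J J ℂ) v = v := by
  rw [mop_one']; rfl

theorem mop_add (M N : Matrix J J ℂ) (v : EuclideanSpace ℂ J) :
    mop (M + N) v = mop M v + mop N v := by
  simp [mop]

theorem mop_sub (M N : Matrix J J ℂ) (v : EuclideanSpace ℂ J) :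
    mop (M - N) v = mop M v - mop N v := by
  simp [mop]

theorem mop_smul (c : ℂ) (M : Matrix J J ℂ) (v : EuclideanSpace ℂ J) :
    mop (c • M) v = c • mop M v := by
  simp [mop]

theorem mop_smul' (c : ℂ) (M : Matrix J J ℂ) : mop (c • M) = c • mop M := by
  simp [mop]

theorem mop_zero (v : EuclideanSpace ℂ J) : mop (0 : Matrix J J ℂ) v = 0 := by
  simp [mop]

theorem mop_sum {α : Type*} (s : Finset α) (f : α → Matrix J J ℂ) (v : EuclideanSpace ℂ J) :
    mop (∑ a ∈ s, f a) v = ∑ a ∈ s, mop (f a) v := by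
  simp [mop]

theorem mop_sum' {α : Type*} (s : Finset α) (f : α → Matrix J J ℂ) :
    mop (∑ a ∈ s, f a) = ∑ a ∈ s, mop (f a) := by
  simp [mop]

theorem mop_inner (M : Matrix J J ℂ) (x y : EuclideanSpace ℂ J) :
    ⟪mop M x, y⟫ = ⟪x, mop Mᴴ y⟫ := by
  have h : mop Mᴴ = ContinuousLinearMap.adjoint (mop M) := by
    rw [mop, mop, ← Matrix.star_eq_conjTranspose, map_star]
    rfl
  rw [h, ContinuousLinearMap.adjoint_inner_right]

theorem mop_norm_of_unitary [DecidableEq J] {M : Matrix J J ℂ} (h : Mᴴ * M = 1) (v : EuclideanSpace ℂ J) :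
    ‖mop M v‖ = ‖v‖ := by
  have h1 : ⟪mop M v, mop M v⟫ = ⟪v, v⟫ := by
    rw [mop_inner, ← mop_mul, h, mop_one]
  rw [inner_self_eq_norm_sq_to_K, inner_self_eq_norm_sq_to_K] at h1
  have h2 : ‖mop M v‖ ^ 2 = ‖v‖ ^ 2 := by exact_mod_cast h1
  exact (sq_eq_sq₀ (norm_nonneg _) (norm_nonneg _)).1 h2

end mop

/-- Tensor product of matrices. -/
def tens (M : ι → Matrix X X ℂ) : Matrix (ι → X) (ι → X) ℂ := fun x y => ∏ i, M i (x i) (y i)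

theorem tens_mul (M N : ι → Matrix X X ℂ) : tens M * tens N = tens (fun i => M i * N i) := by
  ext x y
  simp only [tens, Matrix.mul_apply]
  rw [Finset.prod_univ_sum]
  simp only [Fintype.piFinset_univ]
  apply Finset.sum_congr rfl
  intro z _
  rw [Finset.prod_mul_distrib]

theorem tens_one : tens (fun _ : ι => (1 : Matrix X X ℂ)) = 1 := by
  ext x y
  rw [tens, Matrix.one_apply]
  split_ifs with h
  · subst h; simp
  · obtain ⟨i, hi⟩ := Function.ne_iff.1 h
    exact Finset.prod_eq_zero (Finset.mem_univ i) (Matrix.one_apply_ne hi)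

theorem tens_conjTranspose (M : ι → Matrix X X ℂ) : (tens M)ᴴ = tens (fun i => (M i)ᴴ) := by
  ext x y
  simp [tens, Matrix.conjTranspose_apply]

theorem tens_update_add (M : ι → Matrix X X ℂ) (s : ι) (A B : Matrix X X ℂ) :
    tens (Function.update M s (A + B)) = tens (Function.update M s A) + tens (Function.update M s B) := by
  ext x y
  have h : ∀ C : Matrix X X ℂ, tens (Function.update M s C) x y =
      C (x s) (y s) * ∏ i ∈ Finset.univ.erase s, M i (x i) (y i) := by
    intro C
    rw [tens, ← Finset.mul_prod_erase _ _ (Finset.mem_univ s), Function.update_self]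
    congr 1
    apply Finset.prod_congr rfl
    intro i hi
    rw [Function.update_of_ne (Finset.ne_of_mem_erase hi)]
  rw [Matrix.add_apply, h, h, h, Matrix.add_apply, add_mul]

theorem tens_update_smul (M : ι → Matrix X X ℂ) (s : ι) (c : ℂ) (A : Matrix X X ℂ) :
    tens (Function.update M s (c • A)) = c • tens (Function.update M s A) := by
  ext x y
  have h : ∀ C : Matrix X X ℂ, tens (Function.update M s C) x y =
      C (x s) (y s) * ∏ i ∈ Finset.univ.erase s, M i (x i) (y i) := by
    intro C
    rw [tens, ← Finset.mul_prod_erase _ _ (Finset.mem_univ s), Function.update_self]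
    congr 1
    apply Finset.prod_congr rfl
    intro i hi
    rw [Function.update_of_ne (Finset.ne_of_mem_erase hi)]
  rw [Matrix.smul_apply, h, h, Matrix.smul_apply, smul_eq_mul, smul_eq_mul, mul_assoc]

theorem tens_diagonal (d : ι → X → ℂ) :
    tens (fun i => Matrix.diagonal (d i)) = Matrix.diagonal (fun w => ∏ i, d i (w i)) := by
  ext x y
  rw [tens, Matrix.diagonal_apply]
  split_ifs with h
  · subst h; simp
  · obtain ⟨i, hi⟩ := Function.ne_iff.1 h
    exact Finset.prod_eq_zero (Finset.mem_univ i) (Matrix.diagonal_apply_ne _ hi)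

/-- Operator acting on one tensor factor. -/
def site (s : ι) : Matrix X X ℂ →ₗ[ℂ] Matrix (ι → X) (ι → X) ℂ where
  toFun A := tens (Function.update (fun _ => 1) s A)
  map_add' A B := tens_update_add _ _ _ _
  map_smul' c A := tens_update_smul _ _ _ _

theorem site_def (s : ι) (A : Matrix X X ℂ) :
    site s A = tens (Function.update (fun _ => 1) s A) := rfl

theorem site_one (s : ι) : site s (1 : Matrix X X ℂ) = 1 := by
  rw [site_def, ← tens_one]
  congr 1
  ext1 i
  by_cases h : i = s
  · subst h; simp
  · rw [Function.update_of_ne h]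

theorem site_mul (s : ι) (A B : Matrix X X ℂ) : site s A * site s B = site s (A * B) := by
  simp only [site_def]
  rw [tens_mul]
  congr 1
  ext1 i
  by_cases h : i = s
  · subst h; simp
  · simp [Function.update_of_ne h]

theorem site_comm {s s' : ι} (h : s ≠ s') (A B : Matrix X X ℂ) :
    site s A * site s' B = site s' B * site s A := by
  simp only [site_def]
  rw [tens_mul, tens_mul]
  congr 1
  ext1 i
  by_cases h1 : i = s
  · subst h1; simp [Function.update_of_ne h]
  · simp [Function.update_of_ne h1]

theorem site_conjTranspose (s : ι) (A : Matrix X X ℂ) : (site s A)ᴴ = site s Aᴴ := by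
  simp only [site_def]
  rw [tens_conjTranspose]
  congr 1
  ext1 i
  by_cases h : i = s
  · subst h; simp
  · simp [Function.update_of_ne h]

theorem site_diagonal (s : ι) (d : X → ℂ) :
    site s (Matrix.diagonal d) = Matrix.diagonal (fun w : ι → X => d (w s)) := by
  have h : (Function.update (fun _ => 1) s (Matrix.diagonal d) : ι → Matrix X X ℂ) =
      fun i => Matrix.diagonal (Function.update (fun _ _ => (1 : ℂ)) s d i) := by
    ext1 i
    by_cases h : i = s
    · subst h; simp
    · simp only [Function.update_of_ne h]
      rw [Matrix.diagonal_one]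
  rw [site_def, h, tens_diagonal]
  congr 1
  ext w
  rw [← Finset.mul_prod_erase _ _ (Finset.mem_univ s), Function.update_self]
  rw [Finset.prod_eq_one, mul_one]
  intro i hi
  rw [Function.update_of_ne (Finset.ne_of_mem_erase hi)]

theorem tens_mul_site (N : ι → Matrix X X ℂ) (s : ι) (A A' : Matrix X X ℂ)
    (h : N s * A = A' * N s) : tens N * site s A = site s A' * tens N := by
  simp only [site_def]
  rw [tens_mul, tens_mul]
  congr 1
  ext1 i
  by_cases h1 : i = s
  · subst h1; simp [h]
  · simp [Function.update_of_ne h1]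

/-- The twirl operator on the doubled tensor power. -/
def Phi (t : ℕ) (U : Matrix X X ℂ) : Matrix (Fin t ⊕ Fin t → X) (Fin t ⊕ Fin t → X) ℂ :=
  tens (Sum.elim (fun _ => U) (fun _ => U.map star))

theorem Phi_mul (t : ℕ) (U V : Matrix X X ℂ) : Phi t (U * V) = Phi t U * Phi t V := by
  rw [Phi, Phi, Phi, tens_mul]
  congr 1
  ext1 i
  rcases i with i | i
  · rfl
  · simp only [Sum.elim_inr]
    exact Matrix.map_mul (f := starRingEnd ℂ)

theorem Phi_one (t : ℕ) : Phi t (1 : Matrix X X ℂ) = 1 := by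
  rw [Phi, ← tens_one]
  congr 1
  ext1 i
  rcases i with i | i
  · rfl
  · simp only [Sum.elim_inr]
    rw [Matrix.map_one] <;> simp

theorem Phi_conjTranspose (t : ℕ) (U : Matrix X X ℂ) : (Phi t U)ᴴ = Phi t Uᴴ := by
  rw [Phi, Phi, tens_conjTranspose]
  congr 1
  ext1 i
  rcases i with i | i
  · rfl
  · simp only [Sum.elim_inr]
    ext x y
    simp [Matrix.conjTranspose_apply]

theorem Phi_diagonal (t : ℕ) (d : X → ℂ) :
    Phi t (Matrix.diagonal d) = Matrix.diagonal (fun w : Fin t ⊕ Fin t → X =>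
      ∏ s, d (w (Sum.inl s)) * star (d (w (Sum.inr s)))) := by
  have h : (Sum.elim (fun _ => Matrix.diagonal d) (fun _ => (Matrix.diagonal d).map star) :
      Fin t ⊕ Fin t → Matrix X X ℂ) =
      fun i => Matrix.diagonal (Sum.elim (fun _ => d) (fun _ => star d) i : X → ℂ) := by
    ext1 i
    rcases i with i | i
    · rfl
    · simp only [Sum.elim_inr]
      rw [Matrix.diagonal_map (by simp)]
      rfl
  rw [Phi, h, tens_diagonal]
  congr 1
  ext w
  rw [Fintype.prod_sum_type, Finset.prod_mul_distrib]
  rfl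

/-- The infinitesimal twirl. -/
def dpi (t : ℕ) : Matrix X X ℂ →ₗ[ℂ] Matrix (Fin t ⊕ Fin t → X) (Fin t ⊕ Fin t → X) ℂ where
  toFun A := ∑ s : Fin t, (site (Sum.inl s) A - site (Sum.inr s) Aᵀ)
  map_add' A B := by
    rw [← Finset.sum_add_distrib]
    apply Finset.sum_congr rfl
    intro s _
    rw [Matrix.transpose_add, map_add, map_add]; abel
  map_smul' c A := by
    rw [Finset.smul_sum]
    apply Finset.sum_congr rfl
    intro s _
    rw [Matrix.transpose_smul, map_smul, map_smul, RingHom.id_apply, smul_sub]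

theorem dpi_def (t : ℕ) (A : Matrix X X ℂ) :
    dpi t A = ∑ s : Fin t, (site (Sum.inl s) A - site (Sum.inr s) Aᵀ) := rfl

theorem dpi_conjTranspose (t : ℕ) (A : Matrix X X ℂ) : (dpi t A)ᴴ = dpi t Aᴴ := by
  rw [dpi_def, dpi_def, Matrix.conjTranspose_sum]
  apply Finset.sum_congr rfl
  intro s _
  rw [Matrix.conjTranspose_sub, site_conjTranspose, site_conjTranspose]
  rfl

theorem dpi_one (t : ℕ) : dpi t (1 : Matrix X X ℂ) = 0 := by
  rw [dpi_def]
  apply Finset.sum_eq_zero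
  intro s _
  rw [Matrix.transpose_one, site_one, site_one, sub_self]

theorem dpi_comm (t : ℕ) (A B : Matrix X X ℂ) :
    dpi t A * dpi t B - dpi t B * dpi t A = dpi t (A * B - B * A) := by
  have key : ∀ s s' : Fin t, (site (Sum.inl s) A - site (Sum.inr s) Aᵀ) *
      (site (Sum.inl s') B - site (Sum.inr s') Bᵀ) - (site (Sum.inl s') B - site (Sum.inr s') Bᵀ) *
      (site (Sum.inl s) A - site (Sum.inr s) Aᵀ) =
      if s = s' then (site (Sum.inl s) (A * B - B * A) - site (Sum.inr s) (A * B - B * A)ᵀ) else 0 := by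
    intro s s'
    have hlr : ∀ (a b : Fin t) (M N : Matrix X X ℂ), site (Sum.inl a : Fin t ⊕ Fin t) M * site (Sum.inr b) N =
        site (Sum.inr b) N * site (Sum.inl a) M := fun a b M N => site_comm (by simp) M N
    simp only [mul_sub, sub_mul]
    split_ifs with h
    · subst h
      rw [hlr s s A Bᵀ, hlr s s B Aᵀ]
      simp only [site_mul, map_sub, Matrix.transpose_sub, Matrix.transpose_mul]
      abel
    · rw [hlr s s' A Bᵀ, hlr s' s B Aᵀ, site_comm (by simpa using h) A B, site_comm (by simpa using h) Aᵀ Bᵀ]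
      abel
  rw [dpi_def, dpi_def, dpi_def, Finset.sum_mul_sum, Finset.sum_mul_sum]
  conv_lhs => rw [Finset.sum_comm]
  rw [← Finset.sum_sub_distrib]
  have : ∀ j : Fin t, (∑ i, (site (Sum.inl i) A - site (Sum.inr i) Aᵀ) *
      (site (Sum.inl j) B - site (Sum.inr j) Bᵀ) - ∑ i, (site (Sum.inl j) B - site (Sum.inr j) Bᵀ) *
      (site (Sum.inl i) A - site (Sum.inr i) Aᵀ)) =
      (site (Sum.inl j) (A * B - B * A) - site (Sum.inr j) (A * B - B * A)ᵀ) := by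
    intro j
    rw [← Finset.sum_sub_distrib]
    simp only [key]
    simp
  exact Finset.sum_congr rfl (fun j _ => this j)

theorem dpi_diagonal (t : ℕ) (d : X → ℂ) :
    dpi t (Matrix.diagonal d) = Matrix.diagonal (fun w : Fin t ⊕ Fin t → X =>
      ∑ s, (d (w (Sum.inl s)) - d (w (Sum.inr s)))) := by
  rw [dpi_def]
  simp only [Matrix.diagonal_transpose, site_diagonal]
  ext x y
  rw [Matrix.sum_apply]
  by_cases h : x = y
  · subst h; simp
  · simp [h]

theorem Phi_dpi (t : ℕ) (V A A' : Matrix X X ℂ) (h : V * A = A' * V)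
    (h' : A * Vᴴ = Vᴴ * A') : Phi t V * dpi t A = dpi t A' * Phi t V := by
  rw [dpi_def, dpi_def, Finset.mul_sum, Finset.sum_mul]
  apply Finset.sum_congr rfl
  intro s _
  rw [mul_sub, sub_mul, Phi, tens_mul_site _ (Sum.inl s) A A' h, tens_mul_site _ (Sum.inr s) Aᵀ A'ᵀ]
  have e : V.map star = (Vᴴ)ᵀ := by
    ext x y; rfl
  simp only [Sum.elim_inr]
  rw [e, ← Matrix.transpose_mul, ← Matrix.transpose_mul, h']

theorem Phi_unitary (t : ℕ) {U : Matrix X X ℂ} (h : Uᴴ * U = 1) : (Phi t U)ᴴ * Phi t U = 1 := by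
  rw [Phi_conjTranspose, ← Phi_mul, h, Phi_one]

theorem site_norm {s : ι} {A : Matrix X X ℂ} (h : Aᴴ * A = 1) (v : EuclideanSpace ℂ (ι → X)) :
    ‖mop (site s A) v‖ = ‖v‖ := by
  apply mop_norm_of_unitary
  rw [site_conjTranspose, site_mul, h, site_one]

theorem dpi_norm (t : ℕ) {A : Matrix X X ℂ} (h : Aᴴ * A = 1)
    (v : EuclideanSpace ℂ (Fin t ⊕ Fin t → X)) : ‖mop (dpi t A) v‖ ≤ 2 * t * ‖v‖ := by
  rw [dpi_def, mop_sum]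
  have h2 : (Aᵀ)ᴴ * Aᵀ = 1 := by
    have e : (Aᵀ)ᴴ = (Aᴴ)ᵀ := rfl
    rw [e, ← Matrix.transpose_mul, mul_eq_one_comm.1 h, Matrix.transpose_one]
  refine (norm_sum_le _ _).trans ?_
  have : ∀ s ∈ (Finset.univ : Finset (Fin t)),
      ‖mop (site (Sum.inl s) A - site (Sum.inr s) Aᵀ) v‖ ≤ 2 * ‖v‖ := by
    intro s _
    rw [mop_sub]
    refine (norm_sub_le _ _).trans ?_
    rw [site_norm h, site_norm h2]; linarith
  refine (Finset.sum_le_sum this).trans ?_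
  simp
  linarith

end Tens

section Diag
variable {Y : Type*} [Fintype Y] [DecidableEq Y]

theorem herm_diag (H : Matrix Y Y ℂ) (hH : H.IsHermitian) :
    ∃ (V : Matrix Y Y ℂ) (d : Y → ℝ), Vᴴ * V = 1 ∧ V * Vᴴ = 1 ∧
      H = V * Matrix.diagonal (fun a => (d a : ℂ)) * Vᴴ := by
  refine ⟨hH.eigenvectorUnitary, hH.eigenvalues, ?_, ?_, ?_⟩
  · exact Unitary.coe_star_mul_self hH.eigenvectorUnitary
  · exact Unitary.coe_mul_star_self hH.eigenvectorUnitary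
  · have h := hH.spectral_theorem
    rw [Unitary.conjStarAlgAut_apply] at h
    exact h

theorem exists_phase (U : Matrix Y Y ℂ) : ∃ z : ℂ, star z * z = 1 ∧ IsUnit (1 + z • U) := by
  have hfin : {w : ℂ | U.charpoly.IsRoot w}.Finite :=
    Polynomial.finite_setOf_isRoot (Matrix.charpoly_monic U).ne_zero
  have hinf : (Set.range (fun x : Circle => -(((x⁻¹ : Circle)) : ℂ))).Infinite := by
    have : Infinite Circle := by
      have : Infinite (Set.Ioc (-Real.pi) Real.pi) :=
        (Set.Ioc_infinite (by linarith [Real.pi_pos])).to_subtype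
      exact Infinite.of_injective _ Circle.argEquiv.symm.injective
    apply Set.infinite_range_of_injective
    intro x y hxy
    simp only [neg_inj] at hxy
    exact inv_injective (Circle.ext hxy)
  obtain ⟨w, ⟨x, rfl⟩, hw⟩ := hinf.exists_notMem_finite hfin
  refine ⟨x, ?_, ?_⟩
  · rw [mul_comm]
    have := Complex.mul_conj (x : ℂ)
    rw [Circle.normSq_coe] at this
    simpa using this
  · have h1 : ¬ (-(((x⁻¹ : Circle)) : ℂ)) ∈ spectrum ℂ U := by
      rw [Matrix.mem_spectrum_iff_isRoot_charpoly]; exact hw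
    rw [spectrum.notMem_iff] at h1
    have h2 : (1 + (x : ℂ) • U) = (-(x : ℂ)) • (algebraMap ℂ (Matrix Y Y ℂ) (-(((x⁻¹ : Circle)) : ℂ)) - U) := by
      rw [Algebra.algebraMap_eq_smul_one, smul_sub, smul_smul]
      simp [sub_eq_add_neg]
    rw [h2]
    exact h1.smul (Units.mk0 (-(x : ℂ)) (by simp))

theorem unitary_diag (U : Matrix Y Y ℂ) (hU : Uᴴ * U = 1) :
    ∃ (V : Matrix Y Y ℂ) (d : Y → ℂ), Vᴴ * V = 1 ∧ V * Vᴴ = 1 ∧ (∀ a, star (d a) * d a = 1) ∧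
      U = V * Matrix.diagonal d * Vᴴ := by
  obtain ⟨z, hz, hu⟩ := exists_phase U
  set W := z • U with hW
  have hWW : Wᴴ * W = 1 := by
    rw [hW, Matrix.conjTranspose_smul, smul_mul_smul_comm, hU, hz, one_smul]
  have hWW' : W * Wᴴ = 1 := mul_eq_one_comm.1 hWW
  obtain ⟨u, hu⟩ := hu
  set R : Matrix Y Y ℂ := ((u⁻¹ : (Matrix Y Y ℂ)ˣ) : Matrix Y Y ℂ) with hR
  have hR1 : R * (1 + W) = 1 := by rw [← hu, hR]; simp
  have hR2 : (1 + W) * R = 1 := by rw [← hu, hR]; simp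
  have hR3 : Rᴴ * (1 + Wᴴ) = 1 := by
    have := congrArg Matrix.conjTranspose hR2
    simpa using this
  have hR4 : (1 + Wᴴ) * Rᴴ = 1 := by
    have := congrArg Matrix.conjTranspose hR1
    simpa using this
  set H : Matrix Y Y ℂ := Complex.I • ((1 - W) * R) with hH
  have hHH : H.IsHermitian := by
    rw [Matrix.IsHermitian, hH, Matrix.conjTranspose_smul, Matrix.conjTranspose_mul]
    have e1 : (1 - W)ᴴ = 1 - Wᴴ := by simp
    rw [e1]
    have e2 : -((1 - Wᴴ) * (1 + W)) = (1 + Wᴴ) * (1 - W) := by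
      simp only [mul_sub, sub_mul, mul_add, add_mul, hWW, mul_one, one_mul]; abel
    have e3 : Rᴴ * (-((1 - Wᴴ) * (1 + W))) * R = Rᴴ * ((1 + Wᴴ) * (1 - W)) * R := by rw [e2]
    have e4 : Rᴴ * ((1 + Wᴴ) * (1 - W)) * R = (1 - W) * R := by
      rw [← mul_assoc, hR3, one_mul]
    have e5 : Rᴴ * (-((1 - Wᴴ) * (1 + W))) * R = - (Rᴴ * (1 - Wᴴ)) := by
      rw [mul_neg, neg_mul, mul_assoc, mul_assoc, hR2, mul_one]
    have e6 : Rᴴ * (1 - Wᴴ) = - ((1 - W) * R) := by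
      rw [← e4, ← e3, e5, neg_neg]
    rw [e6]
    simp
  obtain ⟨V, d, h1, h2, h3⟩ := herm_diag H hHH
  have hd : ∀ a, (Complex.I + d a : ℂ) ≠ 0 := by
    intro a h
    have := congrArg Complex.im h
    simp at this
  have hne : z ≠ 0 := by
    rintro rfl; simp at hz
  have hstar : star z = z⁻¹ := by
    field_simp; exact hz
  refine ⟨V, fun a => star z * ((Complex.I - d a) / (Complex.I + d a)), h1, h2, ?_, ?_⟩
  · intro a
    have h4 : (-Complex.I + d a : ℂ) ≠ 0 := by
      intro h
      have := congrArg Complex.im h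
      simp at this
    have h5 : star ((Complex.I - d a : ℂ) / (Complex.I + d a)) = (-Complex.I - d a) / (-Complex.I + d a) := by
      simp
    rw [star_mul', h5, star_star]
    have : (-Complex.I - ↑(d a)) / (-Complex.I + ↑(d a)) * ((Complex.I - ↑(d a)) / (Complex.I + ↑(d a))) = (1 : ℂ) := by
      field_simp [hd a, h4]
      ring
    calc _ = (star z * z) * ((-Complex.I - ↑(d a)) / (-Complex.I + ↑(d a)) * ((Complex.I - ↑(d a)) / (Complex.I + ↑(d a)))) := by ring
      _ = 1 := by rw [hz, this, one_mul]
  · have hk : W * (H + Complex.I • 1) = Complex.I • 1 - H := by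
      have hc : W * R = R * W := by
        have a1 : R * ((1 + W) * W) * R = R * (W * (1 + W)) * R := by
          congr 2; simp [mul_add, add_mul]
        have a2 : R * ((1 + W) * W) * R = W * R := by
          rw [← mul_assoc, hR1, one_mul]
        have a3 : R * (W * (1 + W)) * R = R * W := by
          rw [mul_assoc, mul_assoc, hR2, mul_one]
        rw [← a2, a1, a3]
      have e1 : H + Complex.I • 1 = Complex.I • ((2 : ℂ) • R) := by
        rw [hH, ← smul_add]
        congr 1
        have hx : (1 : Matrix Y Y ℂ) = (1 + W) * R := hR2.symm
        refine (congrArg (fun q => (1 - W) * R + q) hx).trans ?_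
        show (1 - W) * R + (1 + W) * R = _
        rw [← add_mul]
        have : (1 - W) + (1 + W) = (2 : ℂ) • (1 : Matrix Y Y ℂ) := by rw [two_smul]; abel
        rw [this, smul_mul_assoc, one_mul]
      have e2 : Complex.I • 1 - H = Complex.I • ((2 : ℂ) • (W * R)) := by
        rw [hH, ← smul_sub]
        congr 1
        have hx : (1 : Matrix Y Y ℂ) = (1 + W) * R := hR2.symm
        refine (congrArg (fun q => q - (1 - W) * R) hx).trans ?_
        show (1 + W) * R - (1 - W) * R = _
        rw [← sub_mul]
        have : (1 + W) - (1 - W) = (2 : ℂ) • W := by rw [two_smul]; abel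
        rw [this, smul_mul_assoc]
      rw [e1, e2, mul_smul_comm, mul_smul_comm]
    have hp : H + Complex.I • 1 = V * Matrix.diagonal (fun a => (Complex.I + d a : ℂ)) * Vᴴ := by
      have : Matrix.diagonal (fun a => (Complex.I + d a : ℂ)) = Matrix.diagonal (fun a => (d a : ℂ)) + Complex.I • 1 := by
        rw [← Matrix.diagonal_one, ← Matrix.diagonal_smul, Matrix.diagonal_add]
        congr 1; ext a; simp [add_comm]
      rw [this, mul_add, add_mul, ← h3, mul_smul_comm, smul_mul_assoc, mul_one, h2]
    have hm : Complex.I • 1 - H = V * Matrix.diagonal (fun a => (Complex.I - d a : ℂ)) * Vᴴ := by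
      have : Matrix.diagonal (fun a => (Complex.I - d a : ℂ)) = Complex.I • 1 - Matrix.diagonal (fun a => (d a : ℂ)) := by
        rw [← Matrix.diagonal_one, ← Matrix.diagonal_smul, Matrix.diagonal_sub]
        congr 1; ext a; simp
      rw [this, mul_sub, sub_mul, ← h3, mul_smul_comm, smul_mul_assoc, mul_one, h2]
    have hq : (H + Complex.I • 1) * (V * Matrix.diagonal (fun a => (Complex.I + d a : ℂ)⁻¹) * Vᴴ) = 1 := by
      rw [hp]
      have : V * Matrix.diagonal (fun a => (Complex.I + d a : ℂ)) * Vᴴ * (V * Matrix.diagonal (fun a => (Complex.I + d a : ℂ)⁻¹) * Vᴴ)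
        = V * (Matrix.diagonal (fun a => (Complex.I + d a : ℂ)) * (Vᴴ * V) * Matrix.diagonal (fun a => (Complex.I + d a : ℂ)⁻¹)) * Vᴴ := by
        simp only [mul_assoc]
      rw [this, h1, mul_one, Matrix.diagonal_mul_diagonal]
      have : (fun a => (Complex.I + d a : ℂ) * (Complex.I + d a : ℂ)⁻¹) = fun _ => 1 := by
        ext a; exact mul_inv_cancel₀ (hd a)
      rw [this, Matrix.diagonal_one, mul_one, h2]
    have hWe : W = V * Matrix.diagonal (fun a => (Complex.I - d a : ℂ) * (Complex.I + d a : ℂ)⁻¹) * Vᴴ := by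
      calc W = W * ((H + Complex.I • 1) * (V * Matrix.diagonal (fun a => (Complex.I + d a : ℂ)⁻¹) * Vᴴ)) := by rw [hq, mul_one]
        _ = (V * Matrix.diagonal (fun a => (Complex.I - d a : ℂ)) * Vᴴ) * (V * Matrix.diagonal (fun a => (Complex.I + d a : ℂ)⁻¹) * Vᴴ) := by
            rw [← mul_assoc, hk, hm]
        _ = V * (Matrix.diagonal (fun a => (Complex.I - d a : ℂ)) * (Vᴴ * V) * Matrix.diagonal (fun a => (Complex.I + d a : ℂ)⁻¹)) * Vᴴ := by
            simp only [mul_assoc]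
        _ = _ := by rw [h1, mul_one, Matrix.diagonal_mul_diagonal]
    have hUW : U = star z • W := by rw [hW, smul_smul, hz, one_smul]
    rw [hUW, hWe]
    have : (fun a => star z * ((Complex.I - d a : ℂ) / (Complex.I + d a))) =
      star z • (fun a => (Complex.I - d a : ℂ) * (Complex.I + d a : ℂ)⁻¹) := by
      ext a; simp [div_eq_mul_inv]
    rw [this, Matrix.diagonal_smul, mul_smul_comm, smul_mul_assoc]

end Diag

section LieFix
variable {Y : Type*} [Fintype Y] [DecidableEq Y]

/-- weight of a basis vector. -/
def wt (t : ℕ) (j : Fin t ⊕ Fin t → Y) (a : Y) : ℤ :=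
  (Finset.univ.filter fun s => j (Sum.inl s) = a).card -
    (Finset.univ.filter fun s => j (Sum.inr s) = a).card

theorem sum_wt (t : ℕ) (j : Fin t ⊕ Fin t → Y) : ∑ a, wt t j a = 0 := by
  simp only [wt, Finset.sum_sub_distrib]
  have h := Finset.card_eq_sum_card_fiberwise (f := fun s => j (Sum.inl s)) (s := (Finset.univ : Finset (Fin t))) (t := Finset.univ) (by simp)
  have h' := Finset.card_eq_sum_card_fiberwise (f := fun s => j (Sum.inr s)) (s := (Finset.univ : Finset (Fin t))) (t := Finset.univ) (by simp)
  rw [← Nat.cast_sum, ← Nat.cast_sum, ← h, ← h', sub_self]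

theorem dpi_diagonal_wt (t : ℕ) (d : Y → ℂ) :
    dpi t (Matrix.diagonal d) = Matrix.diagonal (fun j : Fin t ⊕ Fin t → Y =>
      ∑ a, (wt t j a : ℂ) * d a) := by
  rw [dpi_diagonal]
  congr 1
  ext j
  have h1 : ∀ f : Fin t → Y, ∑ s, d (f s) = ∑ a, ((Finset.univ.filter fun s => f s = a).card : ℂ) * d a := by
    intro f
    rw [← Finset.sum_fiberwise (s := Finset.univ) (g := f)]
    apply Finset.sum_congr rfl
    intro a _
    rw [Finset.sum_congr rfl (g := fun _ => d a)]
    · simp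
    · intro s hs
      rw [(Finset.mem_filter.1 hs).2]
  rw [Finset.sum_sub_distrib, h1 (fun s => j (Sum.inl s)), h1 (fun s => j (Sum.inr s)), ← Finset.sum_sub_distrib]
  apply Finset.sum_congr rfl
  intro a _
  rw [wt]; push_cast; ring

theorem Phi_diagonal_wt (t : ℕ) (d : Y → ℂ) :
    Phi t (Matrix.diagonal d) = Matrix.diagonal (fun j : Fin t ⊕ Fin t → Y =>
      ∏ a, d a ^ (Finset.univ.filter fun s => j (Sum.inl s) = a).card *
        star (d a) ^ (Finset.univ.filter fun s => j (Sum.inr s) = a).card) := by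
  rw [Phi_diagonal]
  congr 1
  ext j
  have h1 : ∀ (e : Y → ℂ) (f : Fin t → Y), ∏ s, e (f s) = ∏ a, e a ^ (Finset.univ.filter fun s => f s = a).card := by
    intro e f
    rw [← Finset.prod_fiberwise (s := Finset.univ) (g := f)]
    apply Finset.prod_congr rfl
    intro a _
    rw [Finset.prod_congr rfl (g := fun _ => e a)]
    · simp
    · intro s hs
      rw [(Finset.mem_filter.1 hs).2]
  rw [Finset.prod_mul_distrib, h1 d (fun s => j (Sum.inl s)), h1 (fun a => star (d a)) (fun s => j (Sum.inr s)), ← Finset.prod_mul_distrib]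

theorem mop_diagonal {J : Type*} [Fintype J] [DecidableEq J] (d : J → ℂ) (v : EuclideanSpace ℂ J) (j : J) :
    mop (Matrix.diagonal d) v j = d j * v j := by
  rw [mop_apply]
  simp [Matrix.diagonal_apply]

/-- Vectors killed by the infinitesimal action. -/
def lieFix (t : ℕ) (Y : Type*) [Fintype Y] [DecidableEq Y] : Submodule ℂ (EuclideanSpace ℂ (Fin t ⊕ Fin t → Y)) where
  carrier := {v | ∀ A : Matrix Y Y ℂ, mop (dpi t A) v = 0}
  add_mem' := by
    intro a b ha hb A
    rw [map_add, ha A, hb A, add_zero]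
  zero_mem' := by intro A; rw [map_zero]
  smul_mem' := by
    intro c x hx A
    rw [map_smul, hx A, smul_zero]

theorem mem_lieFix {t : ℕ} {v : EuclideanSpace ℂ (Fin t ⊕ Fin t → Y)} :
    v ∈ lieFix t Y ↔ ∀ A : Matrix Y Y ℂ, mop (dpi t A) v = 0 := Iff.rfl

theorem dpi_Phi_conj (t : ℕ) {V : Matrix Y Y ℂ} (h2 : V * Vᴴ = 1) (A : Matrix Y Y ℂ)
    (v : EuclideanSpace ℂ (Fin t ⊕ Fin t → Y)) :
    mop (dpi t (V * A * Vᴴ)) (mop (Phi t V) v) = mop (Phi t V) (mop (dpi t A) v) := by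
  have h1 : Vᴴ * V = 1 := mul_eq_one_comm.1 h2
  rw [← mop_mul, ← mop_mul, Phi_dpi t V A (V * A * Vᴴ)]
  · rw [mul_assoc, h1, mul_one]
  · rw [← mul_assoc, ← mul_assoc, h1, one_mul]

theorem mop_Phi_inv (t : ℕ) {V : Matrix Y Y ℂ} (h2 : V * Vᴴ = 1)
    (v : EuclideanSpace ℂ (Fin t ⊕ Fin t → Y)) : mop (Phi t V) (mop (Phi t Vᴴ) v) = v := by
  rw [← mop_mul, ← Phi_mul, h2, Phi_one, mop_one]

theorem Phi_mem_lieFix (t : ℕ) {V : Matrix Y Y ℂ} (h2 : V * Vᴴ = 1)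
    {v : EuclideanSpace ℂ (Fin t ⊕ Fin t → Y)} (hv : v ∈ lieFix t Y) : mop (Phi t V) v ∈ lieFix t Y := by
  intro A
  have h1 : Vᴴ * V = 1 := mul_eq_one_comm.1 h2
  have e : A = V * (Vᴴ * A * V) * Vᴴ := by
    calc A = (V * Vᴴ) * A * (V * Vᴴ) := by rw [h2, one_mul, mul_one]
      _ = _ := by simp only [mul_assoc]
  rw [e, dpi_Phi_conj t h2, hv, map_zero]

theorem fix_of_lieFix {t : ℕ} {v : EuclideanSpace ℂ (Fin t ⊕ Fin t → Y)} (hv : v ∈ lieFix t Y)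
    {U : Matrix Y Y ℂ} (hU : Uᴴ * U = 1) : mop (Phi t U) v = v := by
  obtain ⟨V, d, h1, h2, hd, rfl⟩ := unitary_diag U hU
  have hw := Phi_mem_lieFix t (V := Vᴴ) (by simpa using h1) hv
  rw [Phi_mul, Phi_mul, mop_mul, mop_mul]
  have : mop (Phi t (Matrix.diagonal d)) (mop (Phi t Vᴴ) v) = mop (Phi t Vᴴ) v := by
    set w := mop (Phi t Vᴴ) v with hwdef
    ext j
    rw [Phi_diagonal_wt, mop_diagonal]
    by_cases hj : w j = 0
    · rw [hj, mul_zero]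
    · have hz : ∀ a, wt t j a = 0 := by
        intro a
        have h3 := hw (Matrix.diagonal (Pi.single a 1))
        have h4 := congrArg (fun u => u j) h3
        simp only [dpi_diagonal_wt, mop_diagonal] at h4
        rw [Finset.sum_eq_single a (by intro b _ hb; simp [hb]) (by simp)] at h4
        simp [hj] at h4
        exact h4
      rw [Finset.prod_eq_one, one_mul]
      intro a _
      have h5 : (Finset.univ.filter fun s => j (Sum.inl s) = a).card = (Finset.univ.filter fun s => j (Sum.inr s) = a).card := by
        have := hz a
        rw [wt] at this
        omega
      rw [h5, ← mul_pow, mul_comm, hd, one_pow]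
  rw [this, mop_Phi_inv t h2]

theorem exp_I_pow {k l : ℕ} (h : Complex.exp Complex.I ^ k * star (Complex.exp Complex.I) ^ l = 1) : k = l := by
  have e : star (Complex.exp Complex.I) = Complex.exp (-Complex.I) := by
    rw [Complex.star_def, ← Complex.exp_conj, Complex.conj_I]
  rw [e, ← Complex.exp_nat_mul, ← Complex.exp_nat_mul, ← Complex.exp_add, Complex.exp_eq_one_iff] at h
  obtain ⟨m, hm⟩ := h
  have h2 := congrArg Complex.im hm
  simp at h2
  by_cases hm0 : m = 0
  · subst hm0
    simp at h2
    have : (k : ℝ) = l := by linarith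
    exact_mod_cast this
  · exfalso
    have hirr := irrational_pi
    apply hirr
    refine ⟨((k : ℚ) - l) / (2 * m), ?_⟩
    have : (m : ℝ) ≠ 0 := by exact_mod_cast hm0
    push_cast
    field_simp
    linarith

theorem lieFix_of_fix {t : ℕ} {v : EuclideanSpace ℂ (Fin t ⊕ Fin t → Y)}
    (hv : ∀ U : Matrix Y Y ℂ, Uᴴ * U = 1 → mop (Phi t U) v = v) : v ∈ lieFix t Y := by
  have hherm : ∀ H : Matrix Y Y ℂ, H.IsHermitian → mop (dpi t H) v = 0 := by
    intro H hH
    obtain ⟨V, d, h1, h2, rfl⟩ := herm_diag H hH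
    have e := dpi_Phi_conj t h2 (Matrix.diagonal fun a => (d a : ℂ)) v
    rw [hv V h1] at e
    rw [e]
    have : mop (dpi t (Matrix.diagonal fun a => (d a : ℂ))) v = 0 := by
      ext j
      rw [dpi_diagonal_wt, mop_diagonal]
      by_cases hj : v j = 0
      · rw [hj, mul_zero]; rfl
      · have : ∀ a, wt t j a = 0 := by
          intro a
          have h3 := hv (Matrix.diagonal (Function.update (fun _ => 1) a (Complex.exp Complex.I))) (by
            rw [Matrix.diagonal_conjTranspose, Matrix.diagonal_mul_diagonal, ← Matrix.diagonal_one]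
            congr 1; ext b
            by_cases hb : b = a
            · subst hb
              simp only [Pi.star_apply, Function.update_self]
              rw [Complex.star_def, ← Complex.exp_conj, Complex.conj_I, ← Complex.exp_add]; simp
            · simp [Function.update_of_ne hb])
          have h4 := congrArg (fun u => u j) h3
          simp only [Phi_diagonal_wt, mop_diagonal] at h4
          rw [Finset.prod_eq_single a (by intro b _ hb; simp [Function.update_of_ne hb]) (by simp)] at h4
          have h5 := mul_right_cancel₀ hj (h4.trans (one_mul _).symm)
          rw [Function.update_self] at h5
          have := exp_I_pow h5
          rw [wt, this, sub_self]
        simp [this]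
    rw [this, map_zero]
  intro A
  have hA : A = (2⁻¹ : ℂ) • (A + Aᴴ) + (-(Complex.I) * 2⁻¹) • (Complex.I • (A - Aᴴ)) := by
    rw [smul_smul]
    have : (-Complex.I * 2⁻¹ * Complex.I : ℂ) = 2⁻¹ := by
      calc _ = -(Complex.I * Complex.I) * 2⁻¹ := by ring
        _ = _ := by rw [Complex.I_mul_I]; ring
    rw [this, ← smul_add]
    have : A + Aᴴ + (A - Aᴴ) = (2 : ℂ) • A := by rw [two_smul]; abel
    rw [this, smul_smul]; norm_num
  rw [hA, map_add, map_smul, map_smul, mop_add, mop_smul, mop_smul, hherm, hherm, smul_zero, smul_zero, add_zero]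
  · rw [Matrix.IsHermitian]; simp [smul_sub]; abel
  · rw [Matrix.IsHermitian]; simp [add_comm]

theorem lieFix_iff {t : ℕ} {v : EuclideanSpace ℂ (Fin t ⊕ Fin t → Y)} :
    v ∈ lieFix t Y ↔ ∀ U : Matrix Y Y ℂ, Uᴴ * U = 1 → mop (Phi t U) v = v :=
  ⟨fun h _ hU => fix_of_lieFix h hU, lieFix_of_fix⟩

end LieFix

section Casimir
variable {Y : Type*} [Fintype Y] [DecidableEq Y]
local notation "⟪" x "," y "⟫" => inner ℂ x y

theorem int_weight_bound (l : Y → ℤ) (h0 : ∑ a, l a = 0) (hl : l ≠ 0) :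
    2 * (Fintype.card Y : ℤ) ≤ ∑ a, l a ^ 2 + ∑ a, ∑ b, max (l b - l a) 0 := by
  have hp : ∃ p, 1 ≤ l p := by
    by_contra! h
    apply hl
    ext a
    have := (Finset.sum_eq_zero_iff_of_nonpos (s := Finset.univ) (f := l) (fun i _ => by have := h i; simp; omega)).1 h0
    exact this a (Finset.mem_univ a)
  have hm : ∃ m, l m ≤ -1 := by
    by_contra! h
    apply hl
    ext a
    have := (Finset.sum_eq_zero_iff_of_nonneg (s := Finset.univ) (f := l) (fun i _ => by have := h i; simp; omega)).1 h0
    exact this a (Finset.mem_univ a)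
  obtain ⟨p, hp⟩ := hp
  obtain ⟨m, hm⟩ := hm
  have hpm : p ≠ m := by rintro rfl; omega
  set f : Y → Y → ℤ := fun a b => max (l b - l a) 0 with hf
  have hf0 : ∀ a b, 0 ≤ f a b := fun a b => le_max_right _ _
  have h1 : ∑ a, f a p + ∑ b, f m b ≤ ∑ a, ∑ b, f a b + f m p := by
    rw [← Finset.add_sum_erase _ _ (Finset.mem_univ m)]
    rw [← Finset.add_sum_erase Finset.univ (fun a => ∑ b, f a b) (Finset.mem_univ m)]
    have : ∑ a ∈ Finset.univ.erase m, f a p ≤ ∑ a ∈ Finset.univ.erase m, ∑ b, f a b := by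
      apply Finset.sum_le_sum
      intro a _
      exact Finset.single_le_sum (f := fun b => f a b) (fun b _ => hf0 a b) (Finset.mem_univ p)
    linarith
  have h2 : (Fintype.card Y : ℤ) * (l p - l m) ≤ ∑ a, f a p + ∑ b, f m b := by
    rw [← Finset.sum_add_distrib]
    have : ∀ c ∈ (Finset.univ : Finset Y), l p - l m ≤ f c p + f m c := by
      intro c _
      simp only [hf]
      have := le_max_left (l p - l c) 0
      have := le_max_left (l c - l m) 0
      linarith
    have := Finset.card_nsmul_le_sum _ _ _ this
    simpa using this
  have h3 : l p ^ 2 + l m ^ 2 ≤ ∑ a, l a ^ 2 := by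
    rw [← Finset.sum_pair hpm (f := fun a => l a ^ 2)]
    exact Finset.sum_le_sum_of_subset_of_nonneg (Finset.subset_univ _) (fun a _ _ => sq_nonneg _)
  have h4 : f m p = l p - l m := by simp only [hf]; exact max_eq_left (by omega)
  have h5 : (0 : ℤ) ≤ Fintype.card Y := by positivity
  nlinarith

/-- The generators. -/
def ge (t : ℕ) (a b : Y) : Matrix (Fin t ⊕ Fin t → Y) (Fin t ⊕ Fin t → Y) ℂ :=
  dpi t (Matrix.single a b 1)

theorem ge_conjTranspose (t : ℕ) (a b : Y) : (ge t a b)ᴴ = ge t b a := by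
  rw [ge, ge, dpi_conjTranspose, Matrix.conjTranspose_single, star_one]

theorem ge_diag (t : ℕ) (a : Y) : ge t a a = Matrix.diagonal (fun j => (wt t j a : ℂ)) := by
  have : (Matrix.single a a 1 : Matrix Y Y ℂ) = Matrix.diagonal (Pi.single a 1) := by
    rw [Matrix.diagonal_single]
  rw [ge, this, dpi_diagonal_wt]
  congr 1
  ext j
  rw [Finset.sum_eq_single a (by intro b _ hb; simp [hb]) (by simp)]
  simp

theorem ge_comm (t : ℕ) (a b c d : Y) :
    ge t a b * ge t c d = ge t c d * ge t a b + (if b = c then ge t a d else 0) - (if d = a then ge t c b else 0) := by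
  have h := dpi_comm t (Matrix.single a b (1 : ℂ)) (Matrix.single c d 1)
  rw [map_sub] at h
  have e : ∀ a b c d : Y, dpi t ((Matrix.single a b (1 : ℂ)) * (Matrix.single c d 1)) = if b = c then ge t a d else 0 := by
    intro a b c d
    split_ifs with hbc
    · subst hbc; rw [Matrix.single_mul_single_same, mul_one, ge]
    · rw [Matrix.single_mul_single_of_ne _ _ _ _ hbc, map_zero]
  rw [e, e] at h
  rw [add_sub_assoc, ← h]
  simp only [ge]
  abel

theorem ge_shift (t : ℕ) (a b c : Y) (j j' : Fin t ⊕ Fin t → Y) (h : ge t a b j' j ≠ 0) :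
    wt t j' c = wt t j c + (if c = a then 1 else 0) - (if b = c then 1 else 0) := by
  have h1 := ge_comm t c c a b
  have h2 := congrFun (congrFun h1 j') j
  rw [ge_diag] at h2
  rw [Matrix.sub_apply, Matrix.add_apply, Matrix.diagonal_mul, Matrix.mul_diagonal] at h2
  have e1 : (if c = a then ge t c b else 0) j' j = (if c = a then 1 else 0 : ℂ) * ge t a b j' j := by
    split_ifs with hh
    · subst hh; simp
    · simp
  have e2 : (if b = c then ge t a c else 0) j' j = (if b = c then 1 else 0 : ℂ) * ge t a b j' j := by
    split_ifs with hh
    · subst hh; simp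
    · simp
  rw [e1, e2] at h2
  have h3 : ((wt t j' c : ℂ)) = wt t j c + (if c = a then 1 else 0) - (if b = c then 1 else 0) := by
    apply mul_right_cancel₀ h
    rw [h2]; ring
  have h4 : (((wt t j' c : ℤ)) : ℂ) = ((wt t j c + (if c = a then 1 else 0) - (if b = c then 1 else 0) : ℤ) : ℂ) := by
    rw [h3]; push_cast; rfl
  exact_mod_cast h4

/-- The Casimir matrix. -/
def cas (t : ℕ) (Y : Type*) [Fintype Y] [DecidableEq Y] : Matrix (Fin t ⊕ Fin t → Y) (Fin t ⊕ Fin t → Y) ℂ :=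
  ∑ a : Y, ∑ b : Y, ge t b a * ge t a b

theorem cas_comm (t : ℕ) (c d : Y) : cas t Y * ge t c d = ge t c d * cas t Y := by
  have h : ∀ a b : Y, ge t b a * ge t a b * ge t c d = ge t c d * (ge t b a * ge t a b) +
      ((if b = c then ge t b a * ge t a d else 0) - (if d = a then ge t b a * ge t c b else 0)
      + (if a = c then ge t b d * ge t a b else 0) - (if d = b then ge t c a * ge t a b else 0)) := by
    intro a b
    rw [mul_assoc, ge_comm t a b c d, mul_sub, mul_add, ← mul_assoc, ge_comm t b a c d]
    rw [sub_mul, add_mul, mul_assoc]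
    have e1 : (ge t b a * if b = c then ge t a d else 0) = if b = c then ge t b a * ge t a d else 0 := by
      split_ifs <;> simp
    have e2 : (ge t b a * if d = a then ge t c b else 0) = if d = a then ge t b a * ge t c b else 0 := by
      split_ifs <;> simp
    have e3 : ((if a = c then ge t b d else 0) * ge t a b) = if a = c then ge t b d * ge t a b else 0 := by
      split_ifs <;> simp
    have e4 : ((if d = b then ge t c a else 0) * ge t a b) = if d = b then ge t c a * ge t a b else 0 := by
      split_ifs <;> simp
    rw [e1, e2, e3, e4]
    abel
  rw [cas, Finset.sum_mul, Finset.mul_sum]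
  have h2 : ∑ a : Y, (∑ b : Y, ge t b a * ge t a b) * ge t c d = ∑ a : Y, ∑ b : Y, (ge t c d * (ge t b a * ge t a b) +
      ((if b = c then ge t b a * ge t a d else 0) - (if d = a then ge t b a * ge t c b else 0)
      + (if a = c then ge t b d * ge t a b else 0) - (if d = b then ge t c a * ge t a b else 0))) := by
    apply Finset.sum_congr rfl
    intro a _
    rw [Finset.sum_mul]
    exact Finset.sum_congr rfl (fun b _ => h a b)
  rw [h2]
  simp only [Finset.sum_add_distrib, Finset.sum_sub_distrib, Finset.mul_sum]
  have r1 : ∑ a : Y, ∑ b : Y, (if b = c then ge t b a * ge t a d else 0) = ∑ a, ge t c a * ge t a d := by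
    simp
  have r2 : ∑ a : Y, ∑ b : Y, (if d = a then ge t b a * ge t c b else 0) = ∑ b, ge t b d * ge t c b := by
    rw [Finset.sum_comm]; simp
  have r3 : ∑ a : Y, ∑ b : Y, (if a = c then ge t b d * ge t a b else 0) = ∑ b, ge t b d * ge t c b := by
    rw [Finset.sum_comm]; simp
  have r4 : ∑ a : Y, ∑ b : Y, (if d = b then ge t c a * ge t a b else 0) = ∑ a, ge t c a * ge t a d := by
    simp
  rw [r1, r2, r3, r4]
  abel

theorem cas_eig (t : ℕ) (μ : ℝ) (v : EuclideanSpace ℂ (Fin t ⊕ Fin t → Y)) (hv : v ≠ 0)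
    (h : mop (cas t Y) v = (μ : ℂ) • v) : μ = 0 ∨ 2 * (Fintype.card Y : ℝ) ≤ μ := by
  set P : (Fin t ⊕ Fin t → Y) → Prop := fun j =>
    ∃ u : EuclideanSpace ℂ (Fin t ⊕ Fin t → Y), mop (cas t Y) u = (μ : ℂ) • u ∧ u j ≠ 0 with hP
  have hne : (Finset.univ.filter P).Nonempty := by
    have : ∃ j, v j ≠ 0 := by
      by_contra! hh
      apply hv
      ext j; exact hh j
    obtain ⟨j, hj⟩ := this
    exact ⟨j, Finset.mem_filter.2 ⟨Finset.mem_univ _, v, h, hj⟩⟩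
  obtain ⟨j, hj, hmax⟩ := Finset.exists_max_image (Finset.univ.filter P) (fun j => ∑ a, wt t j a ^ 2) hne
  obtain ⟨u, hu, huj⟩ := (Finset.mem_filter.1 hj).2
  set l := wt t j with hl
  have hK : ∀ a b, mop (cas t Y) (mop (ge t a b) u) = (μ : ℂ) • mop (ge t a b) u := by
    intro a b
    rw [← mop_mul, cas_comm, mop_mul, hu, map_smul]
  have hzero : ∀ a b, a ≠ b → l b ≤ l a → mop (ge t b a * ge t a b) u j = 0 := by
    intro a b hab hle
    rw [mop_mul, mop_apply]
    apply Finset.sum_eq_zero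
    intro j' _
    by_cases h1 : ge t b a j j' = 0
    · rw [h1, zero_mul]
    · by_cases h2 : mop (ge t a b) u j' = 0
      · rw [h2, mul_zero]
      · exfalso
        have h3 := hmax j' (Finset.mem_filter.2 ⟨Finset.mem_univ _, _, hK a b, h2⟩)
        have h4 : ∀ c, wt t j' c = l c + (if c = a then 1 else 0) - (if c = b then 1 else 0) := by
          intro c
          have := ge_shift t b a c j' j h1
          rw [hl, this]
          by_cases q1 : c = a
          · subst q1; simp [hab]
          · by_cases q2 : c = b
            · subst q2; simp [hab, Ne.symm hab]
            · simp [q1, q2, Ne.symm q1]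
        have h5 : ∑ c, wt t j' c ^ 2 = ∑ c, l c ^ 2 + (2 * l a + 1) + (-2 * l b + 1) := by
          have : ∀ c ∈ (Finset.univ : Finset Y), wt t j' c ^ 2 = l c ^ 2 + (if c = a then 2 * l a + 1 else 0) + (if c = b then - 2 * l b + 1 else 0) := by
            intro c _
            rw [h4 c]
            by_cases q1 : c = a
            · subst q1; simp [hab]; ring
            · by_cases q2 : c = b
              · subst q2; simp [Ne.symm hab]; ring
              · simp [q1, q2]
          rw [Finset.sum_congr rfl this, Finset.sum_add_distrib, Finset.sum_add_distrib]
          simp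
        rw [h5] at h3
        linarith
  have hterm : ∀ a b, mop (ge t b a * ge t a b) u j = (((if a = b then l a ^ 2 else 0) + max (l b - l a) 0 : ℤ) : ℂ) * u j := by
    intro a b
    by_cases hab : a = b
    · subst hab
      rw [mop_mul, ge_diag, mop_diagonal, mop_diagonal]
      simp [hl]; ring
    · rcases le_total (l b) (l a) with hle | hle
      · rw [hzero a b hab hle, max_eq_right (by omega)]
        simp [hab]
      · rw [ge_comm t b a a b, mop_sub, mop_add]
        have h6 := hzero b a (Ne.symm hab) hle
        rw [max_eq_left (by omega)]
        simp only [if_true]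
        rw [ge_diag, ge_diag]
        have : (mop (ge t a b * ge t b a) u + mop (Matrix.diagonal fun j => (wt t j b : ℂ)) u - mop (Matrix.diagonal fun j => (wt t j a : ℂ)) u) j
          = mop (ge t a b * ge t b a) u j + mop (Matrix.diagonal fun j => (wt t j b : ℂ)) u j - mop (Matrix.diagonal fun j => (wt t j a : ℂ)) u j := rfl
        rw [this, h6, mop_diagonal, mop_diagonal]
        simp [hl, hab]; ring
  have hsum : mop (cas t Y) u j = (((∑ a, l a ^ 2 + ∑ a, ∑ b, max (l b - l a) 0 : ℤ)) : ℂ) * u j := by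
    have e1 : mop (cas t Y) u j = ∑ a, ∑ b, mop (ge t b a * ge t a b) u j := by
      rw [cas]
      simp only [mop_sum]
      rw [WithLp.ofLp_sum, Finset.sum_apply]
      apply Finset.sum_congr rfl
      intro a _
      rw [WithLp.ofLp_sum, Finset.sum_apply]
    rw [e1]
    simp only [hterm]
    simp only [← Finset.sum_mul]
    congr 1
    rw [← Finset.sum_add_distrib]
    push_cast
    apply Finset.sum_congr rfl
    intro a _
    rw [Finset.sum_add_distrib]
    simp
  have hμ : (μ : ℂ) = ((∑ a, l a ^ 2 + ∑ a, ∑ b, max (l b - l a) 0 : ℤ) : ℂ) := by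
    apply mul_right_cancel₀ huj
    rw [← hsum, hu]; rfl
  have hμ' : μ = ((∑ a, l a ^ 2 + ∑ a, ∑ b, max (l b - l a) 0 : ℤ) : ℝ) := by
    have h7 := congrArg Complex.re hμ
    rwa [Complex.ofReal_re, Complex.intCast_re] at h7
  by_cases hl0 : l = 0
  · left
    rw [hμ', hl0]; simp
  · right
    rw [hμ']
    have := int_weight_bound l (sum_wt t j) hl0
    exact_mod_cast this

theorem cas_inner (t : ℕ) (v : EuclideanSpace ℂ (Fin t ⊕ Fin t → Y)) :
    (⟪v, mop (cas t Y) v⟫).re = ∑ a : Y, ∑ b : Y, ‖mop (ge t a b) v‖ ^ 2 := by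
  rw [cas]
  simp only [mop_sum, inner_sum, Complex.re_sum]
  apply Finset.sum_congr rfl
  intro a _
  apply Finset.sum_congr rfl
  intro b _
  rw [mop_mul]
  have : ge t b a = (ge t a b)ᴴ := (ge_conjTranspose t a b).symm
  rw [this, ← mop_inner, inner_self_eq_norm_sq_to_K]
  norm_cast

theorem casimir_gap (t : ℕ) (v : EuclideanSpace ℂ (Fin t ⊕ Fin t → Y)) :
    2 * (Fintype.card Y : ℝ) * ‖v - (lieFix t Y).starProjection v‖ ^ 2 ≤
      ∑ a : Y, ∑ b : Y, ‖mop (dpi t (Matrix.single a b 1)) v‖ ^ 2 := by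
  rw [show (∑ a : Y, ∑ b : Y, ‖mop (dpi t (Matrix.single a b 1)) v‖ ^ 2) = ∑ a : Y, ∑ b : Y, ‖mop (ge t a b) v‖ ^ 2 from rfl, ← cas_inner]
  refine gap_of_eigenvalues (mop (cas t Y)) ?_ _ ?_ _ ?_ (by positivity) v
  · intro x y
    have : (cas t Y)ᴴ = cas t Y := by
      rw [cas, Matrix.conjTranspose_sum]
      apply Finset.sum_congr rfl
      intro a _
      rw [Matrix.conjTranspose_sum]
      apply Finset.sum_congr rfl
      intro b _
      rw [Matrix.conjTranspose_mul, ge_conjTranspose, ge_conjTranspose]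
    have h := mop_inner (cas t Y) x y
    rw [this] at h
    exact h
  · intro μ v hv h
    exact cas_eig t μ v hv h
  · intro v hv
    have h1 : ∑ a : Y, ∑ b : Y, ‖mop (ge t a b) v‖ ^ 2 = 0 := by
      rw [← cas_inner]
      have : mop (cas t Y) v = 0 := hv
      rw [this]; simp
    have h2 : ∀ a b, mop (ge t a b) v = 0 := by
      intro a b
      have h3 := (Finset.sum_eq_zero_iff_of_nonneg (fun a _ => Finset.sum_nonneg (fun b _ => sq_nonneg _))).1 h1 a (Finset.mem_univ a)
      have h4 := (Finset.sum_eq_zero_iff_of_nonneg (fun b _ => sq_nonneg _)).1 h3 b (Finset.mem_univ b)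
      simpa using h4
    intro A
    rw [Matrix.matrix_eq_sum_single A]
    simp only [map_sum, mop_sum]
    apply Finset.sum_eq_zero
    intro a _
    apply Finset.sum_eq_zero
    intro b _
    have : Matrix.single a b (A a b) = A a b • Matrix.single a b (1 : ℂ) := by
      rw [Matrix.smul_single, smul_eq_mul, mul_one]
    rw [this, map_smul, mop_smul]
    have h5 := h2 a b
    rw [ge] at h5
    rw [h5, smul_zero]

end Casimir

section Emb
variable {X Y Z : Type*} [Fintype X] [DecidableEq X] [Fintype Y] [DecidableEq Y] [Fintype Z] [DecidableEq Z]
variable {ι : Type*} [Fintype ι] [DecidableEq ι]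
local notation "⟪" x "," y "⟫" => inner ℂ x y

/-- Embedding of matrices on a tensor factor. -/
def emb (e : X ≃ Y × Z) : Matrix Y Y ℂ →ₗ[ℂ] Matrix X X ℂ where
  toFun A := fun x y => if (e x).2 = (e y).2 then A (e x).1 (e y).1 else 0
  map_add' A B := by
    ext x y
    show (if (e x).2 = (e y).2 then A (e x).1 (e y).1 + B (e x).1 (e y).1 else 0) =
      (if (e x).2 = (e y).2 then A (e x).1 (e y).1 else 0) + (if (e x).2 = (e y).2 then B (e x).1 (e y).1 else 0)
    split_ifs <;> simp
  map_smul' c A := by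
    ext x y
    show (if (e x).2 = (e y).2 then c * A (e x).1 (e y).1 else 0) =
      c * (if (e x).2 = (e y).2 then A (e x).1 (e y).1 else 0)
    split_ifs <;> simp

theorem emb_apply (e : X ≃ Y × Z) (A : Matrix Y Y ℂ) (x y : X) :
    emb e A x y = if (e x).2 = (e y).2 then A (e x).1 (e y).1 else 0 := rfl

theorem emb_one (e : X ≃ Y × Z) : emb e 1 = 1 := by
  ext x y
  rw [emb_apply, Matrix.one_apply, Matrix.one_apply]
  by_cases h : x = y
  · subst h; simp
  · have : e x ≠ e y := fun h' => h (e.injective h')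
    rw [Ne, Prod.ext_iff] at this
    by_cases h1 : (e x).2 = (e y).2
    · have : (e x).1 ≠ (e y).1 := fun h2 => this ⟨h2, h1⟩
      simp [this, h]
    · simp [h, h1]

theorem emb_mul (e : X ≃ Y × Z) (A B : Matrix Y Y ℂ) : emb e (A * B) = emb e A * emb e B := by
  ext x y
  rw [Matrix.mul_apply, ← e.symm.sum_comp, Fintype.sum_prod_type]
  simp only [emb_apply, Equiv.apply_symm_apply]
  have : ∀ a : Y, ∑ z : Z, ((if (e x).2 = z then A (e x).1 a else 0) * if z = (e y).2 then B a (e y).1 else 0)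
     = if (e x).2 = (e y).2 then A (e x).1 a * B a (e y).1 else 0 := by
    intro a
    rw [Finset.sum_eq_single (e x).2 (by intro z _ hz; rw [if_neg (Ne.symm hz), zero_mul]) (by simp)]
    simp
  simp only [this]
  split_ifs with h
  · rw [Matrix.mul_apply]
  · simp

theorem emb_conjTranspose (e : X ≃ Y × Z) (A : Matrix Y Y ℂ) : (emb e A)ᴴ = emb e Aᴴ := by
  ext x y
  rw [Matrix.conjTranspose_apply, emb_apply, emb_apply, Matrix.conjTranspose_apply]
  by_cases h : (e x).2 = (e y).2
  · rw [if_pos h, if_pos h.symm]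
  · rw [if_neg h, if_neg (Ne.symm h), star_zero]

theorem emb_transpose (e : X ≃ Y × Z) (A : Matrix Y Y ℂ) : (emb e A)ᵀ = emb e Aᵀ := by
  ext x y
  rw [Matrix.transpose_apply, emb_apply, emb_apply, Matrix.transpose_apply]
  by_cases h : (e x).2 = (e y).2
  · rw [if_pos h, if_pos h.symm]
  · rw [if_neg h, if_neg (Ne.symm h)]

theorem emb_map_star (e : X ≃ Y × Z) (A : Matrix Y Y ℂ) : (emb e A).map star = emb e (A.map star) := by
  ext x y
  rw [Matrix.map_apply, emb_apply, emb_apply, Matrix.map_apply]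
  split_ifs <;> simp

theorem emb_unitary (e : X ≃ Y × Z) {U : Matrix Y Y ℂ} (h : Uᴴ * U = 1) : (emb e U)ᴴ * emb e U = 1 := by
  rw [emb_conjTranspose, ← emb_mul, h, emb_one]

/-- Slices of a vector. -/
def sl (e : X ≃ Y × Z) (z : ι → Z) : EuclideanSpace ℂ (ι → X) →ₗ[ℂ] EuclideanSpace ℂ (ι → Y) where
  toFun v := WithLp.toLp 2 (fun w => v (fun i => e.symm (w i, z i)))
  map_add' _ _ := rfl
  map_smul' _ _ := rfl

theorem sl_apply (e : X ≃ Y × Z) (z : ι → Z) (v : EuclideanSpace ℂ (ι → X)) (w : ι → Y) :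
    sl e z v w = v (fun i => e.symm (w i, z i)) := rfl

/-- Index equivalence. -/
def slE (e : X ≃ Y × Z) : (ι → Z) × (ι → Y) ≃ (ι → X) where
  toFun p := fun i => e.symm (p.2 i, p.1 i)
  invFun x := (fun i => (e (x i)).2, fun i => (e (x i)).1)
  left_inv p := by ext <;> simp
  right_inv x := by ext; simp

theorem sl_sum (e : X ≃ Y × Z) {M : Type*} [AddCommMonoid M] (f : (ι → X) → M) :
    ∑ x, f x = ∑ z : ι → Z, ∑ w : ι → Y, f (fun i => e.symm (w i, z i)) := by
  rw [← (slE e).sum_comp, Fintype.sum_prod_type]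
  rfl

theorem sl_inner (e : X ≃ Y × Z) (u v : EuclideanSpace ℂ (ι → X)) :
    ⟪u, v⟫ = ∑ z : ι → Z, ⟪sl e z u, sl e z v⟫ := by
  simp only [PiLp.inner_apply]
  rw [sl_sum e]
  rfl

theorem sl_norm (e : X ≃ Y × Z) (v : EuclideanSpace ℂ (ι → X)) :
    ‖v‖ ^ 2 = ∑ z : ι → Z, ‖sl e z v‖ ^ 2 := by
  have h := sl_inner e v v
  simp only [inner_self_eq_norm_sq_to_K] at h
  exact_mod_cast h

theorem sl_ext (e : X ≃ Y × Z) {u v : EuclideanSpace ℂ (ι → X)} (h : ∀ z : ι → Z, sl e z u = sl e z v) : u = v := by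
  have h1 := sl_norm e (u - v)
  have h2 : ‖u - v‖ ^ 2 = 0 := by
    rw [h1]
    apply Finset.sum_eq_zero
    intro z _
    rw [map_sub, h z, sub_self]; simp
  have h3 : ‖u - v‖ = 0 := by simpa using h2
  exact sub_eq_zero.1 (norm_eq_zero.1 h3)

theorem sl_tens (e : X ≃ Y × Z) (M : ι → Matrix Y Y ℂ) (v : EuclideanSpace ℂ (ι → X)) (z : ι → Z) :
    sl e z (mop (tens fun i => emb e (M i)) v) = mop (tens M) (sl e z v) := by
  ext w
  rw [sl_apply, mop_apply, mop_apply, sl_sum e, Finset.sum_eq_single z]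
  · apply Finset.sum_congr rfl
    intro w' _
    rw [sl_apply]
    congr 1
    apply Finset.prod_congr rfl
    intro i _
    simp [emb_apply]
  · intro z' _ hz
    apply Finset.sum_eq_zero
    intro w' _
    obtain ⟨i, hi⟩ := Function.ne_iff.1 hz
    rw [tens, Finset.prod_eq_zero (Finset.mem_univ i), zero_mul]
    simp [emb_apply, Ne.symm hi]
  · simp

theorem sl_Phi (e : X ≃ Y × Z) (t : ℕ) (U : Matrix Y Y ℂ) (v : EuclideanSpace ℂ (Fin t ⊕ Fin t → X))
    (z : Fin t ⊕ Fin t → Z) : sl e z (mop (Phi t (emb e U)) v) = mop (Phi t U) (sl e z v) := by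
  rw [Phi, Phi, ← sl_tens]
  congr 4
  ext1 i
  rcases i with i | i
  · rfl
  · simp only [Sum.elim_inr]
    rw [emb_map_star]

theorem sl_site (e : X ≃ Y × Z) (s : ι) (A : Matrix Y Y ℂ) (v : EuclideanSpace ℂ (ι → X))
    (z : ι → Z) : sl e z (mop (site s (emb e A)) v) = mop (site s A) (sl e z v) := by
  rw [site_def, site_def, ← sl_tens]
  congr 4
  ext1 i
  by_cases h : i = s
  · subst h; simp
  · simp only [Function.update_of_ne h]; rw [emb_one]

theorem sl_dpi (e : X ≃ Y × Z) (t : ℕ) (A : Matrix Y Y ℂ) (v : EuclideanSpace ℂ (Fin t ⊕ Fin t → X))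
    (z : Fin t ⊕ Fin t → Z) : sl e z (mop (dpi t (emb e A)) v) = mop (dpi t A) (sl e z v) := by
  rw [dpi_def, dpi_def, mop_sum, mop_sum, map_sum]
  apply Finset.sum_congr rfl
  intro s _
  rw [mop_sub, mop_sub, map_sub, sl_site, emb_transpose, sl_site]

/-- Vectors killed by the infinitesimal action of a tensor factor. -/
def embFix (t : ℕ) (e : X ≃ Y × Z) : Submodule ℂ (EuclideanSpace ℂ (Fin t ⊕ Fin t → X)) where
  carrier := {v | ∀ A : Matrix Y Y ℂ, mop (dpi t (emb e A)) v = 0}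
  add_mem' := by
    intro a b ha hb A
    rw [map_add, ha A, hb A, add_zero]
  zero_mem' := by intro A; rw [map_zero]
  smul_mem' := by
    intro c x hx A
    rw [map_smul, hx A, smul_zero]

theorem mem_embFix {t : ℕ} {e : X ≃ Y × Z} {v : EuclideanSpace ℂ (Fin t ⊕ Fin t → X)} :
    v ∈ embFix t e ↔ ∀ A : Matrix Y Y ℂ, mop (dpi t (emb e A)) v = 0 := Iff.rfl

theorem mem_embFix_sl {t : ℕ} {e : X ≃ Y × Z} {v : EuclideanSpace ℂ (Fin t ⊕ Fin t → X)} :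
    v ∈ embFix t e ↔ ∀ z, sl e z v ∈ lieFix t Y := by
  constructor
  · intro h z A
    rw [← sl_dpi, h A, map_zero]
  · intro h A
    apply sl_ext e
    intro z
    rw [sl_dpi, h z A, map_zero]

theorem embFix_iff {t : ℕ} {e : X ≃ Y × Z} {v : EuclideanSpace ℂ (Fin t ⊕ Fin t → X)} :
    v ∈ embFix t e ↔ ∀ U : Matrix Y Y ℂ, Uᴴ * U = 1 → mop (Phi t (emb e U)) v = v := by
  rw [mem_embFix_sl]
  constructor
  · intro h U hU
    apply sl_ext e
    intro z
    rw [sl_Phi, fix_of_lieFix (h z) hU]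
  · intro h z
    apply lieFix_of_fix
    intro U hU
    rw [← sl_Phi, h U hU]

theorem sl_proj (t : ℕ) (e : X ≃ Y × Z) (v : EuclideanSpace ℂ (Fin t ⊕ Fin t → X)) (z : Fin t ⊕ Fin t → Z) :
    sl e z ((embFix t e).starProjection v) = (lieFix t Y).starProjection (sl e z v) := by
  set v' : EuclideanSpace ℂ (Fin t ⊕ Fin t → X) := WithLp.toLp 2
    (fun x => ((lieFix t Y).starProjection (sl e (fun i => (e (x i)).2) v)) (fun i => (e (x i)).1)) with hv'
  have hs : ∀ z, sl e z v' = (lieFix t Y).starProjection (sl e z v) := by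
    intro z
    ext w
    rw [sl_apply, hv']
    simp
  have h1 : v' ∈ embFix t e := by
    rw [mem_embFix_sl]
    intro z
    rw [hs]
    exact Submodule.starProjection_apply_mem _ _
  have h2 : (embFix t e).starProjection v = v' := by
    apply Submodule.eq_starProjection_of_mem_of_inner_eq_zero h1
    intro w hw
    rw [sl_inner e]
    apply Finset.sum_eq_zero
    intro z _
    rw [map_sub, hs]
    exact Submodule.starProjection_inner_eq_zero _ _ (mem_embFix_sl.1 hw z)
  rw [h2, hs]

theorem emb_casimir (t : ℕ) (e : X ≃ Y × Z) (v : EuclideanSpace ℂ (Fin t ⊕ Fin t → X)) :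
    2 * (Fintype.card Y : ℝ) * ‖v - (embFix t e).starProjection v‖ ^ 2 ≤
      ∑ a : Y, ∑ b : Y, ‖mop (dpi t (emb e (Matrix.single a b 1))) v‖ ^ 2 := by
  rw [sl_norm e, Finset.mul_sum]
  have h : ∀ a b : Y, ‖mop (dpi t (emb e (Matrix.single a b 1))) v‖ ^ 2 = ∑ z, ‖mop (dpi t (Matrix.single a b 1)) (sl e z v)‖ ^ 2 := by
    intro a b
    rw [sl_norm e]
    simp only [sl_dpi]
  simp only [h]
  have h2 : ∑ a : Y, ∑ b : Y, ∑ z, ‖mop (dpi t (Matrix.single a b 1)) (sl e z v)‖ ^ 2 =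
     ∑ z, ∑ a : Y, ∑ b : Y, ‖mop (dpi t (Matrix.single a b 1)) (sl e z v)‖ ^ 2 := by
    rw [Finset.sum_comm]
    have : ∀ b : Y, ∑ a : Y, ∑ z, ‖mop (dpi t (Matrix.single a b 1)) (sl e z v)‖ ^ 2 = ∑ z, ∑ a : Y, ‖mop (dpi t (Matrix.single a b 1)) (sl e z v)‖ ^ 2 :=
      fun b => Finset.sum_comm
    simp only [this]
    rw [Finset.sum_comm]
    apply Finset.sum_congr rfl
    intro z _
    rw [Finset.sum_comm]
  rw [h2]
  apply Finset.sum_le_sum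
  intro z _
  rw [map_sub, sl_proj]
  exact casimir_gap t (sl e z v)

theorem sl_transfer (e : X ≃ Y × Z) (S : EuclideanSpace ℂ (ι → Y) →L[ℂ] EuclideanSpace ℂ (ι → Y))
    (u v : EuclideanSpace ℂ (ι → X)) (h : ∀ z : ι → Z, sl e z u = S (sl e z v)) {c : ℝ} (hc : 0 ≤ c)
    (hS : ‖S‖ ≤ c) : ‖u‖ ≤ c * ‖v‖ := by
  have : ‖u‖ ^ 2 ≤ (c * ‖v‖) ^ 2 := by
    rw [sl_norm e u, mul_pow, sl_norm e v, Finset.mul_sum]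
    apply Finset.sum_le_sum
    intro z _
    rw [h, ← mul_pow]
    exact pow_le_pow_left₀ (norm_nonneg _) (S.le_of_opNorm_le hS _) 2
  exact (sq_le_sq₀ (norm_nonneg _) (by positivity)).1 this

end Emb

section Pauli
variable {κ : Type*} [Fintype κ] [DecidableEq κ]
local notation "⟪" x "," y "⟫" => inner ℂ x y

/-- Pauli matrices. -/
def pauli : Fin 4 → Matrix (Fin 2) (Fin 2) ℂ :=
  ![1, !![0, 1; 1, 0], !![0, -Complex.I; Complex.I, 0], !![1, 0; 0, -1]]

/-- Commutation sign. -/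
def sg (a b : Fin 4) : ℤ := if a = 0 ∨ b = 0 ∨ a = b then 1 else -1

theorem pauli_zero : pauli 0 = 1 := rfl

theorem pauli_herm (a : Fin 4) : (pauli a)ᴴ = pauli a := by
  ext i j
  fin_cases a <;> fin_cases i <;> fin_cases j <;> simp [pauli, Matrix.conjTranspose_apply]

theorem pauli_sq (a : Fin 4) : pauli a * pauli a = 1 := by
  ext i j
  fin_cases a <;> fin_cases i <;> fin_cases j <;> simp [pauli, Matrix.mul_apply]

theorem pauli_comm (a b : Fin 4) : pauli a * pauli b = (sg a b : ℂ) • (pauli b * pauli a) := by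
  ext i j
  fin_cases a <;> fin_cases b <;> fin_cases i <;> fin_cases j <;>
    simp [pauli, sg, Matrix.mul_apply]

theorem pauli_complete (a b c d : Fin 2) :
    ∑ k, star (pauli k a b) * pauli k c d = if a = c ∧ b = d then 2 else 0 := by
  rw [Fin.sum_univ_four]
  fin_cases a <;> fin_cases b <;> fin_cases c <;> fin_cases d <;>
    simp [pauli, Complex.ext_iff] <;> norm_num

/-- Pauli strings. -/
def pw (p : κ → Fin 4) : Matrix (κ → Fin 2) (κ → Fin 2) ℂ := tens fun i => pauli (p i)

theorem pw_herm (p : κ → Fin 4) : (pw p)ᴴ = pw p := by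
  rw [pw, tens_conjTranspose]; simp only [pauli_herm]

theorem pw_sq (p : κ → Fin 4) : pw p * pw p = 1 := by
  rw [pw, tens_mul]; simp only [pauli_sq]; exact tens_one

theorem tens_smul (c : κ → ℂ) {X : Type*} [Fintype X] [DecidableEq X] (M : κ → Matrix X X ℂ) :
    tens (fun i => c i • M i) = (∏ i, c i) • tens M := by
  ext x y
  simp [tens, Finset.prod_mul_distrib]

theorem pw_comm (p q : κ → Fin 4) : pw p * pw q = ((∏ i, sg (p i) (q i) : ℤ) : ℂ) • (pw q * pw p) := by
  rw [pw, pw, tens_mul, tens_mul]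
  have : (fun i => pauli (p i) * pauli (q i)) = fun i => (sg (p i) (q i) : ℂ) • (pauli (q i) * pauli (p i)) := by
    ext1 i; exact pauli_comm _ _
  rw [this, tens_smul]
  push_cast
  rfl

theorem pw_complete (a b c d : κ → Fin 2) :
    ∑ q : κ → Fin 4, star (pw q a b) * pw q c d = if a = c ∧ b = d then 2 ^ Fintype.card κ else 0 := by
  have h : ∀ q : κ → Fin 4, star (pw q a b) * pw q c d = ∏ i, star (pauli (q i) (a i) (b i)) * pauli (q i) (c i) (d i) := by
    intro q
    simp [pw, tens, Finset.prod_mul_distrib]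
  simp only [h]
  have h2 := (Finset.prod_univ_sum (fun _ : κ => (Finset.univ : Finset (Fin 4)))
    (fun i k => star (pauli k (a i) (b i)) * pauli k (c i) (d i))).symm
  rw [Fintype.piFinset_univ] at h2
  rw [h2]
  simp only [pauli_complete]
  split_ifs with hh
  · obtain ⟨rfl, rfl⟩ := hh
    simp
  · have : ∃ i, ¬ (a i = c i ∧ b i = d i) := by
      by_contra! h3
      exact hh ⟨funext fun i => (h3 i).1, funext fun i => (h3 i).2⟩
    obtain ⟨i, hi⟩ := this
    exact Finset.prod_eq_zero (Finset.mem_univ i) (if_neg hi)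

theorem single_eq_pw (a b : κ → Fin 2) : (Matrix.single a b 1 : Matrix (κ → Fin 2) (κ → Fin 2) ℂ) =
    ((2 : ℂ) ^ Fintype.card κ)⁻¹ • ∑ q : κ → Fin 4, star (pw q a b) • pw q := by
  ext c d
  rw [Matrix.smul_apply, Matrix.sum_apply]
  simp only [Matrix.smul_apply, smul_eq_mul]
  rw [pw_complete, Matrix.single_apply]
  split_ifs <;> simp

theorem pw_norm_sum {E : Type*} [NormedAddCommGroup E] [InnerProductSpace ℂ E]
    (f : Matrix (κ → Fin 2) (κ → Fin 2) ℂ →ₗ[ℂ] E) :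
    ∑ q : κ → Fin 4, ‖f (pw q)‖ ^ 2 = 2 ^ Fintype.card κ * ∑ a, ∑ b, ‖f (Matrix.single a b 1)‖ ^ 2 := by
  have h1 : ∀ q, f (pw q) = ∑ ab : (κ → Fin 2) × (κ → Fin 2), pw q ab.1 ab.2 • f (Matrix.single ab.1 ab.2 1) := by
    intro q
    conv_lhs => rw [Matrix.matrix_eq_sum_single (pw q)]
    rw [map_sum, Fintype.sum_prod_type]
    apply Finset.sum_congr rfl
    intro a _
    rw [map_sum]
    apply Finset.sum_congr rfl
    intro b _
    have : Matrix.single a b (pw q a b) = pw q a b • Matrix.single a b (1 : ℂ) := by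
      rw [Matrix.smul_single, smul_eq_mul, mul_one]
    rw [this, map_smul]
  have h2 : ∀ q, ((‖f (pw q)‖ ^ 2 : ℝ) : ℂ) = ∑ ab : (κ → Fin 2) × (κ → Fin 2), ∑ cd : (κ → Fin 2) × (κ → Fin 2),
      (star (pw q ab.1 ab.2) * pw q cd.1 cd.2) * ⟪f (Matrix.single ab.1 ab.2 1), f (Matrix.single cd.1 cd.2 1)⟫ := by
    intro q
    have : ((‖f (pw q)‖ ^ 2 : ℝ) : ℂ) = ⟪f (pw q), f (pw q)⟫ := by
      rw [inner_self_eq_norm_sq_to_K]; norm_cast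
    rw [this, h1 q, sum_inner]
    apply Finset.sum_congr rfl
    intro ab _
    rw [inner_sum]
    apply Finset.sum_congr rfl
    intro cd _
    rw [inner_smul_left, inner_smul_right, ← mul_assoc]
    rfl
  have h3 : ((∑ q : κ → Fin 4, ‖f (pw q)‖ ^ 2 : ℝ) : ℂ) = ((2 ^ Fintype.card κ * ∑ a, ∑ b, ‖f (Matrix.single a b 1)‖ ^ 2 : ℝ) : ℂ) := by
    rw [Complex.ofReal_sum]
    simp only [h2]
    rw [Finset.sum_comm]
    have h4 : ∀ ab : (κ → Fin 2) × (κ → Fin 2), ∑ q : κ → Fin 4, ∑ cd : (κ → Fin 2) × (κ → Fin 2),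
      (star (pw q ab.1 ab.2) * pw q cd.1 cd.2) * ⟪f (Matrix.single ab.1 ab.2 1), f (Matrix.single cd.1 cd.2 1)⟫ =
       2 ^ Fintype.card κ * ((‖f (Matrix.single ab.1 ab.2 1)‖ ^ 2 : ℝ) : ℂ) := by
      intro ab
      rw [Finset.sum_comm]
      simp only [← Finset.sum_mul, pw_complete]
      rw [Finset.sum_eq_single ab]
      · rw [inner_self_eq_norm_sq_to_K]; simp
      · intro cd _ hcd
        rw [if_neg, zero_mul]
        rintro ⟨h5, h6⟩
        exact hcd (Prod.ext h5.symm h6.symm)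
      · simp
    simp only [h4]
    rw [← Finset.mul_sum, Fintype.sum_prod_type]
    push_cast
    rfl
  exact_mod_cast h3

variable (Q : κ → Prop) [DecidablePred Q]

/-- Splitting of the qubits. -/
def eQ : (κ → Fin 2) ≃ ({i // Q i} → Fin 2) × ({i // ¬ Q i} → Fin 2) :=
  Equiv.piEquivPiSubtypeProd Q (fun _ => Fin 2)

/-- Extension of labels by zero. -/
def extQ (q : {i // Q i} → Fin 4) : κ → Fin 4 := fun i => if h : Q i then q ⟨i, h⟩ else 0

theorem emb_pw (q : {i // Q i} → Fin 4) : emb (eQ Q) (pw q) = pw (extQ Q q) := by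
  ext x y
  rw [emb_apply, pw, tens, pw, tens]
  rw [← Fintype.prod_subtype_mul_prod_subtype Q]
  have h1 : ∏ i : {i // Q i}, pauli (extQ Q q i) (x i) (y i) = ∏ i, pauli (q i) ((eQ Q x).1 i) ((eQ Q y).1 i) := by
    apply Finset.prod_congr rfl
    intro i _
    have : extQ Q q i = q i := by rw [extQ, dif_pos i.2]
    rw [this]; rfl
  have h2 : ∏ i : {i // ¬ Q i}, pauli (extQ Q q i) (x i) (y i) = if (eQ Q x).2 = (eQ Q y).2 then 1 else 0 := by
    have : ∀ i : {i // ¬ Q i}, pauli (extQ Q q i) (x i) (y i) = (1 : Matrix (Fin 2) (Fin 2) ℂ) ((eQ Q x).2 i) ((eQ Q y).2 i) := by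
      intro i
      have : extQ Q q i = 0 := by rw [extQ, dif_neg i.2]
      rw [this]; rfl
    simp only [this]
    have h3 := congrFun (congrFun (tens_one (ι := {i // ¬ Q i}) (X := Fin 2)) (eQ Q x).2) (eQ Q y).2
    rw [tens, Matrix.one_apply] at h3
    exact h3
  rw [h1, h2]
  split_ifs <;> simp

/-- Supported in `Q`. -/
def Supp (p : κ → Fin 4) : Prop := ∀ i, p i ≠ 0 → Q i

theorem supp_extQ (q : {i // Q i} → Fin 4) : Supp Q (extQ Q q) := by
  intro i hi
  by_contra h
  apply hi
  rw [extQ, dif_neg h]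

theorem exists_extQ {p : κ → Fin 4} (h : Supp Q p) : ∃ q, p = extQ Q q := by
  refine ⟨fun i => p i, ?_⟩
  ext1 i
  rw [extQ]
  split_ifs with h1
  · rfl
  · by_contra h2
    exact h1 (h i h2)

theorem mem_embFix_pw {t : ℕ} {v : EuclideanSpace ℂ (Fin t ⊕ Fin t → (κ → Fin 2))} :
    v ∈ embFix t (eQ Q) ↔ ∀ p, Supp Q p → mop (dpi t (pw p)) v = 0 := by
  constructor
  · intro h p hp
    obtain ⟨q, rfl⟩ := exists_extQ Q hp
    rw [← emb_pw]
    exact h _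
  · intro h A
    rw [Matrix.matrix_eq_sum_single A]
    simp only [map_sum, mop_sum]
    apply Finset.sum_eq_zero
    intro a _
    apply Finset.sum_eq_zero
    intro b _
    have : Matrix.single a b (A a b) = A a b • Matrix.single a b (1 : ℂ) := by
      rw [Matrix.smul_single, smul_eq_mul, mul_one]
    rw [this, single_eq_pw]
    simp only [map_smul, map_sum, mop_smul, mop_sum, emb_pw]
    rw [Finset.sum_eq_zero, smul_zero, smul_zero]
    intro q _
    rw [h _ (supp_extQ Q q), smul_zero]

/-- The linear map from matrices to vectors. -/
def actL (t : ℕ) {X : Type*} [Fintype X] [DecidableEq X] (v : EuclideanSpace ℂ (Fin t ⊕ Fin t → X)) :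
    Matrix X X ℂ →ₗ[ℂ] EuclideanSpace ℂ (Fin t ⊕ Fin t → X) where
  toFun A := mop (dpi t A) v
  map_add' A B := by rw [map_add, mop_add]
  map_smul' c A := by rw [map_smul, mop_smul]; rfl

theorem pauli_gap (t : ℕ) (v : EuclideanSpace ℂ (Fin t ⊕ Fin t → (κ → Fin 2))) (B : ℝ)
    (h : ∀ p, Supp Q p → ‖mop (dpi t (pw p)) v‖ ≤ B) :
    2 * ‖v - (embFix t (eQ Q)).starProjection v‖ ^ 2 ≤ B ^ 2 := by
  have h1 := emb_casimir t (eQ Q) v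
  have h2 := pw_norm_sum ((actL t v).comp (emb (eQ Q)))
  have h3 : ∑ a, ∑ b, ‖((actL t v).comp (emb (eQ Q))) (Matrix.single a b 1)‖ ^ 2 =
    ∑ a, ∑ b, ‖mop (dpi t (emb (eQ Q) (Matrix.single a b 1))) v‖ ^ 2 := rfl
  rw [h3] at h2
  have hB : 0 ≤ B := (norm_nonneg _).trans (h (fun _ => 0) (by intro i hi; simp at hi))
  have h4 : ∑ q : {i // Q i} → Fin 4, ‖((actL t v).comp (emb (eQ Q))) (pw q)‖ ^ 2 ≤ 4 ^ Fintype.card {i // Q i} * B ^ 2 := by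
    have : ∀ q ∈ (Finset.univ : Finset ({i // Q i} → Fin 4)), ‖((actL t v).comp (emb (eQ Q))) (pw q)‖ ^ 2 ≤ B ^ 2 := by
      intro q _
      have e : ((actL t v).comp (emb (eQ Q))) (pw q) = mop (dpi t (pw (extQ Q q))) v := by
        rw [← emb_pw]; rfl
      rw [e]
      exact pow_le_pow_left₀ (norm_nonneg _) (h _ (supp_extQ Q q)) 2
    refine (Finset.sum_le_card_nsmul _ _ _ this).trans ?_
    simp
  rw [h2] at h4
  have hc : (Fintype.card ({i // Q i} → Fin 2) : ℝ) = 2 ^ Fintype.card {i // Q i} := by simp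
  rw [hc] at h1
  have hpos : (0 : ℝ) < 2 ^ Fintype.card {i // Q i} := by positivity
  have h44 : (4 : ℝ) ^ Fintype.card {i // Q i} = 2 ^ Fintype.card {i // Q i} * 2 ^ Fintype.card {i // Q i} := by
    rw [← mul_pow]; norm_num
  rw [h44, mul_assoc] at h4
  have h5 := le_of_mul_le_mul_left h4 hpos
  have h6 := h1.trans h5
  have : 2 ^ Fintype.card {i // Q i} * (2 * ‖v - (embFix t (eQ Q)).starProjection v‖ ^ 2) ≤ 2 ^ Fintype.card {i // Q i} * B ^ 2 := by
    linarith
  exact le_of_mul_le_mul_left this hpos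

end Pauli

section Local
variable {κ : Type*} [Fintype κ] [DecidableEq κ] (Q : κ → Prop) [DecidablePred Q]
local notation "⟪" x "," y "⟫" => inner ℂ x y

/-- Restriction of labels. -/
def resQ (p : κ → Fin 4) : κ → Fin 4 := fun i => if Q i then p i else 0

/-- Restriction of labels to the complement. -/
def coQ (p : κ → Fin 4) : κ → Fin 4 := fun i => if Q i then 0 else p i

theorem supp_resQ (p : κ → Fin 4) : Supp Q (resQ Q p) := by
  intro i hi
  by_contra h
  simp [resQ, h] at hi

theorem sg_zero_left (a : Fin 4) : sg 0 a = 1 := by simp [sg]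
theorem sg_zero_right (a : Fin 4) : sg a 0 = 1 := by simp [sg]

theorem pw_split (p : κ → Fin 4) : pw p = pw (resQ Q p) * pw (coQ Q p) := by
  rw [pw, pw, pw, tens_mul]
  congr 1
  ext1 i
  by_cases h : Q i
  · simp [resQ, coQ, h, pauli_zero]
  · simp [resQ, coQ, h, pauli_zero]

theorem pw_commute_of {p q : κ → Fin 4} (h : ∀ i, p i = 0 ∨ q i = 0) : pw p * pw q = pw q * pw p := by
  rw [pw_comm, Finset.prod_eq_one]
  · simp
  · intro i _
    rcases h i with h | h
    · rw [h, sg_zero_left]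
    · rw [h, sg_zero_right]

theorem emb_res (p : κ → Fin 4) : ∃ q, emb (eQ Q) (pw q) = pw (resQ Q p) := by
  obtain ⟨q, hq⟩ := exists_extQ Q (supp_resQ Q p)
  exact ⟨q, by rw [emb_pw, ← hq]⟩

theorem emb_injective : Function.Injective (emb (eQ Q)) := by
  intro A B h
  ext a b
  have h1 := congrFun (congrFun h ((eQ Q).symm (a, fun _ => 0))) ((eQ Q).symm (b, fun _ => 0))
  simpa [emb_apply] using h1

theorem rot_exists (p q : κ → Fin 4) (hco : ∀ i, ¬ Q i → p i = q i)
    (hs : ∏ i, sg (resQ Q p i) (resQ Q q i) = -1) :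
    ∃ U : Matrix ({i // Q i} → Fin 2) ({i // Q i} → Fin 2) ℂ, Uᴴ * U = 1 ∧
      emb (eQ Q) U * pw p = pw q * emb (eQ Q) U := by
  obtain ⟨p1, hp1⟩ := emb_res Q p
  obtain ⟨q1, hq1⟩ := emb_res Q q
  set A := pw (resQ Q p) with hA
  set B := pw (resQ Q q) with hB
  set c : ℂ := Complex.ofReal ((Real.sqrt 2)⁻¹) with hc
  have hcc : c * c = 2⁻¹ := by
    rw [hc, ← Complex.ofReal_mul, ← mul_inv, Real.mul_self_sqrt (by norm_num)]
    simp
  have hcs : star c = c := by rw [hc]; exact Complex.conj_ofReal _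
  have hAB : A * B = -(B * A) := by
    rw [hA, hB, pw_comm, hs]; simp
  have hAA : A * A = 1 := pw_sq _
  have hBB : B * B = 1 := pw_sq _
  have hG : emb (eQ Q) (c • (pw p1 + pw q1)) = c • (A + B) := by
    rw [map_smul, map_add, hp1, hq1]
  refine ⟨c • (pw p1 + pw q1), ?_, ?_⟩
  · apply emb_injective Q
    rw [emb_mul, ← emb_conjTranspose, hG, emb_one, Matrix.conjTranspose_smul, Matrix.conjTranspose_add, hA, hB, pw_herm, pw_herm, ← hA, ← hB, hcs,
      smul_mul_smul_comm, hcc, add_mul, mul_add, mul_add, hAA, hBB, hAB]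
    have : (1 : Matrix (κ → Fin 2) (κ → Fin 2) ℂ) + -(B * A) + (B * A + 1) = (2 : ℂ) • 1 := by
      rw [two_smul]; abel
    rw [this, smul_smul]; norm_num
  · have hcoq : coQ Q p = coQ Q q := by
      ext1 i
      by_cases h : Q i
      · simp [coQ, h]
      · simp [coQ, h, hco i h]
    have hd : ∀ r : κ → Fin 4, pw (resQ Q r) * pw (coQ Q q) = pw (coQ Q q) * pw (resQ Q r) := by
      intro r
      apply pw_commute_of
      intro i
      by_cases h : Q i
      · right; simp [coQ, h]
      · left; simp [resQ, h]
    rw [hG, pw_split Q p, pw_split Q q, hcoq, ← hA, ← hB]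
    have e1 : (c • (A + B)) * (A * pw (coQ Q q)) = (c • (1 + B * A)) * pw (coQ Q q) := by
      rw [← mul_assoc, smul_mul_assoc, add_mul, hAA]
    have e2 : B * pw (coQ Q q) * (c • (A + B)) = (c • (1 + B * A)) * pw (coQ Q q) := by
      rw [mul_assoc, mul_smul_comm, mul_add, ← hd p, ← hd q, ← hA, ← hB, ← add_mul, mul_smul_comm, ← mul_assoc, mul_add, hBB, smul_mul_assoc, add_comm (B * A)]
    rw [e1, e2]

theorem rot_norm (t : ℕ) (p q : κ → Fin 4) {U : Matrix ({i // Q i} → Fin 2) ({i // Q i} → Fin 2) ℂ}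
    (hU : Uᴴ * U = 1) (h : emb (eQ Q) U * pw p = pw q * emb (eQ Q) U)
    (v : EuclideanSpace ℂ (Fin t ⊕ Fin t → (κ → Fin 2))) :
    ‖mop (dpi t (pw p)) v‖ ≤ ‖mop (dpi t (pw q)) v‖ + 4 * t * ‖v - (embFix t (eQ Q)).starProjection v‖ := by
  set G := emb (eQ Q) U with hG
  have hGG : Gᴴ * G = 1 := emb_unitary _ hU
  have hGG' : G * Gᴴ = 1 := mul_eq_one_comm.1 hGG
  have h' : pw p * Gᴴ = Gᴴ * pw q := by
    calc pw p * Gᴴ = Gᴴ * (G * pw p) * Gᴴ := by rw [← mul_assoc, hGG, one_mul]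
      _ = Gᴴ * pw q * (G * Gᴴ) := by rw [h]; simp only [mul_assoc]
      _ = _ := by rw [hGG', mul_one]
  have h1 := Phi_dpi t G (pw p) (pw q) h h'
  have hun := Phi_unitary t hGG
  have h2 : mop (Phi t G) (mop (dpi t (pw p)) v) = mop (dpi t (pw q)) (mop (Phi t G) v) := by
    rw [← mop_mul, ← mop_mul, h1]
  set w := (embFix t (eQ Q)).starProjection v with hw
  have hwm : w ∈ embFix t (eQ Q) := Submodule.starProjection_apply_mem _ _
  have h3 : mop (Phi t G) w = w := embFix_iff.1 hwm U hU
  have h4 : mop (Phi t G) v = v + (mop (Phi t G) (v - w) - (v - w)) := by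
    rw [map_sub, h3]; abel
  have hq1 : (pw q)ᴴ * pw q = 1 := by rw [pw_herm, pw_sq]
  calc ‖mop (dpi t (pw p)) v‖ = ‖mop (dpi t (pw q)) (mop (Phi t G) v)‖ := by
        rw [← h2, mop_norm_of_unitary hun]
    _ ≤ ‖mop (dpi t (pw q)) v‖ + ‖mop (dpi t (pw q)) (mop (Phi t G) (v - w) - (v - w))‖ := by
        rw [h4, map_add]; exact norm_add_le _ _
    _ ≤ ‖mop (dpi t (pw q)) v‖ + 2 * t * (2 * ‖v - w‖) := by
        gcongr
        refine (dpi_norm t hq1 _).trans ?_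
        gcongr
        refine (norm_sub_le _ _).trans ?_
        rw [mop_norm_of_unitary hun]; linarith
    _ = _ := by ring

theorem loc_norm (t : ℕ) (p : κ → Fin 4) (hp : Supp Q p)
    (v : EuclideanSpace ℂ (Fin t ⊕ Fin t → (κ → Fin 2))) :
    ‖mop (dpi t (pw p)) v‖ ≤ 2 * t * ‖v - (embFix t (eQ Q)).starProjection v‖ := by
  set w := (embFix t (eQ Q)).starProjection v with hw
  have hwm : w ∈ embFix t (eQ Q) := Submodule.starProjection_apply_mem _ _
  have h0 := (mem_embFix_pw Q).1 hwm p hp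
  have : mop (dpi t (pw p)) v = mop (dpi t (pw p)) (v - w) := by rw [map_sub, h0, sub_zero]
  rw [this]
  exact dpi_norm t (by rw [pw_herm, pw_sq]) _

end Local

section Chain
local notation "⟪" x "," y "⟫" => inner ℂ x y

/-- Qubits on which gate `i` acts. -/
def gQ (n i : ℕ) : Fin n → Prop := fun r => r.val = i ∨ r.val = i + 1

/-- Fixed space of gate `i`. -/
def Fg (n t i : ℕ) : Submodule ℂ (EuclideanSpace ℂ (Fin t ⊕ Fin t → (Fin n → Fin 2))) :=
  if i + 1 < n then embFix t (eQ (gQ n i)) else ⊤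

theorem sg_exists : ∀ s0 s1 : Fin 4, (s1 ≠ 0) → ∃ r0 r1 : Fin 4, sg s0 r0 * sg s1 r1 = -1 ∧ sg r0 3 * sg r1 0 = -1 := by
  simp only [sg]
  decide

theorem prod_gQ {n b : ℕ} (hb : b + 1 < n) (p q : Fin n → Fin 4) :
    ∏ i, sg (resQ (gQ n b) p i) (resQ (gQ n b) q i) =
      sg (p ⟨b, by omega⟩) (q ⟨b, by omega⟩) * sg (p ⟨b + 1, hb⟩) (q ⟨b + 1, hb⟩) := by
  have hne : (⟨b, by omega⟩ : Fin n) ≠ ⟨b + 1, hb⟩ := by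
    intro h; simp at h
  rw [← Finset.prod_subset (Finset.subset_univ {(⟨b, by omega⟩ : Fin n), ⟨b + 1, hb⟩}), Finset.prod_pair hne]
  · simp [resQ, gQ]
  · intro i _ hi
    have : ¬ gQ n b i := by
      rintro (h | h)
      · apply hi; simp [Fin.ext_iff, h]
      · apply hi; simp [Fin.ext_iff, h]
    simp [resQ, this, sg]

/-- Step of the induction. -/
theorem step_norm {n t b : ℕ} (hb : b + 1 < n) (p : Fin n → Fin 4) (hp : p ⟨b + 1, hb⟩ ≠ 0)
    (v : EuclideanSpace ℂ (Fin t ⊕ Fin t → (Fin n → Fin 2))) :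
    ∃ q : Fin n → Fin 4, q ⟨b + 1, hb⟩ = 0 ∧ (∀ i : Fin n, i.val ≠ b → i.val ≠ b + 1 → q i = p i) ∧
      ‖mop (dpi t (pw p)) v‖ ≤ ‖mop (dpi t (pw q)) v‖ + 4 * t * ‖v - (Fg n t b).starProjection v‖ := by
  obtain ⟨r0, r1, h1, h2⟩ := sg_exists (p ⟨b, by omega⟩) (p ⟨b + 1, hb⟩) hp
  have hF : Fg n t b = embFix t (eQ (gQ n b)) := by rw [Fg, if_pos hb]
  set q1 : Fin n → Fin 4 := fun i => if i.val = b then r0 else if i.val = b + 1 then r1 else p i with hq1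
  set q2 : Fin n → Fin 4 := fun i => if i.val = b then 3 else if i.val = b + 1 then 0 else p i with hq2
  have a1 : ∀ i : Fin n, ¬ gQ n b i → p i = q1 i := by
    intro i hi
    simp only [gQ, not_or] at hi
    simp [hq1, hi.1, hi.2]
  have a2 : ∀ i : Fin n, ¬ gQ n b i → q1 i = q2 i := by
    intro i hi
    simp only [gQ, not_or] at hi
    simp [hq1, hq2, hi.1, hi.2]
  obtain ⟨U1, u1, e1⟩ := rot_exists (gQ n b) p q1 a1 (by rw [prod_gQ hb, ← h1]; simp [hq1])
  obtain ⟨U2, u2, e2⟩ := rot_exists (gQ n b) q1 q2 a2 (by rw [prod_gQ hb, ← h2]; simp [hq1, hq2])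
  refine ⟨q2, by simp [hq2], fun i h h' => by simp [hq2, h, h'], ?_⟩
  rw [hF]
  apply rot_norm (gQ n b) t p q2 (U := U2 * U1)
  · rw [Matrix.conjTranspose_mul, mul_assoc, ← mul_assoc U2ᴴ, u2, one_mul, u1]
  · rw [emb_mul, mul_assoc, e1, ← mul_assoc, e2, mul_assoc]

theorem interval_norm {n t : ℕ} (v : EuclideanSpace ℂ (Fin t ⊕ Fin t → (Fin n → Fin 2))) (a m : ℕ) :
    a + 1 + m < n → ∀ p : Fin n → Fin 4, (∀ i, p i ≠ 0 → a ≤ i.val ∧ i.val ≤ a + 1 + m) →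
    ‖mop (dpi t (pw p)) v‖ ≤ 4 * t * ∑ i ∈ Finset.Ico a (a + 1 + m), ‖v - (Fg n t i).starProjection v‖ := by
  induction m with
  | zero =>
    intro hm p hp
    have hF : Fg n t a = embFix t (eQ (gQ n a)) := by rw [Fg, if_pos (by omega)]
    rw [add_zero, Nat.Ico_succ_singleton, Finset.sum_singleton, hF]
    refine (loc_norm (gQ n a) t p ?_ v).trans ?_
    · intro i hi
      have := hp i hi
      simp only [gQ]; omega
    · have := norm_nonneg (v - (embFix t (eQ (gQ n a))).starProjection v)
      have : (0 : ℝ) ≤ t := by positivity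
      nlinarith
  | succ m ih =>
    intro hm p hp
    have hm' : (a + 1 + m) + 1 < n := by omega
    have hs : ∑ i ∈ Finset.Ico a (a + 1 + (m + 1)), ‖v - (Fg n t i).starProjection v‖ =
      ∑ i ∈ Finset.Ico a (a + 1 + m), ‖v - (Fg n t i).starProjection v‖ + ‖v - (Fg n t (a + 1 + m)).starProjection v‖ := by
      rw [← add_assoc, Finset.sum_Ico_succ_top (by omega)]
    rw [hs, mul_add]
    by_cases h0 : p ⟨a + 1 + m + 1, hm'⟩ = 0
    · have := ih (by omega) p (by
        intro i hi
        have h1 := hp i hi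
        have : i.val ≠ a + 1 + m + 1 := by
          intro h2
          apply hi
          have : i = ⟨a + 1 + m + 1, hm'⟩ := Fin.ext h2
          rw [this, h0]
        omega)
      have h2 : 0 ≤ 4 * (t : ℝ) * ‖v - (Fg n t (a + 1 + m)).starProjection v‖ := by positivity
      linarith
    · obtain ⟨q, hq0, hq1, hq2⟩ := step_norm hm' p h0 v
      have := ih (by omega) q (by
        intro i hi
        by_cases c1 : i.val = a + 1 + m
        · omega
        · have c2 : i.val ≠ a + 1 + m + 1 := by
            intro h2
            apply hi
            have : i = ⟨a + 1 + m + 1, hm'⟩ := Fin.ext h2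
            rw [this, hq0]
          have h3 := hp i (by rw [← hq1 i c1 c2]; exact hi)
          omega)
      linarith

theorem Fg_farComm (n t : ℕ) : FarComm (Fg n t) := by
  intro i j hij
  by_cases h1 : i + 1 < n
  swap
  · have hi : Fg n t i = ⊤ := if_neg h1
    simp only [hi]
    rw [show (⊤ : Submodule ℂ (EuclideanSpace ℂ (Fin t ⊕ Fin t → (Fin n → Fin 2)))).starProjection = 1 from Submodule.starProjection_top']
    exact Commute.one_left _
  by_cases h2 : j + 1 < n
  swap
  · have hj : Fg n t j = ⊤ := if_neg h2
    simp only [hj]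
    rw [show (⊤ : Submodule ℂ (EuclideanSpace ℂ (Fin t ⊕ Fin t → (Fin n → Fin 2)))).starProjection = 1 from Submodule.starProjection_top']
    exact Commute.one_right _
  have hi : Fg n t i = embFix t (eQ (gQ n i)) := if_pos h1
  have hj : Fg n t j = embFix t (eQ (gQ n j)) := if_pos h2
  simp only [hi, hj]
  · have key : ∀ p, Supp (gQ n i) p → Commute (mop (dpi t (pw p))) (embFix t (eQ (gQ n j))).starProjection := by
      intro p hp
      have hstab : ∀ x ∈ embFix t (eQ (gQ n j)), mop (dpi t (pw p)) x ∈ embFix t (eQ (gQ n j)) := by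
        intro x hx
        rw [mem_embFix_pw] at hx ⊢
        intro q hq
        have hc : pw p * pw q = pw q * pw p := by
          apply pw_commute_of
          intro r
          by_contra! hr
          have h3 := hp r hr.1
          have h4 := hq r hr.2
          simp only [gQ] at h3 h4
          omega
        have h5 := dpi_comm t (pw p) (pw q)
        rw [hc, sub_self, map_zero, sub_eq_zero] at h5
        rw [← mop_mul, ← h5, mop_mul, hx q hq, map_zero]
      refine commute_starProjection_of_mem _ _ (mop (dpi t (pw p))) ?_ hstab hstab
      intro x y
      have := mop_inner (dpi t (pw p)) x y
      rwa [dpi_conjTranspose, pw_herm] at this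
    have hstab2 : ∀ x ∈ embFix t (eQ (gQ n i)), (embFix t (eQ (gQ n j))).starProjection x ∈ embFix t (eQ (gQ n i)) := by
      intro x hx
      rw [mem_embFix_pw] at hx ⊢
      intro p hp
      have h6 := commute_apply (key p hp) x
      rw [h6, hx p hp, map_zero]
    refine (commute_starProjection_of_mem _ _ (embFix t (eQ (gQ n j))).starProjection ?_ hstab2 hstab2).symm
    intro x y
    exact proj_symm _ x y

theorem proj_sub_le_of_mem {E : Type*} [NormedAddCommGroup E] [InnerProductSpace ℂ E] [FiniteDimensional ℂ E]
    (K : Submodule ℂ E) {v w : E} (hw : w ∈ K) : ‖v - K.starProjection v‖ ≤ ‖v - w‖ := by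
  have h := proj_sub_norm_le K (v - w)
  rw [map_sub, Submodule.starProjection_eq_self_iff.2 hw] at h
  convert h using 2
  abel

theorem Fg_loc (n t : ℕ) (a b : ℕ) (v : EuclideanSpace ℂ (Fin t ⊕ Fin t → (Fin n → Fin 2))) (hab : a < b) :
    ‖v - chainProj (Fg n t) (Set.Ico a b) v‖ ^ 2 ≤
      (8 * (t : ℝ) ^ 2) * ((b - a : ℕ) : ℝ) * ∑ i ∈ Finset.Ico a b, ‖v - (Fg n t i).starProjection v‖ ^ 2 := by
  by_cases han : a + 1 < n
  · set b' := min b (n - 1) with hb'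
    obtain ⟨m, hm⟩ : ∃ m, b' = a + 1 + m := ⟨b' - (a + 1), by omega⟩
    set Q : Fin n → Prop := fun r => a ≤ r.val ∧ r.val ≤ a + 1 + m with hQ
    set D := ∑ i ∈ Finset.Ico a (a + 1 + m), ‖v - (Fg n t i).starProjection v‖ with hD
    have h1 := pauli_gap Q t v (4 * t * D) (fun p hp => interval_norm v a m (by omega) p hp)
    have h2 : ‖v - chainProj (Fg n t) (Set.Ico a b) v‖ ≤ ‖v - (embFix t (eQ Q)).starProjection v‖ := by
      apply proj_sub_le_of_mem
      rw [mem_chainFix]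
      intro i hi
      rw [Fg]
      split_ifs with hin
      · have hm1 : (embFix t (eQ Q)).starProjection v ∈ embFix t (eQ Q) := Submodule.starProjection_apply_mem _ _
        rw [mem_embFix_pw] at hm1 ⊢
        intro p hp
        apply hm1
        intro r hr
        have h3 := hp r hr
        have h4 := hi.1
        have h5 := hi.2
        simp only [gQ] at h3
        simp only [hQ]
        omega
      · trivial
    have h3 : D ^ 2 ≤ ((b - a : ℕ) : ℝ) * ∑ i ∈ Finset.Ico a b, ‖v - (Fg n t i).starProjection v‖ ^ 2 := by
      have e1 := sq_sum_le_card_mul_sum_sq (s := Finset.Ico a (a + 1 + m)) (f := fun i => ‖v - (Fg n t i).starProjection v‖)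
      rw [Nat.card_Ico] at e1
      refine e1.trans ?_
      have e2 : ((a + 1 + m - a : ℕ) : ℝ) ≤ ((b - a : ℕ) : ℝ) := by
        exact_mod_cast (by omega)
      apply mul_le_mul e2 _ (Finset.sum_nonneg fun i _ => sq_nonneg _) (by positivity)
      apply Finset.sum_le_sum_of_subset_of_nonneg
      · apply Finset.Ico_subset_Ico le_rfl
        omega
      · intro i _ _; positivity
    have h4 : ‖v - chainProj (Fg n t) (Set.Ico a b) v‖ ^ 2 ≤ ‖v - (embFix t (eQ Q)).starProjection v‖ ^ 2 :=
      pow_le_pow_left₀ (norm_nonneg _) h2 2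
    have h5 : (4 * (t : ℝ) * D) ^ 2 = 16 * (t : ℝ) ^ 2 * D ^ 2 := by ring
    rw [h5] at h1
    have h6 : 0 ≤ (t : ℝ) ^ 2 := by positivity
    nlinarith
  · have h1 : chainProj (Fg n t) (Set.Ico a b) v = v := by
      apply (chainProj_eq_self ..).2
      rw [mem_chainFix]
      intro i hi
      rw [Fg, if_neg (by have := hi.1; omega)]
      trivial
    rw [h1, sub_self, norm_zero]
    have : 0 ≤ ∑ i ∈ Finset.Ico a b, ‖v - (Fg n t i).starProjection v‖ ^ 2 := Finset.sum_nonneg fun i _ => sq_nonneg _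
    rw [zero_pow two_ne_zero]
    positivity

theorem lieFix_pw {n t : ℕ} {v : EuclideanSpace ℂ (Fin t ⊕ Fin t → (Fin n → Fin 2))}
    (h : ∀ p, mop (dpi t (pw p)) v = 0) : v ∈ lieFix t (Fin n → Fin 2) := by
  intro A
  rw [Matrix.matrix_eq_sum_single A]
  simp only [map_sum, mop_sum]
  apply Finset.sum_eq_zero
  intro a _
  apply Finset.sum_eq_zero
  intro b _
  have : Matrix.single a b (A a b) = A a b • Matrix.single a b (1 : ℂ) := by
    rw [Matrix.smul_single, smul_eq_mul, mul_one]
  rw [this, single_eq_pw]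
  simp only [map_smul, map_sum, mop_smul, mop_sum]
  rw [Finset.sum_eq_zero, smul_zero, smul_zero]
  intro q _
  rw [h, smul_zero]

theorem chainFix_univ {n : ℕ} (hn : 2 ≤ n) (t : ℕ) : chainFix (Fg n t) Set.univ = lieFix t (Fin n → Fin 2) := by
  apply le_antisymm
  · intro v hv
    rw [mem_chainFix] at hv
    apply lieFix_pw
    intro p
    obtain ⟨m, hm⟩ : ∃ m, n = 0 + 1 + m + 1 := ⟨n - 2, by omega⟩
    have h1 := interval_norm v 0 m (by omega) p (fun i _ => ⟨Nat.zero_le _, by omega⟩)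
    rw [Finset.sum_eq_zero, mul_zero] at h1
    · exact norm_le_zero_iff.1 h1
    · intro i _
      rw [Submodule.starProjection_eq_self_iff.2 (hv i (Set.mem_univ i)), sub_self, norm_zero]
  · intro v hv
    rw [mem_chainFix]
    intro i _
    rw [Fg]
    split_ifs
    · intro A; exact hv _
    · trivial

end Chain

section Gap
local notation "⟪" x "," y "⟫" => inner ℂ x y

theorem dpi_one_iff {X : Type*} [Fintype X] [DecidableEq X] {A : Matrix X X ℂ} (hA : Aᴴ = A) (hA2 : A * A = 1)
    (v : EuclideanSpace ℂ (Fin 1 ⊕ Fin 1 → X)) :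
    mop (dpi 1 A) v = 0 ↔ mop (Phi 1 A) v = v := by
  have h1 : dpi 1 A = site (Sum.inl 0) A - site (Sum.inr 0) Aᵀ := by
    rw [dpi_def]; simp
  have hm : A.map star = Aᵀ := by
    conv_rhs => rw [← hA]
    rfl
  have h2 : Phi 1 A = site (Sum.inl 0) A * site (Sum.inr 0) Aᵀ := by
    rw [Phi, site_def, site_def, tens_mul]
    congr 1
    ext1 i
    rcases i with i | i
    · have : i = 0 := Subsingleton.elim _ _
      subst this
      simp
    · have : i = 0 := Subsingleton.elim _ _
      subst this
      simpa using hm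
  have ha : site (Sum.inl 0) A * site (Sum.inl 0) A = (1 : Matrix (Fin 1 ⊕ Fin 1 → X) (Fin 1 ⊕ Fin 1 → X) ℂ) := by
    rw [site_mul, hA2, site_one]
  rw [h1, h2, mop_sub, mop_mul, sub_eq_zero]
  constructor
  · intro h
    rw [← h, ← mop_mul, ha, mop_one]
  · intro h
    have := congrArg (mop (site (Sum.inl 0) A)) h
    rw [← mop_mul, ha, mop_one] at this
    exact this.symm

theorem Phi_pw_comm {κ : Type*} [Fintype κ] [DecidableEq κ] (p q : κ → Fin 4) :
    Phi 1 (pw p) * Phi 1 (pw q) = Phi 1 (pw q) * Phi 1 (pw p) := by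
  rw [← Phi_mul, ← Phi_mul, pw_comm]
  have hz : ∀ (c : ℤ) , c * c = 1 → ∀ M : Matrix (κ → Fin 2) (κ → Fin 2) ℂ, Phi 1 ((c : ℂ) • M) = Phi 1 M := by
    intro c hc M
    ext x y
    simp only [Phi, tens, Fintype.prod_sum_type, Sum.elim_inl, Sum.elim_inr, Matrix.smul_apply, Matrix.map_apply, smul_eq_mul]
    simp only [Finset.univ_unique, Finset.prod_singleton, star_mul', star_intCast]
    have : (c : ℂ) * c = 1 := by exact_mod_cast hc
    linear_combination (M (x (Sum.inl default)) (y (Sum.inl default)) * star (M (x (Sum.inr default)) (y (Sum.inr default)))) * this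
  apply hz
  rw [← Finset.prod_mul_distrib]
  apply Finset.prod_eq_one
  intro i _
  generalize p i = a
  generalize q i = b
  revert a b
  unfold sg
  decide

theorem Fg_top {n t i : ℕ} (h : n - 1 ≤ i) : Fg n t i = ⊤ := if_neg (by omega)

theorem Fg_comm_one (n i j : ℕ) : Commute (Fg n 1 i).starProjection (Fg n 1 j).starProjection := by
  have hmem : ∀ i x, x ∈ Fg n 1 i ↔ (i + 1 < n → ∀ p, Supp (gQ n i) p → mop (Phi 1 (pw p)) x = x) := by
    intro i x
    by_cases h : i + 1 < n
    · have hi : Fg n 1 i = embFix 1 (eQ (gQ n i)) := if_pos h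
      rw [hi, mem_embFix_pw]
      simp only [h, true_imp_iff]
      apply forall_congr'; intro p
      rw [dpi_one_iff (pw_herm p) (pw_sq p)]
    · have hi : Fg n 1 i = ⊤ := if_neg h
      rw [hi]
      simp [h]
  have key : ∀ p, Commute (mop (Phi 1 (pw p))) (Fg n 1 j).starProjection := by
    intro p
    have hstab : ∀ x ∈ Fg n 1 j, mop (Phi 1 (pw p)) x ∈ Fg n 1 j := by
      intro x hx
      rw [hmem] at hx ⊢
      intro hj q hq
      rw [← mop_mul, Phi_pw_comm, mop_mul, hx hj q hq]
    refine commute_starProjection_of_mem _ _ (mop (Phi 1 (pw p))) ?_ hstab hstab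
    intro x y
    have := mop_inner (Phi 1 (pw p)) x y
    rwa [Phi_conjTranspose, pw_herm] at this
  have hstab2 : ∀ x ∈ Fg n 1 i, (Fg n 1 j).starProjection x ∈ Fg n 1 i := by
    intro x hx
    rw [hmem] at hx ⊢
    intro hi p hp
    rw [commute_apply (key p) x, hx hi p hp]
  refine (commute_starProjection_of_mem _ _ (Fg n 1 j).starProjection ?_ hstab2 hstab2).symm
  intro x y
  exact proj_symm _ x y

theorem chainProj_Iio_univ {E : Type*} [NormedAddCommGroup E] [InnerProductSpace ℂ E] [FiniteDimensional ℂ E]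
    (F : ℕ → Submodule ℂ E) (m : ℕ) (hm : ∀ i, m ≤ i → F i = ⊤) : chainProj F (Set.Iio m) = chainProj F Set.univ := by
  have : chainFix F (Set.Iio m) = chainFix F Set.univ := by
    ext x
    rw [mem_chainFix, mem_chainFix]
    constructor
    · intro h i _
      by_cases hi : i < m
      · exact h i hi
      · rw [hm i (by omega)]; trivial
    · intro h i _
      exact h i (Set.mem_univ i)
  unfold chainProj
  simp only [this]

/-- The gap parameter. -/
def xgap (t : ℕ) : ℝ := (425 * ((⌊Real.logb 2 (4 * t)⌋ : ℤ) : ℝ) ^ 2 * (t : ℝ) ^ 5 *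
      (t : ℝ) ^ ((3.1 : ℝ) / Real.log 2))⁻¹

theorem xgap_pos {t : ℕ} (ht : 1 ≤ t) : 0 < xgap t := by
  have h0 : (1 : ℝ) ≤ t := by exact_mod_cast ht
  have h1 : (1 : ℤ) ≤ ⌊Real.logb 2 (4 * t)⌋ := by
    rw [Int.le_floor, Real.le_logb_iff_rpow_le (by norm_num) (by positivity)]
    norm_num
    linarith
  have h2 : (1 : ℝ) ≤ ((⌊Real.logb 2 (4 * t)⌋ : ℤ) : ℝ) := by exact_mod_cast h1
  unfold xgap
  positivity

theorem xgap_one : xgap 1 ≤ 1 := by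
  have h1 : (1 : ℤ) ≤ ⌊Real.logb 2 (4 * (1 : ℕ))⌋ := by
    rw [Int.le_floor, Real.le_logb_iff_rpow_le (by norm_num) (by positivity)]
    norm_num
  have h2 : (1 : ℝ) ≤ ((⌊Real.logb 2 (4 * (1 : ℕ))⌋ : ℤ) : ℝ) := by exact_mod_cast h1
  unfold xgap
  apply inv_le_one_of_one_le₀
  generalize ((⌊Real.logb 2 (4 * (1 : ℕ))⌋ : ℤ) : ℝ) = y at h2
  simp
  nlinarith

theorem xgap_two {t : ℕ} (ht : 2 ≤ t) : xgap t * (41696 * (t : ℝ) ^ 4) ≤ 1 := by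
  have h0 : (2 : ℝ) ≤ t := by exact_mod_cast ht
  have h1 : (3 : ℤ) ≤ ⌊Real.logb 2 (4 * t)⌋ := by
    rw [Int.le_floor, Real.le_logb_iff_rpow_le (by norm_num) (by positivity)]
    have : (2 : ℝ) ^ (((3 : ℤ) : ℝ)) = 8 := by
      rw [Real.rpow_intCast]; norm_num
    rw [this]
    linarith
  have h2 : (3 : ℝ) ≤ ((⌊Real.logb 2 (4 * t)⌋ : ℤ) : ℝ) := by exact_mod_cast h1
  have h3 : (t : ℝ) ^ 4 ≤ (t : ℝ) ^ ((3.1 : ℝ) / Real.log 2) := by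
    rw [← Real.rpow_natCast]
    apply Real.rpow_le_rpow_of_exponent_le (by linarith)
    rw [le_div_iff₀ (Real.log_pos (by norm_num))]
    have := Real.log_two_lt_d9
    push_cast
    linarith
  unfold xgap
  have h4 : (16 : ℝ) ≤ (t : ℝ) ^ 4 := by
    calc (16 : ℝ) = 2 ^ 4 := by norm_num
      _ ≤ _ := by gcongr
  have h5 : (32 : ℝ) ≤ (t : ℝ) ^ 5 := by
    calc (32 : ℝ) = 2 ^ 5 := by norm_num
      _ ≤ _ := by gcongr
  rw [inv_mul_le_iff₀ (by positivity), mul_one]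
  calc 41696 * (t : ℝ) ^ 4 ≤ 425 * 3 ^ 2 * 32 * (t : ℝ) ^ 4 := by nlinarith
    _ ≤ _ := by gcongr

theorem Fg_gap (n : ℕ) {t : ℕ} (ht : 1 ≤ t) (v : EuclideanSpace ℂ (Fin t ⊕ Fin t → (Fin n → Fin 2))) :
    xgap t * ‖v - chainProj (Fg n t) Set.univ v‖ ^ 2 ≤
      ∑ i ∈ Finset.range (n - 1), ‖v - (Fg n t i).starProjection v‖ ^ 2 := by
  rcases Nat.lt_or_ge t 2 with h | h
  · obtain rfl : t = 1 := by omega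
    have := fnw_chain (Fg n 1) 0 le_rfl (by norm_num) (fun i j _ => Fg_comm_one n i j) (by
      intro k v
      have := commuting_pair _ _ (Fg_comm_one n k (k + 1)) v
      simp only [zero_mul, neg_zero]
      linarith) (n - 1) v
    rw [chainProj_Iio_univ _ _ (fun i hi => Fg_top hi)] at this
    refine le_trans ?_ this
    have := xgap_one
    have h2 : 0 ≤ ‖v - chainProj (Fg n 1) Set.univ v‖ ^ 2 := by positivity
    nlinarith
  · have h0 : (1 : ℝ) ≤ t := by exact_mod_cast ht
    have h1 : (1 : ℝ) ≤ (t : ℝ) ^ 2 := by nlinarith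
    have := uniform_gap (Fg n t) (Fg_farComm n t) (8 * (t : ℝ) ^ 2) (by positivity)
      (fun a b v hab => Fg_loc n t a b v hab) (n - 1) (fun i hi => Fg_top hi) (217 * t ^ 2) (by
        push_cast
        nlinarith) v
    have h2 := xgap_two h
    have h3 := xgap_pos ht
    set S := ∑ i ∈ Finset.range (n - 1), ‖v - (Fg n t i).starProjection v‖ ^ 2 with hS
    have hS0 : 0 ≤ S := Finset.sum_nonneg fun i _ => sq_nonneg _
    have h4 : 4 * (8 * (t : ℝ) ^ 2 * (6 * ((217 * t ^ 2 : ℕ) : ℝ) + 1)) ≤ 41696 * (t : ℝ) ^ 4 := by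
      push_cast
      nlinarith
    calc _ ≤ xgap t * (41696 * (t : ℝ) ^ 4 * S) := by
          apply mul_le_mul_of_nonneg_left _ h3.le
          exact this.trans (mul_le_mul_of_nonneg_right h4 hS0)
      _ = xgap t * (41696 * (t : ℝ) ^ 4) * S := by ring
      _ ≤ 1 * S := mul_le_mul_of_nonneg_right h2 hS0
      _ = S := one_mul _

theorem Pgap_pos {t : ℕ} (ht : 1 ≤ t) : 0 < Pgap t := by
  have := xgap_pos ht
  have e : Pgap t = (1 + (1 / 2) * xgap t) ^ (-(1 / 3 : ℝ)) := rfl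
  rw [e]
  positivity

theorem Pgap_sq {t : ℕ} (ht : 1 ≤ t) : 1 ≤ (Pgap t) ^ 2 * (1 + xgap t / 2) := by
  have := xgap_pos ht
  have e : Pgap t = (1 + (1 / 2) * xgap t) ^ (-(1 / 3 : ℝ)) := rfl
  have e2 : 1 + (1 / 2) * xgap t = 1 + xgap t / 2 := by ring
  rw [e, e2]
  set y := 1 + xgap t / 2 with hy
  have hy1 : 1 ≤ y := by linarith
  have hy0 : 0 < y := by linarith
  rw [← Real.rpow_natCast, ← Real.rpow_mul hy0.le]
  nth_rewrite 2 [← Real.rpow_one y]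
  rw [← Real.rpow_add hy0]
  apply Real.one_le_rpow hy1
  norm_num

theorem block_bound (n : ℕ) {t : ℕ} (ht : 1 ≤ t) (v : EuclideanSpace ℂ (Fin t ⊕ Fin t → (Fin n → Fin 2))) :
    ‖chainProj (Fg n t) {i | Odd i} (chainProj (Fg n t) {i | Even i} v) - chainProj (Fg n t) Set.univ v‖
      ≤ Pgap t * ‖v‖ := by
  have h1 := block_contraction (Fg n t) (Fg_farComm n t) (n - 1) (xgap t) (Fg_gap n ht) v
  have h2 := Pgap_pos ht
  have h3 := Pgap_sq ht
  have h4 := xgap_pos ht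
  apply le_of_sq_le_sq _ (by positivity)
  set a := ‖chainProj (Fg n t) {i | Odd i} (chainProj (Fg n t) {i | Even i} v) - chainProj (Fg n t) Set.univ v‖ ^ 2
  have ha : 0 ≤ a := sq_nonneg _
  calc a ≤ a * (Pgap t ^ 2 * (1 + xgap t / 2)) := le_mul_of_one_le_right ha h3
    _ = Pgap t ^ 2 * (a * (1 + xgap t / 2)) := by ring
    _ ≤ Pgap t ^ 2 * ‖v‖ ^ 2 := by gcongr
    _ = _ := by ring

end Gap

section Conv
variable {Y : Type*} [Fintype Y] [DecidableEq Y]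
local notation "⟪" x "," y "⟫" => inner ℂ x y

theorem ug_left (U : Matrix.unitaryGroup Y ℂ) : (U : Matrix Y Y ℂ)ᴴ * (U : Matrix Y Y ℂ) = 1 :=
  Matrix.mem_unitaryGroup_iff'.1 U.2

theorem ug_right (U : Matrix.unitaryGroup Y ℂ) : (U : Matrix Y Y ℂ) * (U : Matrix Y Y ℂ)ᴴ = 1 :=
  Matrix.mem_unitaryGroup_iff.1 U.2

/-- Diagonal unitaries. -/
def dcirc : (Y → Circle) →* Matrix.unitaryGroup Y ℂ where
  toFun d := ⟨Matrix.diagonal fun a => (d a : ℂ), by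
    rw [Matrix.mem_unitaryGroup_iff, Matrix.star_eq_conjTranspose, Matrix.diagonal_conjTranspose, Matrix.diagonal_mul_diagonal,
      ← Matrix.diagonal_one]
    congr 1
    ext a
    simp [Complex.mul_conj]⟩
  map_one' := by
    ext a b
    simp [Matrix.one_apply, Matrix.diagonal_apply]
  map_mul' d e := by
    apply Subtype.ext
    simp [Matrix.diagonal_mul_diagonal]

theorem dcirc_coe (d : Y → Circle) : ((dcirc d : Matrix.unitaryGroup Y ℂ) : Matrix Y Y ℂ) = Matrix.diagonal fun a => (d a : ℂ) := rfl

/-- Permutation unitaries. -/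
def permU (σ : Equiv.Perm Y) : Matrix.unitaryGroup Y ℂ :=
  ⟨(1 : Matrix Y Y ℂ).submatrix σ id, by
    rw [Matrix.mem_unitaryGroup_iff, Matrix.star_eq_conjTranspose, Matrix.conjTranspose_submatrix, Matrix.conjTranspose_one]
    have := Matrix.submatrix_mul_equiv (1 : Matrix Y Y ℂ) (1 : Matrix Y Y ℂ) σ (Equiv.refl Y) σ
    rw [one_mul, Matrix.submatrix_one_equiv] at this
    exact this⟩

theorem permU_dcirc (σ : Equiv.Perm Y) (d : Y → Circle) :
    permU σ * dcirc d = dcirc (d ∘ σ) * permU σ := by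
  apply Subtype.ext
  ext a b
  change ((1 : Matrix Y Y ℂ).submatrix σ id * Matrix.diagonal (fun a => (d a : ℂ))) a b =
    (Matrix.diagonal (fun a => (d (σ a) : ℂ)) * (1 : Matrix Y Y ℂ).submatrix σ id) a b
  rw [Matrix.mul_diagonal, Matrix.diagonal_mul]
  simp only [Matrix.submatrix_apply, id, Matrix.one_apply]
  by_cases h : σ a = b
  · subst h; simp
  · simp [h]

/-- A character of the unitary group killing scalars is trivial. -/
theorem char_trivial (χ : Matrix.unitaryGroup Y ℂ →* ℂ)
    (hs : ∀ w : Circle, χ (dcirc fun _ => w) = 1) (U : Matrix.unitaryGroup Y ℂ) : χ U = 1 := by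
  have hne : ∀ V, χ V ≠ 0 := by
    intro V h
    have := χ.map_mul V V⁻¹
    rw [mul_inv_cancel, map_one, h, zero_mul] at this
    exact one_ne_zero this
  have hperm : ∀ (σ : Equiv.Perm Y) (d : Y → Circle), χ (dcirc (d ∘ σ)) = χ (dcirc d) := by
    intro σ d
    have := congrArg χ (permU_dcirc σ d)
    rw [map_mul, map_mul, mul_comm] at this
    exact (mul_right_cancel₀ (hne _) this).symm
  set N := Fintype.card (Equiv.Perm Y) with hN
  have hN0 : (N : ℝ) ≠ 0 := by
    have : 0 < N := Fintype.card_pos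
    positivity
  have hpow : ∀ d : Y → Circle, χ (dcirc d) ^ N = 1 := by
    intro d
    have h1 : ∏ σ : Equiv.Perm Y, χ (dcirc (d ∘ σ)) = χ (dcirc d) ^ N := by
      simp only [hperm]
      rw [Finset.prod_const, Finset.card_univ]
    have hmp : ∏ σ : Equiv.Perm Y, χ (dcirc (d ∘ σ)) = χ (dcirc (∏ σ : Equiv.Perm Y, d ∘ σ)) :=
      (map_prod (χ.comp dcirc) (fun σ : Equiv.Perm Y => d ∘ σ) Finset.univ).symm
    rw [← h1, hmp]
    rcases isEmpty_or_nonempty Y with hY | ⟨⟨b⟩⟩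
    · have : ∏ σ : Equiv.Perm Y, d ∘ σ = 1 := Subsingleton.elim _ _
      rw [this, map_one, map_one]
    have h2 : ∏ σ : Equiv.Perm Y, d ∘ σ = fun _ => ∏ σ : Equiv.Perm Y, d (σ b) := by
      ext1 a
      rw [Finset.prod_apply]
      rw [← Equiv.prod_comp (Equiv.mulRight (Equiv.swap a b))]
      apply Finset.prod_congr rfl
      intro σ _
      simp
    rw [h2]
    exact hs _
  have hdiag : ∀ d : Y → Circle, χ (dcirc d) = 1 := by
    intro d
    have : d = (fun a => Circle.exp (Complex.arg (d a) / N)) ^ N := by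
      ext1 a
      rw [Pi.pow_apply, ← Circle.exp_nsmul, nsmul_eq_mul, mul_div_cancel₀ _ hN0, Circle.exp_arg]
    rw [this, map_pow, map_pow, hpow]
  obtain ⟨V, d, h1, h2, hd, hU⟩ := unitary_diag (U : Matrix Y Y ℂ) (ug_left U)
  have hd' : ∀ a, ‖d a‖ = 1 := by
    intro a
    have := hd a
    have h3 : Complex.normSq (d a) = 1 := by
      have h4 := Complex.normSq_eq_conj_mul_self (z := d a)
      rw [show (starRingEnd ℂ) (d a) = star (d a) from rfl, this] at h4
      exact_mod_cast h4
    rw [Complex.normSq_eq_norm_sq] at h3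
    nlinarith [norm_nonneg (d a)]
  set W : Matrix.unitaryGroup Y ℂ := ⟨V, Matrix.mem_unitaryGroup_iff.2 h2⟩ with hW
  have hex : ∀ a, ∃ w : Circle, (w : ℂ) = d a := fun a => ⟨⟨d a, mem_sphere_zero_iff_norm.2 (hd' a)⟩, rfl⟩
  choose d' hd'' using hex
  have : U = W * dcirc d' * W⁻¹ := by
    apply Subtype.ext
    rw [hU]
    have e : d = fun a => (d' a : ℂ) := by ext a; exact (hd'' a).symm
    rw [e]
    rfl
  rw [this, map_mul, map_mul, hdiag, mul_one, ← map_mul, mul_inv_cancel, map_one]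

theorem Phi_scalar (t : ℕ) (w : Circle) : Phi t (Matrix.diagonal fun _ : Y => (w : ℂ)) = 1 := by
  rw [Phi_diagonal, ← Matrix.diagonal_one]
  congr 1
  ext x
  apply Finset.prod_eq_one
  intro s _
  have : (w : ℂ) * star (w : ℂ) = 1 := by
    change (w : ℂ) * (starRingEnd ℂ) (w : ℂ) = 1
    rw [Complex.mul_conj]; simp
  exact this

theorem continuous_mop_Phi (t : ℕ) (v : EuclideanSpace ℂ (Fin t ⊕ Fin t → Y)) :
    Continuous fun U : Matrix.unitaryGroup Y ℂ => mop (Phi t (U : Matrix Y Y ℂ)) v := by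
  have hc : ∀ a b, Continuous fun U : Matrix.unitaryGroup Y ℂ => (U : Matrix Y Y ℂ) a b := by
    intro a b
    exact (continuous_apply b).comp ((continuous_apply a).comp continuous_subtype_val)
  refine (PiLp.continuous_toLp 2 _).comp (f := fun U : Matrix.unitaryGroup Y ℂ => WithLp.ofLp (mop (Phi t (U : Matrix Y Y ℂ)) v)) ?_
  apply continuous_pi
  intro x
  simp only [mop_apply]
  apply continuous_finsetSum
  intro y _
  apply Continuous.mul _ continuous_const
  simp only [Phi, tens]
  apply continuous_finsetProd
  intro i _
  rcases i with i | i
  · exact hc _ _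
  · exact (hc _ _).star

theorem fix_of_eigen (UB : Finset (Matrix.unitaryGroup Y ℂ))
    (hdense : Dense ((Subgroup.closure (↑UB : Set (Matrix.unitaryGroup Y ℂ)) :
        Subgroup (Matrix.unitaryGroup Y ℂ)) : Set (Matrix.unitaryGroup Y ℂ)))
    (t : ℕ) (v : EuclideanSpace ℂ (Fin t ⊕ Fin t → Y)) (c : ℂ)
    (hv : ∀ U ∈ UB, mop (Phi t (U : Matrix Y Y ℂ)) v = c • v) : v ∈ lieFix t Y := by
  by_cases hv0 : v = 0
  · rw [hv0]; exact Submodule.zero_mem _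
  let H : Subgroup (Matrix.unitaryGroup Y ℂ) :=
    { carrier := {U | mop (Phi t (U : Matrix Y Y ℂ)) v ∈ Submodule.span ℂ {v}}
      one_mem' := by
        change mop (Phi t (1 : Matrix Y Y ℂ)) v ∈ Submodule.span ℂ {v}
        rw [Phi_one, mop_one]; exact Submodule.mem_span_singleton_self v
      mul_mem' := by
        intro a b ha hb
        change mop (Phi t ((a : Matrix Y Y ℂ) * (b : Matrix Y Y ℂ))) v ∈ Submodule.span ℂ {v}
        obtain ⟨x, hx⟩ := Submodule.mem_span_singleton.1 hb
        rw [Phi_mul, mop_mul, ← hx, map_smul]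
        exact Submodule.smul_mem _ _ ha
      inv_mem' := by
        intro a ha
        change mop (Phi t ((a : Matrix Y Y ℂ)ᴴ)) v ∈ Submodule.span ℂ {v}
        obtain ⟨x, hx⟩ := Submodule.mem_span_singleton.1 ha
        have h1 : mop (Phi t ((a : Matrix Y Y ℂ)ᴴ)) (mop (Phi t (a : Matrix Y Y ℂ)) v) = v := by
          rw [← mop_mul, ← Phi_mul, ug_left, Phi_one, mop_one]
        rw [← hx, map_smul] at h1
        have hx0 : x ≠ 0 := by
          rintro rfl
          rw [zero_smul] at h1
          exact hv0 h1.symm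
        rw [Submodule.mem_span_singleton]
        refine ⟨x⁻¹, ?_⟩
        rw [inv_smul_eq_iff₀ hx0]
        exact h1.symm }
  have hcl : IsClosed (H : Set (Matrix.unitaryGroup Y ℂ)) :=
    (Submodule.closed_of_finiteDimensional (Submodule.span ℂ {v})).preimage (continuous_mop_Phi t v)
  have hle : Subgroup.closure (↑UB : Set (Matrix.unitaryGroup Y ℂ)) ≤ H := by
    rw [Subgroup.closure_le]
    intro U hU
    change mop (Phi t (U : Matrix Y Y ℂ)) v ∈ Submodule.span ℂ {v}
    rw [hv U hU]
    exact Submodule.smul_mem _ _ (Submodule.mem_span_singleton_self v)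
  have hall : ∀ U : Matrix.unitaryGroup Y ℂ, ∃ c : ℂ, c • v = mop (Phi t (U : Matrix Y Y ℂ)) v := by
    intro U
    have : U ∈ (H : Set (Matrix.unitaryGroup Y ℂ)) := by
      have h1 := (hdense.mono hle).closure_eq
      rw [hcl.closure_eq] at h1
      rw [h1]; trivial
    exact Submodule.mem_span_singleton.1 this
  choose χ hχ using hall
  have hinj : ∀ a b : ℂ, a • v = b • v → a = b := fun a b h => smul_left_injective ℂ hv0 h
  let χ' : Matrix.unitaryGroup Y ℂ →* ℂ :=
    { toFun := χ
      map_one' := by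
        apply hinj
        rw [hχ, one_smul]
        change mop (Phi t (1 : Matrix Y Y ℂ)) v = v
        rw [Phi_one, mop_one]
      map_mul' := by
        intro a b
        apply hinj
        rw [hχ]
        change mop (Phi t ((a : Matrix Y Y ℂ) * (b : Matrix Y Y ℂ))) v = _
        rw [Phi_mul, mop_mul, ← hχ b, map_smul, ← hχ a, smul_smul, mul_comm] }
  have htriv := char_trivial χ' (by
    intro w
    apply hinj
    change χ _ • v = _
    rw [hχ, dcirc_coe, Phi_scalar, mop_one, one_smul])
  rw [lieFix_iff]
  intro U hU
  have h1 := hχ ⟨U, Matrix.mem_unitaryGroup_iff'.2 hU⟩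
  rw [show χ ⟨U, Matrix.mem_unitaryGroup_iff'.2 hU⟩ = 1 from htriv _, one_smul] at h1
  exact h1.symm

/-- The averaging operator. -/
def avgOp (t : ℕ) (UB : Finset (Matrix.unitaryGroup Y ℂ)) :
    EuclideanSpace ℂ (Fin t ⊕ Fin t → Y) →L[ℂ] EuclideanSpace ℂ (Fin t ⊕ Fin t → Y) :=
  mop ((UB.card : ℂ)⁻¹ • ∑ U ∈ UB, Phi t (U : Matrix Y Y ℂ))

theorem avgOp_apply (t : ℕ) (UB : Finset (Matrix.unitaryGroup Y ℂ)) (v : EuclideanSpace ℂ (Fin t ⊕ Fin t → Y)) :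
    avgOp t UB v = (UB.card : ℂ)⁻¹ • ∑ U ∈ UB, mop (Phi t (U : Matrix Y Y ℂ)) v := by
  rw [avgOp, mop_smul, mop_sum]

theorem avgOp_eigen (t : ℕ) (UB : Finset (Matrix.unitaryGroup Y ℂ)) (hne : UB.Nonempty)
    (v : EuclideanSpace ℂ (Fin t ⊕ Fin t → Y)) (c : ℂ) (hc : 1 ≤ ‖c‖) (h : avgOp t UB v = c • v) :
    ∀ U ∈ UB, mop (Phi t (U : Matrix Y Y ℂ)) v = c • v := by
  have hN : (0 : ℝ) < UB.card := by exact_mod_cast hne.card_pos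
  have h1 : ∑ U ∈ UB, mop (Phi t (U : Matrix Y Y ℂ)) v = (UB.card : ℂ) • c • v := by
    rw [← h, avgOp_apply, smul_inv_smul₀]
    exact_mod_cast hN.ne'
  have h2 : ∑ U ∈ UB, ‖mop (Phi t (U : Matrix Y Y ℂ)) v - c • v‖ ^ 2 = UB.card * ((1 - ‖c‖ ^ 2) * ‖v‖ ^ 2) := by
    have : ∀ U ∈ UB, ‖mop (Phi t (U : Matrix Y Y ℂ)) v - c • v‖ ^ 2 =
        ‖v‖ ^ 2 - 2 * (⟪mop (Phi t (U : Matrix Y Y ℂ)) v, c • v⟫).re + ‖c‖ ^ 2 * ‖v‖ ^ 2 := by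
      intro U _
      rw [@norm_sub_sq ℂ, mop_norm_of_unitary (Phi_unitary t (ug_left U)), norm_smul, mul_pow]
      rfl
    rw [Finset.sum_congr rfl this, Finset.sum_add_distrib, Finset.sum_sub_distrib, ← Finset.mul_sum, ← Complex.re_sum,
      ← sum_inner, h1, inner_smul_left, inner_self_eq_norm_sq_to_K, norm_smul]
    simp only [Finset.sum_const, nsmul_eq_mul]
    have : ((starRingEnd ℂ) (UB.card : ℂ) * ((‖c‖ * ‖v‖ : ℝ) : ℂ) ^ 2).re = UB.card * (‖c‖ ^ 2 * ‖v‖ ^ 2) := by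
      rw [Complex.conj_natCast, ← Complex.ofReal_pow, ← Complex.ofReal_natCast, ← Complex.ofReal_mul, Complex.ofReal_re, mul_pow]
    erw [this]
    ring
  have h3 : ∑ U ∈ UB, ‖mop (Phi t (U : Matrix Y Y ℂ)) v - c • v‖ ^ 2 ≤ 0 := by
    rw [h2]
    have : 1 - ‖c‖ ^ 2 ≤ 0 := by nlinarith
    have h4 : (1 - ‖c‖ ^ 2) * ‖v‖ ^ 2 ≤ 0 := mul_nonpos_of_nonpos_of_nonneg this (by positivity)
    nlinarith
  have h4 := (Finset.sum_eq_zero_iff_of_nonneg (fun U _ => sq_nonneg _)).1 (le_antisymm h3 (Finset.sum_nonneg fun U _ => sq_nonneg _))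
  intro U hU
  have := h4 U hU
  rw [sq_eq_zero_iff, norm_eq_zero, sub_eq_zero] at this
  exact this

theorem avgOp_fix (t : ℕ) (UB : Finset (Matrix.unitaryGroup Y ℂ)) (hne : UB.Nonempty)
    {v : EuclideanSpace ℂ (Fin t ⊕ Fin t → Y)} (hv : v ∈ lieFix t Y) : avgOp t UB v = v := by
  rw [avgOp_apply, Finset.sum_congr rfl (fun U _ => fix_of_lieFix hv (ug_left U)), Finset.sum_const, ← Nat.cast_smul_eq_nsmul ℂ,
    inv_smul_smul₀]
  exact_mod_cast hne.card_pos.ne'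

theorem Phi_comm_lieFix (t : ℕ) {U : Matrix Y Y ℂ} (h1 : Uᴴ * U = 1) (h2 : U * Uᴴ = 1) :
    Commute (mop (Phi t U)) (lieFix t Y).starProjection := by
  refine commute_starProjection_of_mem _ _ (mop (Phi t Uᴴ)) ?_ ?_ ?_
  · intro x y
    have := mop_inner (Phi t U) x y
    rw [Phi_conjTranspose] at this
    exact this
  · intro x hx; exact Phi_mem_lieFix t h2 hx
  · intro x hx
    exact Phi_mem_lieFix t (V := Uᴴ) (by rw [Matrix.conjTranspose_conjTranspose]; exact h1) hx

theorem Phi_comm_proj' (t : ℕ) {U : Matrix Y Y ℂ} (h1 : Uᴴ * U = 1) (h2 : U * Uᴴ = 1) (v : EuclideanSpace ℂ (Fin t ⊕ Fin t → Y)) :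
    (lieFix t Y).starProjection (mop (Phi t U) v) = (lieFix t Y).starProjection v := by
  rw [← commute_apply (Phi_comm_lieFix t h1 h2) v]
  have hm : (lieFix t Y).starProjection v ∈ lieFix t Y := Submodule.starProjection_apply_mem (lieFix t Y) v
  exact fix_of_lieFix hm h1

theorem Phi_comm_proj (t : ℕ) (U : Matrix.unitaryGroup Y ℂ) (v : EuclideanSpace ℂ (Fin t ⊕ Fin t → Y)) :
    (lieFix t Y).starProjection (mop (Phi t (U : Matrix Y Y ℂ)) v) = (lieFix t Y).starProjection v :=
  Phi_comm_proj' t (ug_left U) (ug_right U) v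

theorem proj_avgOp (t : ℕ) (UB : Finset (Matrix.unitaryGroup Y ℂ)) (hne : UB.Nonempty)
    (v : EuclideanSpace ℂ (Fin t ⊕ Fin t → Y)) :
    (lieFix t Y).starProjection (avgOp t UB v) = (lieFix t Y).starProjection v := by
  rw [avgOp_apply, map_smul, map_sum, Finset.sum_congr rfl (fun U _ => Phi_comm_proj t U v), Finset.sum_const,
    ← Nat.cast_smul_eq_nsmul ℂ, inv_smul_smul₀]
  exact_mod_cast hne.card_pos.ne'

/-- Powers of an operator minus an absorbing idempotent. -/
theorem pow_sub_absorb {R : Type*} [Ring R] {T G : R} (h1 : T * G = G) (h2 : G * T = G) (h3 : G * G = G) (k : ℕ) :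
    T ^ (k + 1) - G = (T - G) ^ (k + 1) := by
  induction k with
  | zero => simp
  | succ k ih =>
    have hTk : G * T ^ (k + 1) = G := by
      clear ih
      induction k with
      | zero => simpa using h2
      | succ k ih => rw [pow_succ, ← mul_assoc, ih, h2]
    rw [pow_succ' (T - G), ← ih, sub_mul, mul_sub, mul_sub, ← pow_succ', h1, hTk, h3]
    abel

theorem gate_conv [Nonempty Y] (UB : Finset (Matrix.unitaryGroup Y ℂ)) (hne : UB.Nonempty)
    (hdense : Dense ((Subgroup.closure (↑UB : Set (Matrix.unitaryGroup Y ℂ)) :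
        Subgroup (Matrix.unitaryGroup Y ℂ)) : Set (Matrix.unitaryGroup Y ℂ)))
    (t : ℕ) : ∃ (K : ℕ) (r : ℝ), 1 ≤ K ∧ 0 < r ∧ r < 1 ∧
      ∀ k, K ≤ k → ‖avgOp t UB ^ k - (lieFix t Y).starProjection‖ ≤ r ^ k := by
  set T := avgOp t UB with hT
  set G := (lieFix t Y).starProjection with hG
  have h1 : T * G = G := by
    ext1 v
    exact avgOp_fix t UB hne (Submodule.starProjection_apply_mem _ _)
  have h2 : G * T = G := by
    ext1 v
    exact proj_avgOp t UB hne v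
  have h3 : G * G = G := by
    ext1 v
    exact proj_idem _ v
  have hrad : spectralRadius ℂ (T - G) < 1 := by
    have : Nonempty (Fin t ⊕ Fin t → Y) := inferInstance
    have : Nontrivial (EuclideanSpace ℂ (Fin t ⊕ Fin t → Y)) := inferInstance
    obtain ⟨c, hc, hcr⟩ := spectrum.exists_nnnorm_eq_spectralRadius (T - G)
    rw [← hcr]
    by_contra hcon
    have hc1 : 1 ≤ ‖c‖ := by
      have : (1 : NNReal) ≤ ‖c‖₊ := by
        rw [not_lt] at hcon
        exact_mod_cast hcon
      exact_mod_cast this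
    apply hc
    rw [spectrum.mem_resolventSet_iff, ContinuousLinearMap.isUnit_iff_bijective]
    have hinj : Function.Injective (algebraMap ℂ (EuclideanSpace ℂ (Fin t ⊕ Fin t → Y) →L[ℂ] EuclideanSpace ℂ (Fin t ⊕ Fin t → Y)) c - (T - G)) := by
      rw [injective_iff_map_eq_zero]
      intro v hv
      have hv' : c • v = T v - G v := by
        have : c • v - (T v - G v) = 0 := by
          rw [← hv, Algebra.algebraMap_eq_smul_one]; rfl
        exact sub_eq_zero.1 this
      have hGv : G v = 0 := by
        have h4 := congrArg G hv'
        rw [map_smul, map_sub] at h4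
        have h5 : G (T v) = G v := proj_avgOp t UB hne v
        have h6 : G (G v) = G v := proj_idem _ v
        rw [h5, h6, sub_self, smul_eq_zero] at h4
        rcases h4 with h4 | h4
        · rw [h4, norm_zero] at hc1; linarith
        · exact h4
      rw [hGv, sub_zero] at hv'
      have h7 := fix_of_eigen UB hdense t v c (avgOp_eigen t UB hne v c hc1 hv'.symm)
      rw [← Submodule.starProjection_eq_self_iff] at h7
      rw [← h7]; exact hGv
    refine ⟨hinj, ?_⟩
    exact (LinearMap.injective_iff_surjective (f := (algebraMap ℂ (EuclideanSpace ℂ (Fin t ⊕ Fin t → Y) →L[ℂ] EuclideanSpace ℂ (Fin t ⊕ Fin t → Y)) c - (T - G)).toLinearMap)).1 hinj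
  obtain ⟨r, hr1, hr2⟩ := ENNReal.lt_iff_exists_nnreal_btwn.1 hrad
  have hr2' : r < 1 := by exact_mod_cast hr2
  have hr0 : 0 < r := by
    have : (0 : ENNReal) < r := lt_of_le_of_lt zero_le hr1
    exact_mod_cast this
  have hev := (spectrum.pow_nnnorm_pow_one_div_tendsto_nhds_spectralRadius (T - G)).eventually (gt_mem_nhds hr1)
  obtain ⟨K, hK⟩ := Filter.eventually_atTop.1 hev
  refine ⟨K + 1, r, by omega, hr0, hr2', ?_⟩
  intro k hk
  have h4 := hK k (by omega)
  obtain ⟨j, rfl⟩ : ∃ j, k = j + 1 := ⟨k - 1, by omega⟩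
  rw [pow_sub_absorb h1 h2 h3]
  have h5 : (‖(T - G) ^ (j + 1)‖₊ : ENNReal) ≤ (r : ENNReal) ^ (j + 1) := by
    have h6 : ((‖(T - G) ^ (j + 1)‖₊ : ENNReal) ^ (1 / ((j + 1 : ℕ) : ℝ))) ^ (((j + 1 : ℕ) : ℝ)) ≤ (r : ENNReal) ^ (((j + 1 : ℕ) : ℝ)) :=
      ENNReal.rpow_le_rpow h4.le (by positivity)
    rw [← ENNReal.rpow_mul, one_div, inv_mul_cancel₀ (by positivity), ENNReal.rpow_one, ENNReal.rpow_natCast] at h6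
    exact h6
  have h7 : ‖(T - G) ^ (j + 1)‖₊ ≤ r ^ (j + 1) := by exact_mod_cast h5
  exact_mod_cast h7

end Conv

section Avg
variable {R : Type*} [Ring R] [Algebra ℂ R]

/-- Uniform average over a finite type. -/
def av {ι : Type*} [Fintype ι] {M : Type*} [AddCommGroup M] [Module ℂ M] (f : ι → M) : M :=
  (Fintype.card ι : ℂ)⁻¹ • ∑ i, f i

theorem av_map {ι : Type*} [Fintype ι] {M N : Type*} [AddCommGroup M] [Module ℂ M] [AddCommGroup N] [Module ℂ N]
    (L : M →ₗ[ℂ] N) (f : ι → M) : L (av f) = av (fun i => L (f i)) := by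
  rw [av, av, map_smul, map_sum]

theorem av_prod {A B : Type*} [Fintype A] [Fintype B] (f : A → R) (g : B → R) :
    av (fun p : A × B => g p.2 * f p.1) = av g * av f := by
  simp only [av]
  rw [Fintype.card_prod, Fintype.sum_prod_type_right]
  simp only [← Finset.mul_sum]
  rw [← Finset.sum_mul, smul_mul_smul_comm, Nat.cast_mul, mul_inv, mul_comm (Fintype.card A : ℂ)⁻¹]

theorem av_ofFn {A : Type*} [Fintype A] : ∀ {m : ℕ} (g : Fin m → A → R),
    av (fun π : Fin m → A => (List.ofFn fun i => g i (π i)).prod) = (List.ofFn fun i => av (g i)).prod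
  | 0, g => by
    simp [av]
  | m + 1, g => by
    rw [List.ofFn_succ, List.prod_cons, ← av_ofFn (fun i => g i.succ), ← av_prod]
    simp only [av]
    rw [Fintype.card_prod, Fintype.card_fun, Fintype.card_fun, Fintype.card_fin, Fintype.card_fin, ← pow_succ]
    congr 1
    rw [← (Fin.consEquiv (fun _ : Fin (m + 1) => A)).sum_comp, ← (Equiv.prodComm (Fin m → A) A).sum_comp]
    apply Finset.sum_congr rfl
    intro p _
    rw [List.ofFn_succ, List.prod_cons]
    simp [Fin.consEquiv]

theorem av_norm_le {ι : Type*} [Fintype ι] {M : Type*} [NormedAddCommGroup M] [NormedSpace ℂ M] (f : ι → M)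
    (h : ∀ i, ‖f i‖ ≤ 1) : ‖av f‖ ≤ 1 := by
  rw [av, norm_smul, norm_inv, Complex.norm_natCast]
  have h1 : ‖∑ i, f i‖ ≤ Fintype.card ι := by
    refine (norm_sum_le _ _).trans ?_
    refine (Finset.sum_le_sum fun i _ => h i).trans ?_
    simp
  rcases Nat.eq_zero_or_pos (Fintype.card ι) with h0 | h0
  · rw [h0]; simp
  · have : (0 : ℝ) < Fintype.card ι := by exact_mod_cast h0
    rw [inv_mul_le_iff₀ this]; simpa using h1

theorem ofFn_prod_norm {R : Type*} [NormedRing R] [NormOneClass R] : ∀ {m : ℕ} (W : Fin m → R), (∀ i, ‖W i‖ ≤ 1) →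
    ‖(List.ofFn W).prod‖ ≤ 1
  | 0, W, _ => by simp
  | m + 1, W, h => by
    rw [List.ofFn_succ, List.prod_cons]
    refine (norm_mul_le _ _).trans ?_
    have := ofFn_prod_norm (fun i => W i.succ) (fun i => h _)
    exact mul_le_one₀ (h 0) (norm_nonneg _) this

theorem ofFn_prod_sub {R : Type*} [NormedRing R] [NormOneClass R] {δ : ℝ} : ∀ {m : ℕ} (W G : Fin m → R),
    (∀ i, ‖W i‖ ≤ 1) → (∀ i, ‖G i‖ ≤ 1) → (∀ i, ‖W i - G i‖ ≤ δ) →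
    ‖(List.ofFn W).prod - (List.ofFn G).prod‖ ≤ m * δ
  | 0, W, G, _, _, _ => by simp
  | m + 1, W, G, h1, h2, h3 => by
    rw [List.ofFn_succ, List.prod_cons, List.ofFn_succ, List.prod_cons]
    have ih := ofFn_prod_sub (fun i => W i.succ) (fun i => G i.succ) (fun i => h1 _) (fun i => h2 _) (fun i => h3 _)
    have hG := ofFn_prod_norm (fun i => G i.succ) (fun i => h2 _)
    set w := (List.ofFn fun i => W i.succ).prod
    set g := (List.ofFn fun i => G i.succ).prod
    have e : W 0 * w - G 0 * g = W 0 * (w - g) + (W 0 - G 0) * g := by noncomm_ring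
    rw [e]
    refine (norm_add_le _ _).trans ?_
    have a1 : ‖W 0 * (w - g)‖ ≤ 1 * (m * δ) :=
      (norm_mul_le _ _).trans (mul_le_mul (h1 0) ih (norm_nonneg _) zero_le_one)
    have a2 : ‖(W 0 - G 0) * g‖ ≤ δ * 1 :=
      (norm_mul_le _ _).trans (mul_le_mul (h3 0) hG (norm_nonneg _) ((norm_nonneg _).trans (h3 0)))
    push_cast
    linarith

end Avg

section Gate

/-- Two-qubit index equivalence. -/
def pairE {n i : ℕ} (h : i + 1 < n) : ({r : Fin n // gQ n i r} → Fin 2) ≃ Fin 4 where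
  toFun w := pairIdx (w ⟨⟨i, by omega⟩, Or.inl rfl⟩) (w ⟨⟨i + 1, h⟩, Or.inr rfl⟩)
  invFun c := fun r => if r.1.val = i then ⟨c.val / 2, by omega⟩ else ⟨c.val % 2, by omega⟩
  left_inv w := by
    ext1 r
    rcases r with ⟨⟨r, hr⟩, hr' | hr'⟩
    · simp only at hr'
      subst hr'
      simp only [if_true, pairIdx]
      ext
      simp only
      omega
    · simp only at hr'
      subst hr'
      have : ¬ (i + 1 = i) := by omega
      simp only [this, if_false, pairIdx]
      ext
      simp only
      omega
  right_inv c := by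
    ext
    have : ¬ (i + 1 = i) := by omega
    simp only [if_true, this, if_false, pairIdx]
    omega

/-- The splitting of the configuration space at a gate. -/
def gateE {n i : ℕ} (h : i + 1 < n) : (Fin n → Fin 2) ≃ Fin 4 × ({r : Fin n // ¬ gQ n i r} → Fin 2) :=
  (eQ (gQ n i)).trans (Equiv.prodCongr (pairE h) (Equiv.refl _))

theorem gateE_fst {n i : ℕ} (h : i + 1 < n) (x : Fin n → Fin 2) :
    (gateE h x).1 = pairIdx (x ⟨i, by omega⟩) (x ⟨i + 1, h⟩) := rfl

theorem gateE_snd {n i : ℕ} (h : i + 1 < n) (x : Fin n → Fin 2) (r : {r : Fin n // ¬ gQ n i r}) :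
    (gateE h x).2 r = x r := rfl

theorem applyGate_eq {n i : ℕ} (h : i + 1 < n) (U : Matrix (Fin 4) (Fin 4) ℂ) :
    applyGate n ⟨i, by omega⟩ ⟨i + 1, h⟩ U = emb (gateE h) U := by
  ext x y
  rw [emb_apply, gateE_fst, gateE_fst, applyGate]
  have : (∀ r : Fin n, r ≠ ⟨i, by omega⟩ → r ≠ ⟨i + 1, h⟩ → x r = y r) ↔ (gateE h x).2 = (gateE h y).2 := by
    rw [funext_iff]
    constructor
    · intro H r
      rw [gateE_snd, gateE_snd]
      apply H
      · intro h1; exact r.2 (Or.inl (by rw [h1]))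
      · intro h1; exact r.2 (Or.inr (by rw [h1]))
    · intro H r h1 h2
      have := H ⟨r, by
        rintro (h3 | h3)
        · exact h1 (Fin.ext h3)
        · exact h2 (Fin.ext h3)⟩
      rwa [gateE_snd, gateE_snd] at this
  simp only [this]

theorem emb_gateE {n i : ℕ} (h : i + 1 < n) (U : Matrix (Fin 4) (Fin 4) ℂ) :
    emb (gateE h) U = emb (eQ (gQ n i)) (U.submatrix (pairE h) (pairE h)) := by
  ext x y
  rw [emb_apply, emb_apply]
  rfl

theorem embFix_gateE {n i : ℕ} (h : i + 1 < n) (t : ℕ) : embFix t (gateE h) = Fg n t i := by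
  have hi : Fg n t i = embFix t (eQ (gQ n i)) := if_pos h
  rw [hi]
  ext v
  rw [mem_embFix, mem_embFix]
  constructor
  · intro H A
    have := H (A.submatrix (pairE h).symm (pairE h).symm)
    rw [emb_gateE, Matrix.submatrix_submatrix] at this
    simpa using this
  · intro H A
    rw [emb_gateE]
    exact H _

variable (UB : Finset (Matrix.unitaryGroup (Fin 4) ℂ))

theorem wordMat_unitary {k : ℕ} (f : Fin k → Matrix.unitaryGroup (Fin 4) ℂ) : (wordMat f)ᴴ * wordMat f = 1 := by
  have : wordMat f = ((List.ofFn f).prod : Matrix.unitaryGroup (Fin 4) ℂ) := by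
    rw [wordMat, Submonoid.coe_list_prod, List.map_ofFn]
    rfl
  rw [this]
  exact ug_left _

/-- The word-averaged gate superoperator at position `i`. -/
def gateAv (n t k i : ℕ) (h : i + 1 < n) :
    EuclideanSpace ℂ (Fin t ⊕ Fin t → (Fin n → Fin 2)) →L[ℂ] EuclideanSpace ℂ (Fin t ⊕ Fin t → (Fin n → Fin 2)) :=
  av fun f : Fin k → {x // x ∈ UB} => mop (Phi t (applyGate n ⟨i, by omega⟩ ⟨i + 1, h⟩
    (wordMat fun j => (f j : Matrix.unitaryGroup (Fin 4) ℂ))))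

theorem gate_unitary {n i : ℕ} (h : i + 1 < n) {U : Matrix (Fin 4) (Fin 4) ℂ} (hU : Uᴴ * U = 1) :
    (applyGate n ⟨i, by omega⟩ ⟨i + 1, h⟩ U)ᴴ * applyGate n ⟨i, by omega⟩ ⟨i + 1, h⟩ U = 1 := by
  rw [applyGate_eq]
  exact emb_unitary _ hU

theorem mop_norm_le_one {J : Type*} [Fintype J] [DecidableEq J] {M : Matrix J J ℂ} (h : Mᴴ * M = 1) : ‖mop M‖ ≤ 1 := by
  apply ContinuousLinearMap.opNorm_le_bound _ zero_le_one
  intro v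
  rw [mop_norm_of_unitary h, one_mul]

theorem gateAv_norm (n t k i : ℕ) (h : i + 1 < n) : ‖gateAv UB n t k i h‖ ≤ 1 := by
  apply av_norm_le
  intro f
  exact mop_norm_le_one (Phi_unitary t (gate_unitary h (wordMat_unitary _)))

theorem avgOp_pow (t k : ℕ) : avgOp t UB ^ k = av fun f : Fin k → {x // x ∈ UB} =>
    mop (Phi t (wordMat fun j => (f j : Matrix.unitaryGroup (Fin 4) ℂ))) := by
  have h1 : avgOp t UB = av fun a : {x // x ∈ UB} => mop (Phi t ((a : Matrix.unitaryGroup (Fin 4) ℂ) : Matrix (Fin 4) (Fin 4) ℂ)) := by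
    rw [avgOp, mop_smul', mop_sum', av, Fintype.card_coe]
    congr 1
    exact (Finset.sum_coe_sort UB (fun U : Matrix.unitaryGroup (Fin 4) ℂ => mop (Phi t (U : Matrix (Fin 4) (Fin 4) ℂ)))).symm
  have h2 := av_ofFn (m := k) (fun _ (a : {x // x ∈ UB}) =>
    mop (Phi t ((a : Matrix.unitaryGroup (Fin 4) ℂ) : Matrix (Fin 4) (Fin 4) ℂ)))
  rw [← h1, List.ofFn_const, List.prod_replicate] at h2
  rw [← h2]
  congr 1
  ext1 f
  let φ : Matrix (Fin 4) (Fin 4) ℂ →* (EuclideanSpace ℂ (Fin t ⊕ Fin t → Fin 4) →L[ℂ] EuclideanSpace ℂ (Fin t ⊕ Fin t → Fin 4)) :=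
    { toFun := fun M => mop (Phi t M)
      map_one' := by rw [Phi_one, mop_one']
      map_mul' := fun M N => by rw [Phi_mul, mop_mul'] }
  change (List.ofFn fun i => φ ((f i : Matrix.unitaryGroup (Fin 4) ℂ) : Matrix (Fin 4) (Fin 4) ℂ)).prod = φ (wordMat _)
  rw [wordMat, map_list_prod, List.map_ofFn]
  rfl

theorem gateAv_sub (n t k i : ℕ) (h : i + 1 < n) {δ : ℝ} (hδ0 : 0 ≤ δ)
    (hδ : ‖avgOp t UB ^ k - (lieFix t (Fin 4)).starProjection‖ ≤ δ) :
    ‖gateAv UB n t k i h - (Fg n t i).starProjection‖ ≤ δ := by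
  apply ContinuousLinearMap.opNorm_le_bound _ hδ0
  intro v
  apply sl_transfer (gateE h) (avgOp t UB ^ k - (lieFix t (Fin 4)).starProjection) _ v _ hδ0 hδ
  intro z
  have h1 : sl (gateE h) z ((Fg n t i).starProjection v) = (lieFix t (Fin 4)).starProjection (sl (gateE h) z v) := by
    rw [← sl_proj]
    have := embFix_gateE h t
    simp only [this]
  have h2 : sl (gateE h) z (gateAv UB n t k i h v) = (avgOp t UB ^ k) (sl (gateE h) z v) := by
    rw [avgOp_pow, gateAv, av, av, ContinuousLinearMap.smul_apply, ContinuousLinearMap.smul_apply, map_smul,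
      ContinuousLinearMap.sum_apply, ContinuousLinearMap.sum_apply, map_sum]
    congr 1
    apply Finset.sum_congr rfl
    intro f _
    rw [applyGate_eq, sl_Phi]
  rw [ContinuousLinearMap.sub_apply, ContinuousLinearMap.sub_apply, map_sub, h1, h2]

end Gate

section Assemble

/-- The representation `U ↦ U^{⊗t} ⊗ conj U^{⊗t}` as a monoid homomorphism. -/
def opHom (t : ℕ) (Y : Type*) [Fintype Y] [DecidableEq Y] : Matrix Y Y ℂ →*
    (EuclideanSpace ℂ (Fin t ⊕ Fin t → Y) →L[ℂ] EuclideanSpace ℂ (Fin t ⊕ Fin t → Y)) where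
  toFun := fun M => mop (Phi t M)
  map_one' := by rw [Phi_one, mop_one']
  map_mul' := fun M N => by rw [Phi_mul, mop_mul']

theorem opHom_apply (t : ℕ) {Y : Type*} [Fintype Y] [DecidableEq Y] (M : Matrix Y Y ℂ) :
    opHom t Y M = mop (Phi t M) := rfl

variable (UB : Finset (Matrix.unitaryGroup (Fin 4) ℂ))

/-- Averaged superoperator of one block. -/
def blockAv (n t k : ℕ) :
    EuclideanSpace ℂ (Fin t ⊕ Fin t → (Fin n → Fin 2)) →L[ℂ] EuclideanSpace ℂ (Fin t ⊕ Fin t → (Fin n → Fin 2)) :=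
  av fun p : (Fin (n / 2) → (Fin k → {x // x ∈ UB})) × (Fin ((n - 1) / 2) → (Fin k → {x // x ∈ UB})) =>
    mop (Phi t (blockUnitary n
      (fun i => wordMat fun j => (p.1 i j : Matrix.unitaryGroup (Fin 4) ℂ))
      (fun i => wordMat fun j => (p.2 i j : Matrix.unitaryGroup (Fin 4) ℂ))))

theorem blockAv_eq (n t k : ℕ) : blockAv UB n t k =
    (List.ofFn fun i : Fin ((n - 1) / 2) => gateAv UB n t k (2 * i.val + 1) (by omega)).prod *
    (List.ofFn fun i : Fin (n / 2) => gateAv UB n t k (2 * i.val) (by omega)).prod := by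
  have h1 := av_ofFn (m := (n - 1) / 2) (fun (i : Fin ((n - 1) / 2)) (f : Fin k → {x // x ∈ UB}) =>
    mop (Phi t (applyGate n ⟨2 * i.val + 1, by omega⟩ ⟨2 * i.val + 1 + 1, by omega⟩
    (wordMat fun j => (f j : Matrix.unitaryGroup (Fin 4) ℂ)))))
  have h2 := av_ofFn (m := n / 2) (fun (i : Fin (n / 2)) (f : Fin k → {x // x ∈ UB}) =>
    mop (Phi t (applyGate n ⟨2 * i.val, by omega⟩ ⟨2 * i.val + 1, by omega⟩
    (wordMat fun j => (f j : Matrix.unitaryGroup (Fin 4) ℂ)))))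
  unfold gateAv
  rw [← h1, ← h2, ← av_prod, blockAv]
  congr 1
  ext1 p
  rw [← opHom_apply, blockUnitary, map_mul, map_list_prod, map_list_prod, List.map_ofFn, List.map_ofFn]
  rfl

theorem ensembleAv_eq (n t k L : ℕ) :
    av (fun π : Fin L → (Fin (n / 2) → (Fin k → {x // x ∈ UB})) × (Fin ((n - 1) / 2) → (Fin k → {x // x ∈ UB})) =>
      mop (Phi t (List.ofFn fun l : Fin L =>
                blockUnitary n
                  (fun i => wordMat fun j => ((π l).1 i j : Matrix.unitaryGroup (Fin 4) ℂ))
                  (fun i => wordMat fun j => ((π l).2 i j : Matrix.unitaryGroup (Fin 4) ℂ))).prod)) =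
    blockAv UB n t k ^ L := by
  have h1 := av_ofFn (m := L) (fun _ (p : (Fin (n / 2) → (Fin k → {x // x ∈ UB})) × (Fin ((n - 1) / 2) → (Fin k → {x // x ∈ UB}))) =>
    mop (Phi t (blockUnitary n
      (fun i => wordMat fun j => (p.1 i j : Matrix.unitaryGroup (Fin 4) ℂ))
      (fun i => wordMat fun j => (p.2 i j : Matrix.unitaryGroup (Fin 4) ℂ)))))
  rw [List.ofFn_const, List.prod_replicate] at h1
  rw [blockAv, ← h1]
  congr 1
  ext1 π
  rw [← opHom_apply, map_list_prod, List.map_ofFn]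
  rfl

theorem list_unitary {Y : Type*} [Fintype Y] [DecidableEq Y] : ∀ {m : ℕ} (W : Fin m → Matrix Y Y ℂ),
    (∀ i, (W i)ᴴ * W i = 1) → ((List.ofFn W).prod)ᴴ * (List.ofFn W).prod = 1
  | 0, W, _ => by simp
  | m + 1, W, h => by
    rw [List.ofFn_succ, List.prod_cons, Matrix.conjTranspose_mul]
    have := list_unitary (fun i => W i.succ) (fun i => h _)
    rw [Matrix.mul_assoc, ← Matrix.mul_assoc (W 0)ᴴ, h 0, Matrix.one_mul, this]

theorem mul_unitary {Y : Type*} [Fintype Y] [DecidableEq Y] {A B : Matrix Y Y ℂ} (h1 : Aᴴ * A = 1) (h2 : Bᴴ * B = 1) :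
    (A * B)ᴴ * (A * B) = 1 := by
  rw [Matrix.conjTranspose_mul, Matrix.mul_assoc, ← Matrix.mul_assoc Aᴴ, h1, Matrix.one_mul, h2]

theorem av_mul_absorb {R : Type*} [Ring R] [Algebra ℂ R] {ι : Type*} [Fintype ι] [Nonempty ι] (f : ι → R) (g : R)
    (h : ∀ i, f i * g = g) : av f * g = g := by
  have hc : (Fintype.card ι : ℂ) ≠ 0 := by exact_mod_cast Fintype.card_ne_zero
  rw [av, smul_mul_assoc, Finset.sum_mul, Finset.sum_congr rfl (fun i _ => h i), Finset.sum_const, Finset.card_univ,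
    ← Nat.cast_smul_eq_nsmul ℂ, smul_smul, inv_mul_cancel₀ hc, one_smul]

theorem mul_av_absorb {R : Type*} [Ring R] [Algebra ℂ R] {ι : Type*} [Fintype ι] [Nonempty ι] (f : ι → R) (g : R)
    (h : ∀ i, g * f i = g) : g * av f = g := by
  have hc : (Fintype.card ι : ℂ) ≠ 0 := by exact_mod_cast Fintype.card_ne_zero
  rw [av, mul_smul_comm, Finset.mul_sum, Finset.sum_congr rfl (fun i _ => h i), Finset.sum_const, Finset.card_univ,
    ← Nat.cast_smul_eq_nsmul ℂ, smul_smul, inv_mul_cancel₀ hc, one_smul]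

theorem block_unitary' (n k : ℕ) (p : (Fin (n / 2) → (Fin k → {x // x ∈ UB})) × (Fin ((n - 1) / 2) → (Fin k → {x // x ∈ UB}))) :
    (blockUnitary n
      (fun i => wordMat fun j => (p.1 i j : Matrix.unitaryGroup (Fin 4) ℂ))
      (fun i => wordMat fun j => (p.2 i j : Matrix.unitaryGroup (Fin 4) ℂ)))ᴴ * blockUnitary n
      (fun i => wordMat fun j => (p.1 i j : Matrix.unitaryGroup (Fin 4) ℂ))
      (fun i => wordMat fun j => (p.2 i j : Matrix.unitaryGroup (Fin 4) ℂ)) = 1 := by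
  rw [blockUnitary]
  have h1 := list_unitary (fun i : Fin ((n - 1) / 2) => applyGate n ⟨2 * i.val + 1, by omega⟩ ⟨2 * i.val + 2, by omega⟩
    (wordMat fun j => (p.2 i j : Matrix.unitaryGroup (Fin 4) ℂ)))
    (fun i => gate_unitary (i := 2 * i.val + 1) (by omega) (wordMat_unitary _))
  have h2 := list_unitary (fun i : Fin (n / 2) => applyGate n ⟨2 * i.val, by omega⟩ ⟨2 * i.val + 1, by omega⟩
    (wordMat fun j => (p.1 i j : Matrix.unitaryGroup (Fin 4) ℂ)))
    (fun i => gate_unitary (i := 2 * i.val) (by omega) (wordMat_unitary _))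
  exact mul_unitary h1 h2

variable {E : Type*} [NormedAddCommGroup E] [InnerProductSpace ℂ E] [FiniteDimensional ℂ E]

theorem ofFn_chainProj (F : ℕ → Submodule ℂ E) (hF : FarComm F) (c : ℕ) : ∀ m : ℕ,
    (List.ofFn fun i : Fin m => (F (2 * i.val + c)).starProjection).prod =
      chainProj F {i | ∃ j, j < m ∧ i = 2 * j + c}
  | 0 => by
    have : {i | ∃ j, j < 0 ∧ i = 2 * j + c} = (∅ : Set ℕ) := by
      ext i; simp
    rw [this, chainProj_empty]; simp
  | m + 1 => by
    rw [List.ofFn_succ', List.concat_eq_append, List.prod_append, List.prod_singleton]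
    have ih := ofFn_chainProj F hF c m
    simp only [Fin.val_castSucc, Fin.val_last]
    rw [ih, ← chainProj_singleton F (2 * m + c), ← chainProj_union]
    · congr 1
      ext i
      simp only [Set.mem_union, Set.mem_singleton_iff]
      constructor
      · rintro (⟨j, h1, h2⟩ | h)
        · exact ⟨j, by omega, h2⟩
        · exact ⟨m, by omega, h⟩
      · rintro ⟨j, h1, h2⟩
        by_cases h : j = m
        · right; rw [h2, h]
        · left; exact ⟨j, by omega, h2⟩
    · apply commute_chainProj_chainProj
      rintro i ⟨j, h1, h2⟩ i' rfl
      exact hF _ _ (by omega)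

theorem layer_eq (n t c : ℕ) (m : ℕ) (S : Set ℕ) (hS : ∀ i, i < n - 1 → (i ∈ S ↔ ∃ j, j < m ∧ i = 2 * j + c))
    : (List.ofFn fun i : Fin m => (Fg n t (2 * i.val + c)).starProjection).prod = chainProj (Fg n t) S := by
  rw [ofFn_chainProj _ (Fg_farComm n t)]
  have : chainFix (Fg n t) {i | ∃ j, j < m ∧ i = 2 * j + c} = chainFix (Fg n t) S := by
    ext x
    rw [mem_chainFix, mem_chainFix]
    constructor
    · intro H i hi
      by_cases h : i < n - 1
      · exact H i ((hS i h).1 hi)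
      · rw [Fg_top (by omega)]; trivial
    · intro H i hi
      by_cases h : i < n - 1
      · exact H i ((hS i h).2 hi)
      · rw [Fg_top (by omega)]; trivial
  simp only [chainProj, this]

theorem blockAv_sub (n t k : ℕ) (hn : 2 ≤ n) (ht : 1 ≤ t) {δ : ℝ} (hδ0 : 0 ≤ δ)
    (hδ : ‖avgOp t UB ^ k - (lieFix t (Fin 4)).starProjection‖ ≤ δ) :
    ‖blockAv UB n t k - (lieFix t (Fin n → Fin 2)).starProjection‖ ≤ n * δ + Pgap t := by
  have hne : NormOneClass (EuclideanSpace ℂ (Fin t ⊕ Fin t → (Fin n → Fin 2)) →L[ℂ] EuclideanSpace ℂ (Fin t ⊕ Fin t → (Fin n → Fin 2))) :=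
    inferInstance
  have hpn : ∀ i, ‖(Fg n t i).starProjection‖ ≤ 1 := fun i => by
    apply ContinuousLinearMap.opNorm_le_bound _ zero_le_one
    intro v
    rw [one_mul]; exact proj_norm_le _ v
  rw [blockAv_eq]
  have ho := ofFn_prod_sub (δ := δ) (fun i : Fin ((n - 1) / 2) => gateAv UB n t k (2 * i.val + 1) (by omega))
    (fun i => (Fg n t (2 * i.val + 1)).starProjection) (fun i => gateAv_norm _ _ _ _ _ _) (fun i => hpn _)
    (fun i => gateAv_sub _ _ _ _ _ _ hδ0 hδ)
  have he := ofFn_prod_sub (δ := δ) (fun i : Fin (n / 2) => gateAv UB n t k (2 * i.val) (by omega))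
    (fun i => (Fg n t (2 * i.val)).starProjection) (fun i => gateAv_norm _ _ _ _ _ _) (fun i => hpn _)
    (fun i => gateAv_sub _ _ _ _ _ _ hδ0 hδ)
  have hon := ofFn_prod_norm (fun i : Fin ((n - 1) / 2) => gateAv UB n t k (2 * i.val + 1) (by omega))
    (fun i => gateAv_norm _ _ _ _ _ _)
  have hen := ofFn_prod_norm (fun i : Fin (n / 2) => (Fg n t (2 * i.val)).starProjection) (fun i => hpn _)
  have e1 := layer_eq n t 1 ((n - 1) / 2) {i | Odd i} (by
    intro i hi
    constructor
    · rintro ⟨j, hj⟩; exact ⟨j, by omega, hj⟩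
    · rintro ⟨j, _, hj⟩; exact ⟨j, hj⟩)
  have e2 := layer_eq n t 0 (n / 2) {i | Even i} (by
    intro i hi
    constructor
    · rintro ⟨j, hj⟩; exact ⟨j, by omega, by omega⟩
    · rintro ⟨j, _, hj⟩; exact ⟨j, by omega⟩)
  simp only [add_zero] at e2
  rw [e1] at ho
  rw [e2] at he hen
  set A := (List.ofFn fun i : Fin ((n - 1) / 2) => gateAv UB n t k (2 * i.val + 1) (by omega)).prod
  set B := (List.ofFn fun i : Fin (n / 2) => gateAv UB n t k (2 * i.val) (by omega)).prod
  set P := chainProj (Fg n t) {i | Odd i}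
  set Q := chainProj (Fg n t) {i | Even i}
  have hG : (lieFix t (Fin n → Fin 2)).starProjection = chainProj (Fg n t) Set.univ := by
    have := chainFix_univ hn t
    simp only [chainProj, this]
  have hPQ : ‖P * Q - (lieFix t (Fin n → Fin 2)).starProjection‖ ≤ Pgap t := by
    apply ContinuousLinearMap.opNorm_le_bound _ (Pgap_pos ht).le
    intro v
    rw [hG]
    exact block_bound n ht v
  set G := (lieFix t (Fin n → Fin 2)).starProjection
  have e : A * B - G = A * (B - Q) + (A - P) * Q + (P * Q - G) := by
    rw [mul_sub, sub_mul]; abel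
  rw [e]
  have a1 : ‖A * (B - Q)‖ ≤ 1 * ((n / 2 : ℕ) * δ) :=
    (norm_mul_le _ _).trans (mul_le_mul hon he (norm_nonneg _) zero_le_one)
  have a2 : ‖(A - P) * Q‖ ≤ (((n - 1) / 2 : ℕ) * δ) * 1 :=
    (norm_mul_le _ _).trans (mul_le_mul ho hen (norm_nonneg _) (by positivity))
  have a3 : (((n / 2 : ℕ) : ℝ) + ((n - 1) / 2 : ℕ)) * δ ≤ n * δ := by
    apply mul_le_mul_of_nonneg_right _ hδ0
    norm_cast
    omega
  have a4 := norm_add₃_le (a := A * (B - Q)) (b := (A - P) * Q) (c := P * Q - G)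
  linarith

theorem Phi_mul_G {Y : Type*} [Fintype Y] [DecidableEq Y] (t : ℕ) {U : Matrix Y Y ℂ} (h : Uᴴ * U = 1) :
    mop (Phi t U) * (lieFix t Y).starProjection = (lieFix t Y).starProjection := by
  ext1 v
  rw [ContinuousLinearMap.mul_apply]
  exact fix_of_lieFix (Submodule.starProjection_apply_mem (lieFix t Y) v) h

theorem G_mul_Phi {Y : Type*} [Fintype Y] [DecidableEq Y] (t : ℕ) {U : Matrix Y Y ℂ} (h : Uᴴ * U = 1) :
    (lieFix t Y).starProjection * mop (Phi t U) = (lieFix t Y).starProjection := by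
  ext1 v
  rw [ContinuousLinearMap.mul_apply]
  exact Phi_comm_proj' t h (mul_eq_one_comm.1 h) v

theorem blockAv_absorb (n t k : ℕ) (hne : UB.Nonempty) :
    blockAv UB n t k * (lieFix t (Fin n → Fin 2)).starProjection = (lieFix t (Fin n → Fin 2)).starProjection ∧
    (lieFix t (Fin n → Fin 2)).starProjection * blockAv UB n t k = (lieFix t (Fin n → Fin 2)).starProjection := by
  obtain ⟨u, hu⟩ := hne
  haveI : Nonempty {x // x ∈ UB} := ⟨⟨u, hu⟩⟩
  constructor
  · apply av_mul_absorb
    intro p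
    exact Phi_mul_G t (block_unitary' UB n k p)
  · apply mul_av_absorb
    intro p
    exact G_mul_Phi t (block_unitary' UB n k p)

theorem blockAv_pow (n t k L : ℕ) (hne : UB.Nonempty) (hn : 2 ≤ n) (ht : 1 ≤ t) (hL : 1 ≤ L) {δ : ℝ} (hδ0 : 0 ≤ δ)
    (hδ : ‖avgOp t UB ^ k - (lieFix t (Fin 4)).starProjection‖ ≤ δ) :
    ‖blockAv UB n t k ^ L - (lieFix t (Fin n → Fin 2)).starProjection‖ ≤ (n * δ + Pgap t) ^ L := by
  obtain ⟨h1, h2⟩ := blockAv_absorb UB n t k hne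
  obtain ⟨l, rfl⟩ : ∃ l, L = l + 1 := ⟨L - 1, by omega⟩
  rw [pow_sub_absorb h1 h2 (by ext1 v; exact proj_idem _ v)]
  refine (norm_pow_le' _ (by omega)).trans ?_
  exact pow_le_pow_left₀ (norm_nonneg _) (blockAv_sub UB n t k hn ht hδ0 hδ) _

end Assemble

section Numerics

theorem pow_le_of_logb {x M : ℝ} (hx0 : 0 < x) (hx1 : x < 1) {k : ℕ} (h : M / Real.logb 2 (1 / x) ≤ k) :
    x ^ k ≤ (2 : ℝ) ^ (-M) := by
  have h1 : 1 < 1 / x := by rw [lt_div_iff₀ hx0]; linarith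
  have h2 : 0 < Real.logb 2 (1 / x) := Real.logb_pos (by norm_num) h1
  rw [div_le_iff₀ h2] at h
  have h3 : x = (2 : ℝ) ^ (-Real.logb 2 (1 / x)) := by
    rw [Real.rpow_neg (by norm_num), Real.rpow_logb (by norm_num) (by norm_num) (by positivity)]
    simp
  have h4 : x ^ k = (2 : ℝ) ^ (-((k : ℝ) * Real.logb 2 (1 / x))) := by
    nth_rewrite 1 [h3]
    rw [← Real.rpow_natCast, ← Real.rpow_mul (by norm_num)]
    congr 1; ring
  rw [h4]
  apply Real.rpow_le_rpow_of_exponent_le (by norm_num)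
  linarith

theorem two_rpow_logb {x : ℝ} (hx : 0 < x) : (2 : ℝ) ^ (-Real.logb 2 (1 / x)) = x := by
  rw [Real.rpow_neg (by norm_num), Real.rpow_logb (by norm_num) (by norm_num) (by positivity)]
  simp

theorem choose_C {K : ℕ} (hK : 1 ≤ K) {r : ℝ} (hr0 : 0 < r) (hr1 : r < 1) {t : ℕ} (ht : 1 ≤ t) {a : ℝ} (ha0 : 0 < a) (ha1 : a ≤ 1) :
    ∃ C : ℝ, 0 < C ∧ C < 1 ∧ ∀ (n k : ℕ) (ε : ℝ), 0 < ε → ε < 1 → 1 ≤ n →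
      (10 * t + (n : ℝ) ^ 2 * t - n * t + n + Real.logb 2 (1 / ε)) / Real.logb 2 (1 / (1 + (C - 1) * a)) ≤ (k : ℝ) →
      K ≤ k ∧ n * r ^ k ≤ ε := by
  have hK0 : (0 : ℝ) < K := by exact_mod_cast hK
  set c : ℝ := (2 : ℝ) ^ (-(1 / (K : ℝ))) with hc
  have hcK : c ^ K = 1 / 2 := by
    rw [hc, ← Real.rpow_natCast, ← Real.rpow_mul (by norm_num)]
    have : -(1 / (K : ℝ)) * K = -1 := by field_simp
    rw [this, Real.rpow_neg (by norm_num)]; norm_num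
  have hc0 : 0 < c := by positivity
  have hc1 : c < 1 := by
    by_contra h
    push Not at h
    have := one_le_pow₀ h (n := K)
    rw [hcK] at this
    norm_num at this
  refine ⟨max r c, lt_max_of_lt_left hr0, max_lt hr1 hc1, ?_⟩
  intro n k ε he0 he1 hn h
  set C := max r c
  have hC0 : 0 < C := lt_max_of_lt_left hr0
  have hC1 : C < 1 := max_lt hr1 hc1
  have hb0 : C ≤ 1 + (C - 1) * a := by nlinarith
  have hb1 : 1 + (C - 1) * a < 1 := by nlinarith
  have h1 := pow_le_of_logb (by linarith) hb1 h
  have h2 : C ^ k ≤ (1 + (C - 1) * a) ^ k := pow_le_pow_left₀ hC0.le hb0 k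
  have hn' : (1 : ℝ) ≤ n := by exact_mod_cast hn
  have ht' : (1 : ℝ) ≤ t := by exact_mod_cast ht
  have h3 : (1 : ℝ) + n + Real.logb 2 (1 / ε) ≤ 10 * t + (n : ℝ) ^ 2 * t - n * t + n + Real.logb 2 (1 / ε) := by
    have : 0 ≤ ((n : ℝ) - 1) * n * t := by
      apply mul_nonneg (mul_nonneg (by linarith) (by linarith)) (by linarith)
    nlinarith
  have h4 : C ^ k ≤ (2 : ℝ) ^ (-(1 + n + Real.logb 2 (1 / ε))) := by
    refine (h2.trans h1).trans ?_
    apply Real.rpow_le_rpow_of_exponent_le (by norm_num)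
    linarith
  have h5 : (2 : ℝ) ^ (-(1 + n + Real.logb 2 (1 / ε))) = ((2 : ℝ) ^ (n + 1))⁻¹ * ε := by
    rw [neg_add, Real.rpow_add (by norm_num), two_rpow_logb he0, Real.rpow_neg (by norm_num)]
    congr 2
    rw [← Real.rpow_natCast]
    congr 1
    push_cast; ring
  rw [h5] at h4
  have h6 : (n : ℝ) + 1 ≤ (2 : ℝ) ^ (n + 1) := by
    have := Nat.lt_two_pow_self (n := n + 1)
    exact_mod_cast this.le
  have h6' : (2 : ℝ) < (2 : ℝ) ^ (n + 1) := by
    have : (2 : ℝ) ^ 1 < (2 : ℝ) ^ (n + 1) := pow_lt_pow_right₀ (by norm_num) (by omega)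
    simpa using this
  constructor
  · by_contra hk
    push Not at hk
    have h7 : C ^ K ≤ C ^ k := pow_le_pow_of_le_one hC0.le hC1.le hk.le
    have h8 : c ^ K ≤ C ^ K := pow_le_pow_left₀ hc0.le (le_max_right _ _) K
    have h9 : ((2 : ℝ) ^ (n + 1))⁻¹ * ε < 1 / 2 := by
      have : ((2 : ℝ) ^ (n + 1))⁻¹ < 2⁻¹ := by
        apply inv_strictAnti₀ (by norm_num) h6'
      have hp : 0 < ((2 : ℝ) ^ (n + 1))⁻¹ := by positivity
      nlinarith
    rw [hcK] at h8
    linarith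
  · have h7 : r ^ k ≤ C ^ k := pow_le_pow_left₀ hr0.le (le_max_left _ _) k
    calc (n : ℝ) * r ^ k ≤ (2 : ℝ) ^ (n + 1) * (((2 : ℝ) ^ (n + 1))⁻¹ * ε) := by
          apply mul_le_mul (by linarith) (h7.trans h4) (by positivity) (by positivity)
      _ = ε := by
          rw [mul_inv_cancel_left₀ (by positivity)]

theorem n_ge {t n : ℕ} (ht : 1 ≤ t) (h : ⌊(2.5 : ℝ) * Real.logb 2 (4 * t)⌋ ≤ (n : ℤ)) : 2 ≤ n := by
  have ht' : (1 : ℝ) ≤ t := by exact_mod_cast ht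
  have h1 : (2 : ℝ) ≤ Real.logb 2 (4 * t) := by
    rw [Real.le_logb_iff_rpow_le (by norm_num) (by linarith)]
    norm_num
    linarith
  have h2 : (5 : ℤ) ≤ ⌊(2.5 : ℝ) * Real.logb 2 (4 * t)⌋ := by
    rw [Int.le_floor]
    push_cast
    linarith
  omega

theorem L_bound {t n L : ℕ} (ht : 1 ≤ t) (hn : 1 ≤ n) {x ε : ℝ} (hx0 : 0 < x) (hx1 : x < 1) (he0 : 0 < ε) (he1 : ε < 1)
    (h : (4 * n * t + Real.logb 2 (1 / ε)) / Real.logb 2 (1 / x) ≤ (L : ℝ)) :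
    1 ≤ L ∧ ((2 : ℝ) ^ (n * t)) ^ 2 * x ^ L ≤ ε := by
  have h1 := pow_le_of_logb hx0 hx1 h
  have h5 : (2 : ℝ) ^ (-(4 * n * t + Real.logb 2 (1 / ε))) = ((2 : ℝ) ^ (4 * n * t))⁻¹ * ε := by
    rw [neg_add, Real.rpow_add (by norm_num), two_rpow_logb he0, Real.rpow_neg (by norm_num)]
    congr 2
    rw [← Real.rpow_natCast]
    congr 1
    push_cast; ring
  rw [h5] at h1
  have hp : 1 ≤ (2 : ℝ) ^ (4 * n * t) := one_le_pow₀ (by norm_num)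
  constructor
  · by_contra hL
    have : L = 0 := by omega
    rw [this, pow_zero] at h1
    have h6 : ((2 : ℝ) ^ (4 * n * t))⁻¹ ≤ 1 := inv_le_one_of_one_le₀ hp
    nlinarith
  · have h7 : ((2 : ℝ) ^ (n * t)) ^ 2 ≤ (2 : ℝ) ^ (4 * n * t) := by
      rw [← pow_mul]
      apply pow_le_pow_right₀ (by norm_num)
      nlinarith [Nat.zero_le (n * t)]
    calc ((2 : ℝ) ^ (n * t)) ^ 2 * x ^ L ≤ (2 : ℝ) ^ (4 * n * t) * (((2 : ℝ) ^ (4 * n * t))⁻¹ * ε) := by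
          apply mul_le_mul h7 h1 (by positivity) (by positivity)
      _ = ε := by
          rw [mul_inv_cancel_left₀ (by positivity)]

end Numerics

section Haar
variable {Y : Type*} [Fintype Y] [DecidableEq Y]

theorem integrable_mop_Phi (t : ℕ) (μ : Measure (Matrix.unitaryGroup Y ℂ)) [IsProbabilityMeasure μ]
    (v : EuclideanSpace ℂ (Fin t ⊕ Fin t → Y)) :
    Integrable (fun U : Matrix.unitaryGroup Y ℂ => mop (Phi t (U : Matrix Y Y ℂ)) v) μ := by
  apply Integrable.of_bound (C := ‖v‖)
  · exact (continuous_mop_Phi t v).aestronglyMeasurable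
  · refine Filter.Eventually.of_forall fun U => ?_
    rw [mop_norm_of_unitary (Phi_unitary t (ug_left U))]

theorem haar_proj (t : ℕ) (μ : Measure (Matrix.unitaryGroup Y ℂ)) [IsProbabilityMeasure μ] [μ.IsHaarMeasure]
    (v : EuclideanSpace ℂ (Fin t ⊕ Fin t → Y)) :
    ∫ U : Matrix.unitaryGroup Y ℂ, mop (Phi t (U : Matrix Y Y ℂ)) v ∂μ = (lieFix t Y).starProjection v := by
  have hintg := integrable_mop_Phi t μ v
  have h1 : ∫ U : Matrix.unitaryGroup Y ℂ, mop (Phi t (U : Matrix Y Y ℂ)) v ∂μ ∈ lieFix t Y := by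
    rw [lieFix_iff]
    intro W hW
    set W' : Matrix.unitaryGroup Y ℂ := ⟨W, Matrix.mem_unitaryGroup_iff'.2 hW⟩
    rw [← ContinuousLinearMap.integral_comp_comm _ hintg]
    have h2 := integral_mul_left_eq_self (μ := μ) (fun U : Matrix.unitaryGroup Y ℂ => mop (Phi t (U : Matrix Y Y ℂ)) v) W'
    rw [← h2]
    congr 1
    ext1 U
    rw [← mop_mul, ← Phi_mul]
    rfl
  have h2 : (lieFix t Y).starProjection (∫ U : Matrix.unitaryGroup Y ℂ, mop (Phi t (U : Matrix Y Y ℂ)) v ∂μ) =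
      (lieFix t Y).starProjection v := by
    rw [← ContinuousLinearMap.integral_comp_comm _ hintg]
    simp only [Phi_comm_proj]
    simp
  rw [← h2]
  exact (Submodule.starProjection_eq_self_iff.2 h1).symm

theorem haar_entry (t : ℕ) (μ : Measure (Matrix.unitaryGroup Y ℂ)) [IsProbabilityMeasure μ] [μ.IsHaarMeasure]
    (v : EuclideanSpace ℂ (Fin t ⊕ Fin t → Y)) (z : Fin t ⊕ Fin t → Y) :
    ∫ U : Matrix.unitaryGroup Y ℂ, mop (Phi t (U : Matrix Y Y ℂ)) v z ∂μ = (lieFix t Y).starProjection v z := by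
  rw [← haar_proj t μ v]
  exact ContinuousLinearMap.integral_comp_comm (EuclideanSpace.proj z : EuclideanSpace ℂ (Fin t ⊕ Fin t → Y) →L[ℂ] ℂ)
    (integrable_mop_Phi t μ v)

theorem integrable_entry (t : ℕ) (μ : Measure (Matrix.unitaryGroup Y ℂ)) [IsProbabilityMeasure μ]
    (v : EuclideanSpace ℂ (Fin t ⊕ Fin t → Y)) (z : Fin t ⊕ Fin t → Y) :
    Integrable (fun U : Matrix.unitaryGroup Y ℂ => mop (Phi t (U : Matrix Y Y ℂ)) v z) μ :=
  (EuclideanSpace.proj z : EuclideanSpace ℂ (Fin t ⊕ Fin t → Y) →L[ℂ] ℂ).integrable_comp (integrable_mop_Phi t μ v)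

/-- Matrix of the projection onto the fixed space. -/
def Gm (t : ℕ) (Y : Type*) [Fintype Y] [DecidableEq Y] : Matrix (Fin t ⊕ Fin t → Y) (Fin t ⊕ Fin t → Y) ℂ :=
  (Matrix.toEuclideanCLM (𝕜 := ℂ) (n := Fin t ⊕ Fin t → Y)).symm (lieFix t Y).starProjection

theorem mop_Gm (t : ℕ) : mop (Gm t Y) = (lieFix t Y).starProjection := by
  have := (Matrix.toEuclideanCLM (𝕜 := ℂ) (n := Fin t ⊕ Fin t → Y)).apply_symm_apply (lieFix t Y).starProjection
  rw [mop, Gm]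
  convert this

theorem mop_single {J : Type*} [Fintype J] [DecidableEq J] (M : Matrix J J ℂ) (i j : J) :
    mop M (EuclideanSpace.single j 1) i = M i j := by
  rw [mop_apply]
  simp [EuclideanSpace.single_apply]

theorem mop_inj {J : Type*} [Fintype J] [DecidableEq J] {M N : Matrix J J ℂ} (h : mop M = mop N) : M = N := by
  ext i j
  rw [← mop_single M, ← mop_single N, h]

theorem Gm_mul (t : ℕ) : Gm t Y * Gm t Y = Gm t Y := by
  apply mop_inj
  rw [mop_mul', mop_Gm]
  ext1 v
  exact proj_idem _ v

theorem Gm_herm (t : ℕ) : (Gm t Y)ᴴ = Gm t Y := by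
  apply mop_inj
  ext1 v
  apply ext_inner_left ℂ
  intro w
  rw [← mop_inner, mop_Gm]
  exact proj_symm _ _ _

theorem Gm_entry (t : ℕ) (μ : Measure (Matrix.unitaryGroup Y ℂ)) [IsProbabilityMeasure μ] [μ.IsHaarMeasure]
    (z z' : Fin t ⊕ Fin t → Y) :
    ∫ U : Matrix.unitaryGroup Y ℂ, Phi t (U : Matrix Y Y ℂ) z z' ∂μ = Gm t Y z z' := by
  rw [← mop_single (Gm t Y), mop_Gm, ← haar_entry t μ]
  simp only [mop_single]

theorem integrable_Phi (t : ℕ) (μ : Measure (Matrix.unitaryGroup Y ℂ)) [IsProbabilityMeasure μ]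
    (z z' : Fin t ⊕ Fin t → Y) :
    Integrable (fun U : Matrix.unitaryGroup Y ℂ => Phi t (U : Matrix Y Y ℂ) z z') μ := by
  have := integrable_entry t μ (EuclideanSpace.single z' 1) z
  simpa only [mop_single] using this

end Haar

section Vec
variable {Y : Type*} [Fintype Y] [DecidableEq Y] {t : ℕ}

/-- Left half of a doubled index. -/
def lh (z : Fin t ⊕ Fin t → Y) : Fin t → Y := fun s => z (Sum.inl s)

/-- Right half of a doubled index. -/
def rh (z : Fin t ⊕ Fin t → Y) : Fin t → Y := fun s => z (Sum.inr s)

theorem sumZ {M : Type*} [AddCommMonoid M] (f : (Fin t → Y) → (Fin t → Y) → M) :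
    ∑ z : Fin t ⊕ Fin t → Y, f (lh z) (rh z) = ∑ x, ∑ y, f x y := by
  rw [← Fintype.sum_prod_type', ← (Equiv.sumArrowEquivProdArrow (Fin t) (Fin t) Y).sum_comp]
  rfl

theorem elim_lr (z : Fin t ⊕ Fin t → Y) : Sum.elim (lh z) (rh z) = z := by
  ext i; rcases i with i | i <;> rfl

theorem lh_elim (x y : Fin t → Y) : lh (Sum.elim x y) = x := rfl
theorem rh_elim (x y : Fin t → Y) : rh (Sum.elim x y) = y := rfl

/-- Vectorization. -/
def vecM (ρ : Matrix (Fin t → Y) (Fin t → Y) ℂ) : EuclideanSpace ℂ (Fin t ⊕ Fin t → Y) :=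
  WithLp.toLp 2 fun z => ρ (lh z) (rh z)

/-- Matrix form. -/
def matV (v : EuclideanSpace ℂ (Fin t ⊕ Fin t → Y)) : Matrix (Fin t → Y) (Fin t → Y) ℂ :=
  fun x y => v (Sum.elim x y)

/-- The superoperator kernel `c ⊗ conj c`. -/
def kr (c : Matrix (Fin t → Y) (Fin t → Y) ℂ) : Matrix (Fin t ⊕ Fin t → Y) (Fin t ⊕ Fin t → Y) ℂ :=
  fun z z' => c (lh z) (lh z') * star (c (rh z) (rh z'))

theorem kr_tpow (U : Matrix Y Y ℂ) : kr (tpowMat t U) = Phi t U := by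
  ext z z'
  rw [kr, Phi, tens, Fintype.prod_sum_type, tpowMat, tpowMat, star_prod]
  rfl

theorem matV_kr (c : Matrix (Fin t → Y) (Fin t → Y) ℂ) (v : EuclideanSpace ℂ (Fin t ⊕ Fin t → Y)) :
    matV (mop (kr c) v) = c * matV v * cᴴ := by
  ext x y
  rw [matV, mop_apply, Matrix.mul_apply]
  simp only [Matrix.mul_apply, Matrix.conjTranspose_apply, Finset.sum_mul]
  rw [Finset.sum_comm, ← sumZ (fun a b => c x a * matV v a b * star (c y b))]
  apply Finset.sum_congr rfl
  intro z _
  rw [matV, elim_lr, kr, lh_elim, rh_elim]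
  ring

theorem matV_vecM (ρ : Matrix (Fin t → Y) (Fin t → Y) ℂ) : matV (vecM ρ) = ρ := by
  ext x y; rfl

theorem vecM_matV (v : EuclideanSpace ℂ (Fin t ⊕ Fin t → Y)) : vecM (matV v) = v := by
  ext z
  change v (Sum.elim (lh z) (rh z)) = v z
  rw [elim_lr]

theorem haarChannel_eq (μ : Measure (Matrix.unitaryGroup Y ℂ)) [IsProbabilityMeasure μ] [μ.IsHaarMeasure]
    (ρ : Matrix (Fin t → Y) (Fin t → Y) ℂ) : haarChannel t μ ρ = matV (mop (Gm t Y) (vecM ρ)) := by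
  ext x y
  rw [haarChannel, mop_Gm, matV, ← haar_entry t μ]
  congr 1
  ext1 U
  have := matV_kr (tpowMat t (U : Matrix Y Y ℂ)) (vecM ρ)
  rw [matV_vecM, kr_tpow] at this
  rw [← this]
  rfl

theorem tpow_channel (V : Matrix Y Y ℂ) (ρ : Matrix (Fin t → Y) (Fin t → Y) ℂ) :
    tpowMat t V * ρ * (tpowMat t V)ᴴ = matV (mop (Phi t V) (vecM ρ)) := by
  rw [← kr_tpow, matV_kr, matV_vecM]

theorem tpow_mul (U V : Matrix Y Y ℂ) : tpowMat t (U * V) = tpowMat t U * tpowMat t V :=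
  (tens_mul (fun _ : Fin t => U) (fun _ => V)).symm

theorem tpow_one : tpowMat t (1 : Matrix Y Y ℂ) = 1 := tens_one

theorem tpow_conj (U : Matrix Y Y ℂ) : (tpowMat t U)ᴴ = tpowMat t Uᴴ := tens_conjTranspose (fun _ : Fin t => U)

/-- Fixed vectors commute with tensor powers. -/
theorem matV_comm {v : EuclideanSpace ℂ (Fin t ⊕ Fin t → Y)} (hv : v ∈ lieFix t Y) {U : Matrix Y Y ℂ} (hU : Uᴴ * U = 1) :
    tpowMat t U * matV v = matV v * tpowMat t U := by
  have h1 := fix_of_lieFix hv hU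
  have h2 := matV_kr (tpowMat t U) v
  rw [kr_tpow, h1] at h2
  nth_rewrite 2 [h2]
  rw [Matrix.mul_assoc _ (tpowMat t U)ᴴ, tpow_conj, ← tpow_mul, hU, tpow_one, Matrix.mul_one]

theorem one_fix : vecM (1 : Matrix (Fin t → Y) (Fin t → Y) ℂ) ∈ lieFix t Y := by
  rw [lieFix_iff]
  intro U hU
  rw [← vecM_matV (mop _ _), ← kr_tpow, matV_kr, matV_vecM, Matrix.mul_one, tpow_conj, ← tpow_mul,
    mul_eq_one_comm.1 hU, tpow_one]

end Vec

section Quad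
variable {Y : Type*} [Fintype Y] [DecidableEq Y] {t : ℕ}

/-- Squared Hilbert–Schmidt norm. -/
def hs {I J : Type*} [Fintype I] [Fintype J] (A : Matrix I J ℂ) : ℝ := ∑ x, ∑ y, ‖A x y‖ ^ 2

theorem hs_nonneg {I J : Type*} [Fintype I] [Fintype J] (A : Matrix I J ℂ) : 0 ≤ hs A :=
  Finset.sum_nonneg fun _ _ => Finset.sum_nonneg fun _ _ => sq_nonneg _

theorem trace_self {I J : Type*} [Fintype I] [Fintype J] (A : Matrix I J ℂ) : (A * Aᴴ).trace = (hs A : ℂ) := by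
  rw [Matrix.trace, hs]
  push_cast
  apply Finset.sum_congr rfl
  intro x _
  rw [Matrix.diag_apply, Matrix.mul_apply]
  apply Finset.sum_congr rfl
  intro y _
  rw [Matrix.conjTranspose_apply]
  exact Complex.mul_conj' _

theorem hs_sum_le {ι I J : Type*} [Fintype ι] [Fintype I] [Fintype J] (f : ι → Matrix I J ℂ) :
    hs (∑ i, f i) ≤ Fintype.card ι * ∑ i, hs (f i) := by
  simp only [hs]
  rw [Finset.sum_comm (s := (Finset.univ : Finset ι)), Finset.mul_sum]
  apply Finset.sum_le_sum
  intro x _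
  rw [Finset.sum_comm (s := (Finset.univ : Finset ι)), Finset.mul_sum]
  apply Finset.sum_le_sum
  intro y _
  rw [Matrix.sum_apply]
  calc ‖∑ i, f i x y‖ ^ 2 ≤ (∑ i, ‖f i x y‖) ^ 2 := by
        gcongr; exact norm_sum_le _ _
    _ ≤ _ := by
        have := sq_sum_le_card_mul_sum_sq (s := Finset.univ) (f := fun i => ‖f i x y‖)
        simpa using this

theorem hs_kr (c : Matrix (Fin t → Y) (Fin t → Y) ℂ) : hs (kr c) = hs c ^ 2 := by
  have h1 : ∀ x x', ∑ z' : Fin t ⊕ Fin t → Y, ‖c x (lh z')‖ ^ 2 * ‖c x' (rh z')‖ ^ 2 =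
      (∑ y, ‖c x y‖ ^ 2) * ∑ y, ‖c x' y‖ ^ 2 := by
    intro x x'
    rw [sumZ (fun a b => ‖c x a‖ ^ 2 * ‖c x' b‖ ^ 2), Finset.sum_mul_sum]
  have h2 : hs (kr c) = ∑ z : Fin t ⊕ Fin t → Y, (∑ y, ‖c (lh z) y‖ ^ 2) * ∑ y, ‖c (rh z) y‖ ^ 2 := by
    rw [hs]
    apply Finset.sum_congr rfl
    intro z _
    rw [← h1]
    apply Finset.sum_congr rfl
    intro z' _
    rw [kr, norm_mul, norm_star, mul_pow]
  rw [h2, sumZ (fun a b => (∑ y, ‖c a y‖ ^ 2) * ∑ y, ‖c b y‖ ^ 2), hs, sq, Finset.sum_mul_sum]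

/-- The quadratic form `tr((c ⊗ conj c)ᴴ X)`. -/
def qf (c : Matrix (Fin t → Y) (Fin t → Y) ℂ) (X : Matrix (Fin t ⊕ Fin t → Y) (Fin t ⊕ Fin t → Y) ℂ) : ℂ :=
  ((kr c)ᴴ * X).trace

theorem trace_bound {J : Type*} [Fintype J] [DecidableEq J] (A X : Matrix J J ℂ) {l : ℝ} (hl : 0 ≤ l) (hX : ‖mop X‖ ≤ l) :
    ‖(Aᴴ * X).trace‖ ^ 2 ≤ Fintype.card J * hs A * l ^ 2 := by
  have h1 : (Aᴴ * X).trace = ∑ j, inner ℂ (mop A (EuclideanSpace.single j 1)) (mop X (EuclideanSpace.single j 1)) := by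
    rw [Matrix.trace]
    apply Finset.sum_congr rfl
    intro j _
    rw [Matrix.diag_apply, Matrix.mul_apply, PiLp.inner_apply]
    apply Finset.sum_congr rfl
    intro i _
    rw [mop_single, mop_single, Matrix.conjTranspose_apply, RCLike.inner_apply, mul_comm]
    rfl
  have h2 : ‖(Aᴴ * X).trace‖ ≤ ∑ j, ‖mop A (EuclideanSpace.single j 1)‖ * l := by
    rw [h1]
    refine (norm_sum_le _ _).trans (Finset.sum_le_sum fun j _ => ?_)
    refine (norm_inner_le_norm _ _).trans ?_
    apply mul_le_mul_of_nonneg_left _ (norm_nonneg _)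
    refine (ContinuousLinearMap.le_opNorm _ _).trans ?_
    simpa using hX
  have h3 : ∑ j, ‖mop A (EuclideanSpace.single j 1)‖ ^ 2 = hs A := by
    rw [hs, Finset.sum_comm]
    apply Finset.sum_congr rfl
    intro j _
    rw [EuclideanSpace.norm_sq_eq]
    simp only [mop_single]
  calc ‖(Aᴴ * X).trace‖ ^ 2 ≤ (∑ j, ‖mop A (EuclideanSpace.single j 1)‖ * l) ^ 2 := by gcongr
    _ = (∑ j, ‖mop A (EuclideanSpace.single j 1)‖) ^ 2 * l ^ 2 := by rw [← Finset.sum_mul, mul_pow]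
    _ ≤ (Fintype.card J * hs A) * l ^ 2 := by
        gcongr
        have := sq_sum_le_card_mul_sum_sq (s := Finset.univ) (f := fun j => ‖mop A (EuclideanSpace.single j 1)‖)
        rw [h3] at this
        simpa using this

theorem qf_bound (c : Matrix (Fin t → Y) (Fin t → Y) ℂ) (X : Matrix (Fin t ⊕ Fin t → Y) (Fin t ⊕ Fin t → Y) ℂ)
    {l : ℝ} (hl : 0 ≤ l) (hX : ‖mop X‖ ≤ l) : ‖qf c X‖ ≤ Fintype.card (Fin t → Y) * hs c * l := by
  have h := trace_bound (kr c) X hl hX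
  rw [hs_kr] at h
  have h2 : (Fintype.card (Fin t ⊕ Fin t → Y) : ℝ) = (Fintype.card (Fin t → Y) : ℝ) ^ 2 := by
    rw [Fintype.card_congr (Equiv.sumArrowEquivProdArrow (Fin t) (Fin t) Y), Fintype.card_prod]
    push_cast; ring
  rw [h2] at h
  have h3 := hs_nonneg c
  apply le_of_sq_le_sq _ (by positivity)
  refine h.trans (le_of_eq ?_)
  ring

theorem qf_tpow (c : Matrix (Fin t → Y) (Fin t → Y) ℂ) (U : Matrix Y Y ℂ) :
    qf c (Phi t U) = ((‖∑ x, ∑ y, star (c x y) * tpowMat t U x y‖ ^ 2 : ℝ) : ℂ) := by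
  push_cast
  rw [← Complex.mul_conj', ← kr_tpow, qf, Matrix.trace]
  simp only [Matrix.diag_apply, Matrix.mul_apply, Matrix.conjTranspose_apply, kr]
  have h1 : ∀ y y', ∑ z : Fin t ⊕ Fin t → Y, star (c (lh z) y * star (c (rh z) y')) *
      (tpowMat t U (lh z) y * star (tpowMat t U (rh z) y')) =
      (∑ x, star (c x y) * tpowMat t U x y) * ∑ x, c x y' * star (tpowMat t U x y') := by
    intro y y'
    rw [sumZ (fun a b => star (c a y * star (c b y')) * (tpowMat t U a y * star (tpowMat t U b y'))), Finset.sum_mul_sum]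
    apply Finset.sum_congr rfl
    intro a _
    apply Finset.sum_congr rfl
    intro b _
    rw [star_mul, star_star]
    ring
  simp only [h1]
  rw [sumZ (fun a b => (∑ x, star (c x a) * tpowMat t U x a) * ∑ x, c x b * star (tpowMat t U x b)), ← Finset.sum_mul_sum]
  congr 1
  · rw [Finset.sum_comm]
  · rw [Finset.sum_comm, map_sum]
    apply Finset.sum_congr rfl
    intro x _
    rw [map_sum]
    apply Finset.sum_congr rfl
    intro y _
    rw [map_mul]
    change _ = star (star (c x y)) * _
    rw [star_star]
    rfl

theorem qf_sum (c : Matrix (Fin t → Y) (Fin t → Y) ℂ) {ι : Type*} (s : Finset ι)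
    (f : ι → Matrix (Fin t ⊕ Fin t → Y) (Fin t ⊕ Fin t → Y) ℂ) : qf c (∑ i ∈ s, f i) = ∑ i ∈ s, qf c (f i) := by
  simp only [qf, Matrix.mul_sum, Matrix.trace_sum]

theorem qf_smul (c : Matrix (Fin t → Y) (Fin t → Y) ℂ) (a : ℂ)
    (X : Matrix (Fin t ⊕ Fin t → Y) (Fin t ⊕ Fin t → Y) ℂ) : qf c (a • X) = a * qf c X := by
  simp only [qf, Matrix.mul_smul, Matrix.trace_smul, smul_eq_mul]

theorem qf_sub (c : Matrix (Fin t → Y) (Fin t → Y) ℂ)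
    (X X' : Matrix (Fin t ⊕ Fin t → Y) (Fin t ⊕ Fin t → Y) ℂ) : qf c (X - X') = qf c X - qf c X' := by
  simp only [qf, Matrix.mul_sub, Matrix.trace_sub]

theorem qf_haar (μ : Measure (Matrix.unitaryGroup Y ℂ)) [IsProbabilityMeasure μ] [μ.IsHaarMeasure]
    (c : Matrix (Fin t → Y) (Fin t → Y) ℂ) :
    ∫ U : Matrix.unitaryGroup Y ℂ, qf c (Phi t (U : Matrix Y Y ℂ)) ∂μ = qf c (Gm t Y) := by
  simp only [qf, Matrix.trace, Matrix.diag_apply, Matrix.mul_apply]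
  rw [integral_finsetSum]
  · apply Finset.sum_congr rfl
    intro z _
    rw [integral_finsetSum]
    · apply Finset.sum_congr rfl
      intro z' _
      rw [integral_const_mul, Gm_entry]
    · intro z' _
      exact (integrable_Phi t μ _ _).const_mul _
  · intro z _
    apply integrable_finsetSum
    intro z' _
    exact (integrable_Phi t μ _ _).const_mul _

/-- Columns of the projection matrix, as operators. -/
def colM (t : ℕ) (z : Fin t ⊕ Fin t → Y) : Matrix (Fin t → Y) (Fin t → Y) ℂ :=
  matV (mop (Gm t Y) (EuclideanSpace.single z 1))

theorem qf_Gm (B : Matrix (Fin t → Y) (Fin t → Y) ℂ)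
    (hB : ∀ z : Fin t ⊕ Fin t → Y, B * colM t z = colM t z * B) :
    qf B (Gm t Y) = ((∑ z : Fin t ⊕ Fin t → Y, hs (colM t z * B) : ℝ) : ℂ) := by
  have h1 : qf B (Gm t Y) = (Gm t Y * (kr B)ᴴ * Gm t Y).trace := by
    rw [qf]
    nth_rewrite 1 [← Gm_mul]
    rw [← Matrix.mul_assoc, Matrix.trace_mul_comm, Matrix.mul_assoc]
  rw [h1, Matrix.trace]
  push_cast
  apply Finset.sum_congr rfl
  intro z _
  rw [← trace_self, Matrix.diag_apply]
  have h2 : (Gm t Y * (kr B)ᴴ * Gm t Y) z z = ((colM t z) * (B * colM t z * Bᴴ)ᴴ).trace := by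
    rw [colM, ← matV_kr, Matrix.trace]
    simp only [Matrix.diag_apply, Matrix.mul_apply (M := matV _)]
    rw [← sumZ (fun x y => matV (mop (Gm t Y) (EuclideanSpace.single z 1)) x y *
      (matV (mop (kr B) (mop (Gm t Y) (EuclideanSpace.single z 1))))ᴴ y x), Matrix.mul_apply]
    apply Finset.sum_congr rfl
    intro b _
    rw [Matrix.conjTranspose_apply, matV, matV, elim_lr, mop_single, mul_comm]
    congr 1
    rw [← mop_mul, mop_single, ← Matrix.conjTranspose_apply, Matrix.conjTranspose_mul, Gm_herm]
  rw [h2, Matrix.conjTranspose_mul, Matrix.conjTranspose_conjTranspose, hB z, ← Matrix.mul_assoc]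

theorem col_sum : ∑ x : Fin t → Y, colM t (Sum.elim x x) = 1 := by
  have h1 : mop (Gm t Y) (vecM 1) = vecM 1 := by
    rw [mop_Gm]
    exact Submodule.starProjection_eq_self_iff.2 one_fix
  have h2 : vecM (1 : Matrix (Fin t → Y) (Fin t → Y) ℂ) = ∑ x : Fin t → Y, EuclideanSpace.single (Sum.elim x x) (1 : ℂ) := by
    ext z
    have e : (vecM (1 : Matrix (Fin t → Y) (Fin t → Y) ℂ)) z = (1 : Matrix (Fin t → Y) (Fin t → Y) ℂ) (lh z) (rh z) := rfl
    rw [e, WithLp.ofLp_sum, Finset.sum_apply, Matrix.one_apply]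
    have e2 : ∀ x : Fin t → Y, (EuclideanSpace.single (Sum.elim x x) (1 : ℂ) : EuclideanSpace ℂ (Fin t ⊕ Fin t → Y)) z =
        if x = lh z then (if lh z = rh z then 1 else 0) else 0 := by
      intro x
      rw [EuclideanSpace.single_apply]
      by_cases hx : x = lh z
      · rw [if_pos hx]
        congr 1
        apply propext
        constructor
        · intro h
          rw [h]; rfl
        · intro h
          rw [hx]
          nth_rewrite 2 [h]
          exact (elim_lr z).symm
      · rw [if_neg hx, if_neg]
        intro h
        exact hx (by rw [h]; rfl)
    rw [Finset.sum_congr rfl fun x _ => e2 x, Finset.sum_ite_eq' Finset.univ (lh z)]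
    simp
  have h3 := congrArg matV h1
  rw [matV_vecM, h2, map_sum] at h3
  rw [← h3]
  ext a b
  rw [Matrix.sum_apply]
  simp only [matV, colM]
  rw [WithLp.ofLp_sum, Finset.sum_apply]

theorem qf_lower (B : Matrix (Fin t → Y) (Fin t → Y) ℂ) :
    hs B ≤ Fintype.card (Fin t → Y) * ∑ z : Fin t ⊕ Fin t → Y, hs (colM t z * B) := by
  have h1 : B = ∑ x : Fin t → Y, colM t (Sum.elim x x) * B := by
    rw [← Finset.sum_mul, col_sum, one_mul]
  have h2 := hs_sum_le fun x : Fin t → Y => colM t (Sum.elim x x) * B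
  rw [← h1] at h2
  refine h2.trans ?_
  apply mul_le_mul_of_nonneg_left _ (Nat.cast_nonneg _)
  have h3 : ∑ z : Fin t ⊕ Fin t → Y, hs (colM t z * B) = ∑ x, ∑ y, hs (colM t (Sum.elim x y) * B) := by
    rw [← sumZ (fun x y => hs (colM t (Sum.elim x y) * B))]
    simp only [elim_lr]
  rw [h3]
  apply Finset.sum_le_sum
  intro x _
  exact Finset.single_le_sum (f := fun y => hs (colM t (Sum.elim x y) * B)) (fun y _ => hs_nonneg _) (Finset.mem_univ x)

/-- Replace `c` by its projection on the span of tensor powers. -/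
theorem exists_proj (c : Matrix (Fin t → Y) (Fin t → Y) ℂ) : ∃ B : Matrix (Fin t → Y) (Fin t → Y) ℂ,
    (∀ z : Fin t ⊕ Fin t → Y, B * colM t z = colM t z * B) ∧
    ∀ U : Matrix Y Y ℂ, Uᴴ * U = 1 → qf c (Phi t U) = qf B (Phi t U) := by
  let K : Submodule ℂ (EuclideanSpace ℂ (Fin t ⊕ Fin t → Y)) :=
    Submodule.span ℂ {w | ∃ U : Matrix Y Y ℂ, Uᴴ * U = 1 ∧ w = vecM (tpowMat t U)}
  have hin : ∀ (c' M : Matrix (Fin t → Y) (Fin t → Y) ℂ), inner ℂ (vecM c') (vecM M) = ∑ x, ∑ y, star (c' x y) * M x y := by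
    intro c' M
    rw [← sumZ (fun x y => star (c' x y) * M x y), PiLp.inner_apply]
    apply Finset.sum_congr rfl
    intro z _
    rw [RCLike.inner_apply, mul_comm]
    rfl
  refine ⟨matV (K.starProjection (vecM c)), ?_, ?_⟩
  · intro z
    have hz : mop (Gm t Y) (EuclideanSpace.single z 1) ∈ lieFix t Y := by
      rw [mop_Gm]; exact Submodule.starProjection_apply_mem (lieFix t Y) _
    have : ∀ w ∈ K, matV w * colM t z = colM t z * matV w := by
      intro w hw
      induction hw using Submodule.span_induction with
      | mem w h =>
        obtain ⟨U, hU, rfl⟩ := h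
        rw [matV_vecM]
        exact matV_comm hz hU
      | zero =>
        have : matV (0 : EuclideanSpace ℂ (Fin t ⊕ Fin t → Y)) = 0 := rfl
        rw [this, Matrix.zero_mul, Matrix.mul_zero]
      | add x y _ _ hx hy =>
        have : matV (x + y) = matV x + matV y := rfl
        rw [this, Matrix.add_mul, Matrix.mul_add, hx, hy]
      | smul a x _ hx =>
        have : matV (a • x) = a • matV x := rfl
        rw [this, Matrix.smul_mul, Matrix.mul_smul, hx]
    exact this _ (Submodule.starProjection_apply_mem K (vecM c))
  · intro U hU
    rw [qf_tpow, qf_tpow, ← hin, ← hin, vecM_matV]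
    have hw : vecM (tpowMat t U) ∈ K := Submodule.subset_span ⟨U, hU, rfl⟩
    rw [proj_symm, Submodule.starProjection_eq_self_iff.2 hw]

theorem qf_main (μ : Measure (Matrix.unitaryGroup Y ℂ)) [IsProbabilityMeasure μ] [μ.IsHaarMeasure]
    {ι : Type*} [Fintype ι] (V : ι → Matrix Y Y ℂ) (hV : ∀ i, (V i)ᴴ * V i = 1) {l ε : ℝ} (hl : 0 ≤ l)
    (h : ‖av (fun i => mop (Phi t (V i))) - (lieFix t Y).starProjection‖ ≤ l)
    (hε : (Fintype.card (Fin t → Y) : ℝ) ^ 2 * l ≤ ε)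
    (c : Matrix (Fin t → Y) (Fin t → Y) ℂ) : ∃ r1 r2 : ℝ,
      qf c (av fun i => Phi t (V i)) = (r1 : ℂ) ∧ qf c (Gm t Y) = (r2 : ℂ) ∧ |r1 - r2| ≤ ε * r2 := by
  obtain ⟨B, hB, hcB⟩ := exists_proj c
  have h1 : qf c (av fun i => Phi t (V i)) = qf B (av fun i => Phi t (V i)) := by
    simp only [av, qf_smul, qf_sum]
    congr 1
    exact Finset.sum_congr rfl fun i _ => hcB _ (hV i)
  have h2 : qf c (Gm t Y) = qf B (Gm t Y) := by
    rw [← qf_haar μ, ← qf_haar μ]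
    congr 1
    ext1 U
    exact hcB _ (ug_left U)
  refine ⟨(Fintype.card ι : ℝ)⁻¹ * ∑ i, ‖∑ x, ∑ y, star (B x y) * tpowMat t (V i) x y‖ ^ 2,
    ∑ z : Fin t ⊕ Fin t → Y, hs (colM t z * B), ?_, ?_, ?_⟩
  · rw [h1]
    simp only [av, qf_smul, qf_sum, qf_tpow]
    push_cast
    rfl
  · rw [h2, qf_Gm B hB]
  · have h3 : qf B (av fun i => Phi t (V i)) = (((Fintype.card ι : ℝ)⁻¹ * ∑ i, ‖∑ x, ∑ y, star (B x y) * tpowMat t (V i) x y‖ ^ 2 : ℝ) : ℂ) := by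
      simp only [av, qf_smul, qf_sum, qf_tpow]
      push_cast
      rfl
    have h4 := qf_Gm B hB
    have h5 : mop ((av fun i => Phi t (V i)) - Gm t Y) = av (fun i => mop (Phi t (V i))) - (lieFix t Y).starProjection := by
      ext1 v
      rw [mop_sub, ContinuousLinearMap.sub_apply, mop_Gm, av, av, mop_smul', mop_sum']
    have h6 := qf_bound B ((av fun i => Phi t (V i)) - Gm t Y) hl (by rw [h5]; exact h)
    rw [qf_sub, h3, h4, ← Complex.ofReal_sub, Complex.norm_real, Real.norm_eq_abs] at h6
    refine h6.trans ?_
    have h7 := qf_lower (t := t) B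
    set r2 := ∑ z : Fin t ⊕ Fin t → Y, hs (colM t z * B) with hr2
    have h8 : 0 ≤ r2 := Finset.sum_nonneg fun _ _ => hs_nonneg _
    have hD : (0 : ℝ) ≤ Fintype.card (Fin t → Y) := Nat.cast_nonneg _
    calc (Fintype.card (Fin t → Y) : ℝ) * hs B * l
        ≤ (Fintype.card (Fin t → Y) : ℝ) * (Fintype.card (Fin t → Y) * r2) * l := by gcongr
      _ = ((Fintype.card (Fin t → Y) : ℝ) ^ 2 * l) * r2 := by ring
      _ ≤ ε * r2 := by gcongr

end Quad

section Design
variable {Y : Type*} [Fintype Y] [DecidableEq Y] {t : ℕ}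

theorem quad_eq {m : ℕ} (v : Fin m → ((Fin t → Y) → ℂ)) (ψ : (Fin t → Y) → ℂ)
    (X : Matrix (Fin t ⊕ Fin t → Y) (Fin t ⊕ Fin t → Y) ℂ) :
    star ψ ⬝ᵥ (matV (mop X (vecM (∑ i, vecMulVec (v i) (star (v i))))) *ᵥ ψ) =
      ∑ j, qf (fun x a => ψ x * star (v j a)) X := by
  have h1 : star ψ ⬝ᵥ (matV (mop X (vecM (∑ i, vecMulVec (v i) (star (v i))))) *ᵥ ψ) =
      ∑ z : Fin t ⊕ Fin t → Y, ∑ z' : Fin t ⊕ Fin t → Y, ∑ j,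
        star (ψ (lh z)) * ψ (rh z) * (X z z' * (v j (lh z') * star (v j (rh z')))) := by
    have e : ∀ z : Fin t ⊕ Fin t → Y, ∑ z' : Fin t ⊕ Fin t → Y, ∑ j,
        star (ψ (lh z)) * ψ (rh z) * (X z z' * (v j (lh z') * star (v j (rh z')))) =
        star (ψ (lh z)) * (matV (mop X (vecM (∑ i, vecMulVec (v i) (star (v i))))) (lh z) (rh z) * ψ (rh z)) := by
      intro z
      rw [matV, elim_lr, mop_apply, Finset.sum_mul, Finset.mul_sum]
      apply Finset.sum_congr rfl
      intro z' _
      have e2 : (vecM (∑ i, vecMulVec (v i) (star (v i)))) z' = ∑ j, v j (lh z') * star (v j (rh z')) := by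
        change (∑ i, vecMulVec (v i) (star (v i))) (lh z') (rh z') = _
        rw [Matrix.sum_apply]
        rfl
      rw [e2, ← Finset.mul_sum, ← Finset.mul_sum]
      ring
    rw [Finset.sum_congr rfl fun z _ => e z, sumZ (fun x y => star (ψ x) *
      (matV (mop X (vecM (∑ i, vecMulVec (v i) (star (v i))))) x y * ψ y))]
    simp only [dotProduct, Matrix.mulVec, Finset.mul_sum]
    rfl
  rw [h1]
  simp only [qf, Matrix.trace, Matrix.diag_apply, Matrix.mul_apply]
  rw [Finset.sum_comm]
  conv_rhs => rw [Finset.sum_comm]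
  apply Finset.sum_congr rfl
  intro z' _
  rw [Finset.sum_comm]
  apply Finset.sum_congr rfl
  intro j _
  apply Finset.sum_congr rfl
  intro z _
  simp only [Matrix.conjTranspose_apply, kr, star_mul, star_star]
  ring

theorem haarChannel_herm (μ : Measure (Matrix.unitaryGroup Y ℂ)) {ρ : Matrix (Fin t → Y) (Fin t → Y) ℂ} (hρ : ρ.IsHermitian) :
    (haarChannel t μ ρ).IsHermitian := by
  ext x y
  rw [Matrix.conjTranspose_apply, haarChannel, haarChannel]
  have h := integral_conj (μ := μ) (𝕜 := ℂ) (f := fun U : Matrix.unitaryGroup Y ℂ =>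
    (tpowMat t (U : Matrix Y Y ℂ) * ρ * (tpowMat t (U : Matrix Y Y ℂ))ᴴ) y x)
  refine h.symm.trans ?_
  congr 1
  ext1 U
  have h2 : (tpowMat t (U : Matrix Y Y ℂ) * ρ * (tpowMat t (U : Matrix Y Y ℂ))ᴴ).IsHermitian :=
    isHermitian_mul_mul_conjTranspose _ hρ
  exact h2.apply x y

theorem herm_real_smul {J : Type*} {A : Matrix J J ℂ} (h : A.IsHermitian) (r : ℝ) : ((r : ℂ) • A).IsHermitian := by
  rw [Matrix.IsHermitian, Matrix.conjTranspose_smul, h]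
  congr 1
  exact Complex.conj_ofReal r

theorem design_of_gap (μ : Measure (Matrix.unitaryGroup Y ℂ)) [IsProbabilityMeasure μ] [μ.IsHaarMeasure]
    {ι : Type*} [Fintype ι] (V : ι → Matrix Y Y ℂ) (hV : ∀ i, (V i)ᴴ * V i = 1) {l ε : ℝ} (hl : 0 ≤ l)
    (h : ‖av (fun i => mop (Phi t (V i))) - (lieFix t Y).starProjection‖ ≤ l)
    (hε : (Fintype.card (Fin t → Y) : ℝ) ^ 2 * l ≤ ε) :
    IsApproxDesign t ε μ (fun _ : ι => (Fintype.card ι : ℝ)⁻¹) V := by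
  intro ρ hρ
  set A := ∑ i, (((Fintype.card ι : ℝ)⁻¹ : ℝ) : ℂ) • (tpowMat t (V i) * ρ * (tpowMat t (V i))ᴴ) with hA
  have hAh : A.IsHermitian := by
    rw [Matrix.IsHermitian, hA, Matrix.conjTranspose_sum]
    apply Finset.sum_congr rfl
    intro i _
    exact herm_real_smul (isHermitian_mul_mul_conjTranspose _ hρ.1) _
  have hHh := haarChannel_herm μ hρ.1
  have hA2 : A = matV (mop (av fun i => Phi t (V i)) (vecM ρ)) := by
    rw [hA, ← Finset.smul_sum]
    simp only [tpow_channel]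
    rw [av, mop_smul, mop_sum]
    push_cast
    ext x y
    rw [Matrix.smul_apply, Matrix.sum_apply]
    simp only [matV]
    rw [WithLp.ofLp_smul, Pi.smul_apply, WithLp.ofLp_sum, Finset.sum_apply]
  obtain ⟨m, v, hv⟩ := (Matrix.posSemidef_iff_eq_sum_vecMulVec).1 hρ
  have key : ∀ ψ, ∃ r1 r2 : ℝ, star ψ ⬝ᵥ (A *ᵥ ψ) = (r1 : ℂ) ∧ star ψ ⬝ᵥ (haarChannel t μ ρ *ᵥ ψ) = (r2 : ℂ) ∧
      |r1 - r2| ≤ ε * r2 := by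
    intro ψ
    choose r1 r2 h1 h2 h3 using fun j => qf_main μ V hV hl h hε (fun x a => ψ x * star (v j a))
    refine ⟨∑ j, r1 j, ∑ j, r2 j, ?_, ?_, ?_⟩
    · rw [hA2, hv, quad_eq]
      push_cast
      exact Finset.sum_congr rfl fun j _ => h1 j
    · rw [haarChannel_eq, hv, quad_eq]
      push_cast
      exact Finset.sum_congr rfl fun j _ => h2 j
    · rw [← Finset.sum_sub_distrib, Finset.mul_sum]
      exact (Finset.abs_sum_le_sum_abs _ _).trans (Finset.sum_le_sum fun j _ => h3 j)
  constructor
  · apply Matrix.PosSemidef.of_dotProduct_mulVec_nonneg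
    · exact hAh.sub (herm_real_smul hHh _)
    · intro ψ
      obtain ⟨r1, r2, h1, h2, h3⟩ := key ψ
      rw [Matrix.sub_mulVec, Matrix.smul_mulVec, dotProduct_sub, dotProduct_smul, h1, h2, smul_eq_mul,
        ← Complex.ofReal_mul, ← Complex.ofReal_sub]
      rw [Complex.zero_le_real]
      have := abs_le.1 h3
      linarith
  · apply Matrix.PosSemidef.of_dotProduct_mulVec_nonneg
    · exact (herm_real_smul hHh _).sub hAh
    · intro ψ
      obtain ⟨r1, r2, h1, h2, h3⟩ := key ψ
      rw [Matrix.sub_mulVec, Matrix.smul_mulVec, dotProduct_sub, dotProduct_smul, h1, h2, smul_eq_mul,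
        ← Complex.ofReal_mul, ← Complex.ofReal_sub]
      rw [Complex.zero_le_real]
      have := abs_le.1 h3
      linarith

end Design

theorem block_L_B_k_is_approx_design
    (UB UM : Finset (Matrix.unitaryGroup (Fin 4) ℂ))
    (hMB : UM ⊆ UB) (hMne : UM.Nonempty)
    (hMinv : ∀ U ∈ UM, U⁻¹ ∈ UM)
    (hMalg : ∀ U ∈ UM, ∀ i j, IsAlgebraic ℚ ((U : Matrix (Fin 4) (Fin 4) ℂ) i j))
    (hdense : Dense ((Subgroup.closure (↑UB : Set (Matrix.unitaryGroup (Fin 4) ℂ)) :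
        Subgroup (Matrix.unitaryGroup (Fin 4) ℂ)) : Set (Matrix.unitaryGroup (Fin 4) ℂ)))
    (t : ℕ) (ht : 1 ≤ t) (εd : ℝ) (hεd0 : 0 < εd) (hεd1 : εd < 1) :
    ∃ C : ℝ, 0 < C ∧ C < 1 ∧
      ∀ (n k L : ℕ) (ε' : ℝ), 0 < ε' → ε' < 1 - Pgap t →
        ⌊(2.5 : ℝ) * Real.logb 2 (4 * t)⌋ ≤ (n : ℤ) →
        (10 * t + (n : ℝ) ^ 2 * t - n * t + n + Real.logb 2 (1 / ε')) /
            Real.logb 2 (1 / (1 + (C - 1) * ((UM.card : ℝ) / (UB.card : ℝ)))) ≤ (k : ℝ) →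
        (4 * n * t + Real.logb 2 (1 / εd)) / Real.logb 2 (1 / (ε' + Pgap t)) ≤ (L : ℝ) →
        ∀ μH : Measure (Matrix.unitaryGroup (Fin n → Fin 2) ℂ),
          μH.IsHaarMeasure → IsProbabilityMeasure μH →
          IsApproxDesign t εd μH
            (fun _ : Fin L → (Fin (n / 2) → (Fin k → {x // x ∈ UB})) ×
                (Fin ((n - 1) / 2) → (Fin k → {x // x ∈ UB})) =>
              (Fintype.card (Fin L → (Fin (n / 2) → (Fin k → {x // x ∈ UB})) ×
                (Fin ((n - 1) / 2) → (Fin k → {x // x ∈ UB}))) : ℝ)⁻¹)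
            (fun π =>
              (List.ofFn fun l : Fin L =>
                blockUnitary n
                  (fun i => wordMat fun j => ((π l).1 i j : Matrix.unitaryGroup (Fin 4) ℂ))
                  (fun i => wordMat fun j => ((π l).2 i j : Matrix.unitaryGroup (Fin 4) ℂ))).prod) := by
  have hBne : UB.Nonempty := hMne.mono hMB
  have hMpos : (0 : ℝ) < UM.card := by exact_mod_cast hMne.card_pos
  have hBpos : (0 : ℝ) < UB.card := by exact_mod_cast hBne.card_pos
  have hcard : (UM.card : ℝ) ≤ UB.card := by exact_mod_cast Finset.card_le_card hMB
  have ha0 : 0 < (UM.card : ℝ) / UB.card := div_pos hMpos hBpos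
  have ha1 : (UM.card : ℝ) / UB.card ≤ 1 := by rw [div_le_one hBpos]; exact hcard
  obtain ⟨K, r, hK, hr0, hr1, hconv⟩ := gate_conv UB hBne hdense t
  obtain ⟨C, hC0, hC1, hC⟩ := choose_C hK hr0 hr1 ht ha0 ha1
  refine ⟨C, hC0, hC1, ?_⟩
  intro n k L ε' he0 he1 hn hk hL μH hμ1 hμ2
  have hn2 := n_ge ht hn
  have hP := Pgap_pos ht
  obtain ⟨hKk, hnr⟩ := hC n k ε' he0 (by linarith) (by omega) hk
  obtain ⟨hL1, hL2⟩ := L_bound ht (by omega) (by linarith : 0 < ε' + Pgap t) (by linarith) hεd0 hεd1 hL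
  have hrk : 0 ≤ r ^ k := by positivity
  have hb := blockAv_pow UB n t k L hBne hn2 ht hL1 hrk (hconv k hKk)
  rw [← ensembleAv_eq] at hb
  have hb2 : (n * r ^ k + Pgap t) ^ L ≤ (ε' + Pgap t) ^ L :=
    pow_le_pow_left₀ (by positivity) (by linarith) L
  refine design_of_gap μH _ ?_ (l := (ε' + Pgap t) ^ L) (by positivity) (hb.trans hb2) ?_
  · intro π
    exact list_unitary _ fun l => block_unitary' UB n k (π l)
  · have : (Fintype.card (Fin t → (Fin n → Fin 2)) : ℝ) = (2 : ℝ) ^ (n * t) := by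
      rw [Fintype.card_fun, Fintype.card_fun, Fintype.card_fin, Fintype.card_fin, Fintype.card_fin, ← pow_mul]
      push_cast; rfl
    rw [this]
    exact hL2

end
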